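/- Let G be a loopless multigraph, let k be a positive integer, and let S_1, S_2, …, S_t, R ⊆ V(G) be such that (S_1 ∪ S_2 ∪ … ∪ S_t) ∩ R = ∅, the sets S_1,…,S_t are pairwise vertex-disjoint, each S_i is 36k-edge-connected in G, |S_i| ≥ 2 for each i, and every vertex in R is incident to at least 34k edges. Then there exist k pairwise edge-disjoint (S_1, S_2, …, S_t)-subgraphs of G that balance R. -/

import Mathlib

/-!
Multigraphs are modelled by a vertex type `V`, an edge type `E`, and an
incidence map `ends : E → Sym2 V` giving the (unordered) pair of endpoints
of each edge.  Subgraphs are identified with their edge sets (`Set E`).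
-/

namespace SteinerPacking

variable {V E : Type}

/-- The set of edges incident to a vertex `u` (denoted `E(u)` in the paper). -/
def incEdges (ends : E → Sym2 V) (u : V) : Set E := {e | u ∈ ends e}

/-- The degree `d(u) = |E(u)|` of a vertex. -/
noncomputable def deg (ends : E → Sym2 V) (u : V) : ℕ := (incEdges ends u).ncard

/-- One step along an edge of the edge set `F`. -/
def Step (ends : E → Sym2 V) (F : Set E) (a b : V) : Prop := ∃ e ∈ F, ends e = s(a, b)

/-- `a` and `b` are joined by a walk using only edges in `F`. -/
def Reaches (ends : E → Sym2 V) (F : Set E) (a b : V) : Prop :=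
  Relation.ReflTransGen (Step ends F) a b

/-- The vertex set `S` is connected in the subgraph with edge set `F`. -/
def ConnectsSet (ends : E → Sym2 V) (F : Set E) (S : Set V) : Prop :=
  ∀ a ∈ S, ∀ b ∈ S, Reaches ends F a b

/-- A walk from `u` to `w` given by a list of edges. -/
inductive IsWalk (ends : E → Sym2 V) : V → V → List E → Prop
  | nil (v : V) : IsWalk ends v v []
  | cons {u v w : V} {e : E} {l : List E} :
      ends e = s(u, v) → IsWalk ends v w l → IsWalk ends u w (e :: l)

/-- A path from `u` to `v` using edges of `F` (a walk with no repeated edges). -/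
def IsPathIn (ends : E → Sym2 V) (F : Set E) (u v : V) (l : List E) : Prop :=
  IsWalk ends u v l ∧ l.Nodup ∧ ∀ e ∈ l, e ∈ F

/-- There are `n` pairwise edge-disjoint paths from `u` to `v` inside `F`. -/
def EdgeDisjointPathsIn (ends : E → Sym2 V) (F : Set E) (n : ℕ) (u v : V) : Prop :=
  ∃ P : Fin n → List E, (∀ i, IsPathIn ends F u v (P i)) ∧
    ∀ i j, i ≠ j → ∀ e ∈ P i, e ∉ P j

/-- `S` is `n`-edge-connected in the (sub)graph with edge set `F`:
any two distinct vertices of `S` are joined by `n` edge-disjoint paths. -/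
def EdgeConnectedIn (ends : E → Sym2 V) (F : Set E) (S : Set V) (n : ℕ) : Prop :=
  ∀ a ∈ S, ∀ b ∈ S, a ≠ b → EdgeDisjointPathsIn ends F n a b

/-- A family of subgraphs (edge sets) is pairwise edge-disjoint. -/
def PairwiseEdgeDisjoint {k : ℕ} (H : Fin k → Set E) : Prop :=
  ∀ i j, i ≠ j → Disjoint (H i) (H j)

/-- `v` is a cut vertex of the subgraph with edge set `H`: some two vertices
distinct from `v` are connected in `H` but not after removing `v`. -/
def IsCutVertexOf (ends : E → Sym2 V) (H : Set E) (v : V) : Prop :=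
  ∃ a b : V, a ≠ v ∧ b ≠ v ∧ Reaches ends H a b ∧
    ¬ Reaches ends {e ∈ H | v ∉ ends e} a b

/-- A subpartition of `E(v)` into `k` (possibly empty) parts. -/
def IsSubpartitionAt {k : ℕ} (ends : E → Sym2 V) (v : V) (P : Fin k → Set E) : Prop :=
  (∀ i, P i ⊆ incEdges ends v) ∧ ∀ i j, i ≠ j → Disjoint (P i) (P j)

/-- A balanced partition of `E(v)` into `k` parts: each part has ≥ 2 edges. -/
def IsBalancedPartitionAt {k : ℕ} (ends : E → Sym2 V) (v : V) (P : Fin k → Set E) : Prop :=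
  IsSubpartitionAt ends v P ∧ (⋃ i, P i) = incEdges ends v ∧ ∀ i, 2 ≤ (P i).ncard

/-- A balanced subpartition of `E(v)`: one extendable to a balanced partition. -/
def IsBalancedSubpartitionAt {k : ℕ} (ends : E → Sym2 V) (v : V) (P : Fin k → Set E) : Prop :=
  IsSubpartitionAt ends v P ∧
    ∃ P' : Fin k → Set E, IsBalancedPartitionAt ends v P' ∧ ∀ i, P i ⊆ P' i

/-- The subgraphs `H 1, …, H k` extend the subpartition `P` at `v`:
`P i ⊆ H i` and `v` is not a cut vertex of any `H i`. -/
def Extend {k : ℕ} (ends : E → Sym2 V) (v : V) (P H : Fin k → Set E) : Prop :=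
  ∀ i, P i ⊆ H i ∧ ¬ IsCutVertexOf ends (H i) v

/-- The subgraphs `H 1, …, H k` balance the vertex `u`. -/
def BalanceVertex {k : ℕ} (ends : E → Sym2 V) (H : Fin k → Set E) (u : V) : Prop :=
  IsBalancedSubpartitionAt ends u (fun i => incEdges ends u ∩ H i)

/-- The subgraphs `H 1, …, H k` balance every vertex of `T`. -/
def BalanceSet {k : ℕ} (ends : E → Sym2 V) (H : Fin k → Set E) (T : Set V) : Prop :=
  ∀ u ∈ T, BalanceVertex ends H u

/-- A loopless multigraph. -/
def Loopless (ends : E → Sym2 V) : Prop := ∀ e : E, ¬ (ends e).IsDiag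

/-- The set of neighbors of a vertex. -/
def neighbors (ends : E → Sym2 V) (u : V) : Set V := {w | ∃ e, ends e = s(u, w)}


section

open Module Finset
open scoped Classical

/-- A rank condition guaranteeing that subspaces can be distributed over `J` so that each class,
together with its initial subspace, spans everything. -/
theorem exists_distribution_spanning {I J W : Type} [Fintype J] [AddCommGroup W] [Module ℚ W]
    [FiniteDimensional ℚ W] (L : I → Submodule ℚ W) (s : Finset I) :
    ∀ U : J → Submodule ℚ W,
      (∀ A ⊆ s, Fintype.card J * finrank ℚ W ≤
        (s \ A).card + ∑ j, finrank ℚ ↥(U j ⊔ A.sup L)) →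
      ∃ φ : I → Option J, ∀ j, U j ⊔ (s.filter (φ · = some j)).sup L = ⊤ := by
  induction s using Finset.induction_on with
  | empty =>
    intro U h
    refine ⟨fun _ => none, fun j => ?_⟩
    have h0 := h ∅ (by simp)
    have hsum : ∑ j, finrank ℚ ↥(U j ⊔ (∅ : Finset I).sup L) = ∑ j, finrank ℚ ↥(U j) :=
      Finset.sum_congr rfl fun j _ => by rw [Finset.sup_empty, sup_bot_eq]
    rw [hsum, sdiff_self, bot_eq_empty, card_empty, zero_add] at h0
    have hle : ∀ j ∈ (univ : Finset J), finrank ℚ ↥(U j) ≤ finrank ℚ W :=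
      fun j _ => Submodule.finrank_le _
    have heq := (Finset.sum_eq_sum_iff_of_le hle).1
      (le_antisymm (Finset.sum_le_sum hle) (by simpa using h0))
    simpa using Submodule.eq_top_of_finrank_eq (heq j (mem_univ j))
  | insert x s hx ih =>
    intro U h
    by_contra hno
    -- every way of using `x` is blocked by some tight set
    let f : Finset I → ℕ := fun A => (s \ A).card + 1 + ∑ j, finrank ℚ ↥(U j ⊔ A.sup L)
    have hf : ∀ A ⊆ s, Fintype.card J * finrank ℚ W ≤ f A := by
      intro A hA
      have := h A (hA.trans (subset_insert _ _))
      rw [insert_sdiff_of_notMem _ (fun hh => hx (hA hh)),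
        card_insert_of_notMem (fun hh => hx (mem_sdiff.1 hh).1)] at this
      exact this
    have hnull : ∃ A ⊆ s, f A ≤ Fintype.card J * finrank ℚ W := by
      by_contra! hc
      obtain ⟨φ, hφ⟩ := ih U (fun A hA => by have := hc A hA; simp only [f] at this; omega)
      refine hno ⟨fun y => if y = x then none else φ y, fun j => ?_⟩
      rw [← top_le_iff, ← hφ j]
      refine sup_le_sup_left (Finset.sup_mono fun y hy => ?_) _
      rw [mem_filter] at hy ⊢
      exact ⟨mem_insert_of_mem hy.1, by
        have hyx : y ≠ x := fun hh => hx (hh ▸ hy.1)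
        simpa [hyx] using hy.2⟩
    have hblock : ∀ j, ∃ A ⊆ s, f A ≤ Fintype.card J * finrank ℚ W ∧ L x ≤ U j ⊔ A.sup L := by
      intro j
      by_contra! hc
      obtain ⟨φ, hφ⟩ := ih (Function.update U j (U j ⊔ L x)) (fun A hA => by
        by_contra hlt
        have hmono : ∀ i ∈ (univ : Finset J), finrank ℚ ↥(U i ⊔ A.sup L) ≤
            finrank ℚ ↥(Function.update U j (U j ⊔ L x) i ⊔ A.sup L) := by
          intro i _
          refine Submodule.finrank_mono (sup_le_sup_right ?_ _)
          by_cases hij : i = j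
          · subst hij; simp
          · simp [hij]
        have hsum := Finset.sum_le_sum hmono
        have hfA := hf A hA
        refine hc A hA (by simp only [f]; omega) ?_
        have heq := (Finset.sum_eq_sum_iff_of_le hmono).1 (by simp only [f] at hfA; omega)
          j (mem_univ j)
        rw [Function.update_self] at heq
        have := Submodule.eq_of_le_of_finrank_eq
          (sup_le_sup_right (le_sup_left : U j ≤ U j ⊔ L x) (A.sup L)) heq
        rw [this]
        exact le_sup_of_le_left le_sup_right)
      refine hno ⟨fun y => if y = x then some j else φ y, fun i => ?_⟩
      rw [← top_le_iff, ← hφ i]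
      have hsub : (s.filter (φ · = some i)) ⊆
          (insert x s).filter (fun y => (if y = x then some j else φ y) = some i) := by
        intro y hy
        rw [mem_filter] at hy ⊢
        exact ⟨mem_insert_of_mem hy.1, by
        have hyx : y ≠ x := fun hh => hx (hh ▸ hy.1)
        simpa [hyx] using hy.2⟩
      refine sup_le ?_ (le_sup_of_le_right (Finset.sup_mono hsub))
      by_cases hij : i = j
      · subst hij
        rw [Function.update_self]
        exact sup_le_sup_left (Finset.le_sup (f := L) (by simp)) _
      · rw [Function.update_of_ne hij]
        exact le_sup_left
    have hunion : ∀ A ⊆ s, ∀ B ⊆ s, f A ≤ Fintype.card J * finrank ℚ W →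
        f B ≤ Fintype.card J * finrank ℚ W → f (A ∪ B) ≤ Fintype.card J * finrank ℚ W := by
      intro A hA B hB hAt hBt
      have h1 := hf (A ∩ B) (inter_subset_left.trans hA)
      have h2 : ∀ j ∈ (univ : Finset J), finrank ℚ ↥(U j ⊔ (A ∪ B).sup L) +
          finrank ℚ ↥(U j ⊔ (A ∩ B).sup L) ≤
          finrank ℚ ↥(U j ⊔ A.sup L) + finrank ℚ ↥(U j ⊔ B.sup L) := by
        intro j _
        have hd := Submodule.finrank_sup_add_finrank_inf_eq (U j ⊔ A.sup L) (U j ⊔ B.sup L)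
        refine hd ▸ Nat.add_le_add (Submodule.finrank_mono ?_) (Submodule.finrank_mono ?_)
        · rw [Finset.sup_union, sup_sup_distrib_left]
        · exact le_inf (sup_le_sup_left (Finset.sup_mono inter_subset_left) _)
            (sup_le_sup_left (Finset.sup_mono inter_subset_right) _)
      have h3 := Finset.sum_le_sum h2
      rw [Finset.sum_add_distrib, Finset.sum_add_distrib] at h3
      have h4 := card_union_add_card_inter (s \ A) (s \ B)
      rw [← sdiff_inter_distrib_right, ← Finset.sdiff_union_distrib] at h4
      simp only [f] at *
      omega
    obtain ⟨A, hA, hmax⟩ := Finset.exists_max_image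
      (s.powerset.filter (fun A => f A ≤ Fintype.card J * finrank ℚ W)) card
      (by obtain ⟨A, hA, hA'⟩ := hnull; exact ⟨A, by simp [hA, hA']⟩)
    rw [mem_filter, mem_powerset] at hA
    have hall : ∀ j, L x ≤ U j ⊔ A.sup L := by
      intro j
      obtain ⟨B, hB, hBt, hBx⟩ := hblock j
      have hAB : A ∪ B = A := (eq_of_subset_of_card_le subset_union_left
        (hmax (A ∪ B) (by
          rw [mem_filter, mem_powerset]
          exact ⟨union_subset hA.1 hB, hunion A hA.1 B hB hA.2 hBt⟩))).symm
      exact hBx.trans (sup_le_sup_left (Finset.sup_mono (union_eq_left.1 hAB)) _)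
    have hfin := h (insert x A) (insert_subset_insert _ hA.1)
    have hs : insert x s \ insert x A = s \ A := by
      ext y
      simp only [mem_sdiff, mem_insert]
      constructor
      · rintro ⟨rfl | h1, h2⟩
        · simp at h2
        · exact ⟨h1, fun h3 => h2 (Or.inr h3)⟩
      · rintro ⟨h1, h2⟩
        exact ⟨Or.inr h1, by rintro (rfl | h3); exacts [hx h1, h2 h3]⟩
    have hU : ∀ j, U j ⊔ (insert x A).sup L = U j ⊔ A.sup L := by
      intro j
      rw [Finset.sup_insert]
      exact le_antisymm (sup_le le_sup_left (sup_le (hall j) le_sup_right))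
        (sup_le_sup_left le_sup_right _)
    have hsum : ∑ j, finrank ℚ ↥(U j ⊔ (insert x A).sup L) = ∑ j, finrank ℚ ↥(U j ⊔ A.sup L) :=
      Finset.sum_congr rfl fun j _ => by rw [hU j]
    rw [hs, hsum] at hfin
    have := hA.2
    simp only [f] at this
    omega

/-- The set `X` meets two classes of `r`. -/
def Crosses {B : Type} (r : Setoid B) (X : Set B) : Prop := ∃ a ∈ X, ∃ b ∈ X, ¬ r a b

/-- The set `X` is on one side of `C`. -/
def OneSided {B : Type} (C X : Set B) : Prop := ∀ a ∈ X, ∀ b ∈ X, (a ∈ C ↔ b ∈ C)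

theorem OneSided.compl {B : Type} {C X : Set B} (h : OneSided C X) : OneSided Cᶜ X :=
  fun a ha b hb => not_congr (h a ha b hb)

/-- Hypergraph version of the tree packing theorem of Nash-Williams and Tutte, in which each of the
spanning subhypergraphs comes with an initial hyperedge `M j`. -/
theorem exists_connected_distribution {B I J : Type} [Fintype B] [Fintype J]
    (s : Finset I) (N : I → Set B) (M : J → Set B)
    (h : ∀ r : Setoid B, Fintype.card J * Fintype.card (Quotient r) ≤
      Fintype.card J + (s.filter (fun x => Crosses r (N x))).card +
        (univ.filter (fun j => Crosses r (M j))).card) :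
    ∃ φ : I → Option J, ∀ j, ∀ C : Set B, OneSided C (M j) →
      (∀ x ∈ s, φ x = some j → OneSided C (N x)) → OneSided C Set.univ := by
  rcases isEmpty_or_nonempty B with hB | ⟨⟨o⟩⟩
  · exact ⟨fun _ => none, fun _ _ _ _ a => hB.elim a⟩
  let W := {b : B // b ≠ o} → ℚ
  let vec : B → W := fun a b => if b.1 = a then 1 else 0
  have hveco : vec o = 0 := by
    funext b
    exact if_neg b.2
  have hspan : Submodule.span ℚ (Set.range vec) = ⊤ := by
    rw [← top_le_iff, ← (Pi.basisFun ℚ {b : B // b ≠ o}).span_eq]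
    refine Submodule.span_mono ?_
    rintro _ ⟨b, rfl⟩
    refine ⟨b.1, ?_⟩
    funext c
    simp only [vec, Pi.basisFun_apply, Pi.single_apply, Subtype.ext_iff]
  let D : Set B → Submodule ℚ W := fun X =>
    Submodule.span ℚ {w | ∃ a ∈ X, ∃ b ∈ X, w = vec a - vec b}
  have hmem : ∀ X a b, a ∈ X → b ∈ X → vec a - vec b ∈ D X := fun X a b ha hb =>
    Submodule.subset_span ⟨a, ha, b, hb, rfl⟩
  obtain ⟨φ, hφ⟩ := exists_distribution_spanning (fun x => D (N x)) s (fun j => D (M j)) (by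
    intro A hA
    set VA : Submodule ℚ W := A.sup (fun x => D (N x)) with hVA
    let r : Setoid B := ⟨fun a b => vec a - vec b ∈ VA, fun a => by simp,
      fun {a b} hab => by have := VA.neg_mem hab; simpa using this,
      fun {a b c} hab hbc => by have := VA.add_mem hab hbc; simpa using this⟩
    have hr : ∀ a b, r a b ↔ vec a - vec b ∈ VA := fun a b => Iff.rfl
    have hcross : s.filter (fun x => Crosses r (N x)) ⊆ s \ A := by
      intro x hx
      rw [mem_filter] at hx
      rw [mem_sdiff]
      refine ⟨hx.1, fun hxA => ?_⟩
      obtain ⟨a, ha, b, hb, hab⟩ := hx.2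
      exact hab ((hr a b).2 (Finset.le_sup (f := fun x => D (N x)) hxA (hmem _ a b ha hb)))
    have hdim : finrank ℚ W + 1 ≤ finrank ℚ VA + Fintype.card (Quotient r) := by
      have hq := Submodule.finrank_quotient_add_finrank VA
      let g : Quotient r → W ⧸ VA := Quotient.lift (fun a => VA.mkQ (vec a)) (by
        intro a b hab
        simp only [Submodule.mkQ_apply]
        exact (Submodule.Quotient.eq VA).2 hab)
      have htop : Submodule.span ℚ (((univ.erase (Quotient.mk r o)).image g : Finset _) :
          Set (W ⧸ VA)) = ⊤ := by
        rw [← top_le_iff, ← Submodule.range_mkQ VA, LinearMap.range_eq_map, ← hspan,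
          Submodule.map_span, Submodule.span_le]
        rintro _ ⟨_, ⟨a, rfl⟩, rfl⟩
        by_cases hao : Quotient.mk r a = Quotient.mk r o
        · have h1 : g (Quotient.mk r a) = g (Quotient.mk r o) := by rw [hao]
          have h2 : VA.mkQ (vec a) = VA.mkQ (vec o) := h1
          rw [SetLike.mem_coe, h2, hveco, map_zero]
          exact Submodule.zero_mem _
        · refine Submodule.subset_span ?_
          rw [mem_coe, mem_image]
          exact ⟨Quotient.mk r a, by simp [hao], rfl⟩
      have hle := finrank_span_finset_le_card (R := ℚ) ((univ.erase (Quotient.mk r o)).image g)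
      rw [Set.finrank, htop, finrank_top] at hle
      have hle2 := card_image_le (s := univ.erase (Quotient.mk r o)) (f := g)
      rw [card_erase_of_mem (mem_univ _), card_univ] at hle2
      have : 0 < Fintype.card (Quotient r) := Fintype.card_pos_iff.2 ⟨Quotient.mk r o⟩
      omega
    have hj : ∀ j ∈ (univ : Finset J), finrank ℚ VA + (if Crosses r (M j) then 1 else 0) ≤
        finrank ℚ ↥(D (M j) ⊔ VA) := by
      intro j _
      split_ifs with hc
      · obtain ⟨a, ha, b, hb, hab⟩ := hc
        refine Submodule.finrank_lt_finrank_of_lt (lt_of_le_of_ne le_sup_right fun heq => hab ?_)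
        rw [hr, heq]
        exact Submodule.mem_sup_left (hmem _ a b ha hb)
      · exact Submodule.finrank_mono le_sup_right
    have hsum := Finset.sum_le_sum hj
    rw [Finset.sum_add_distrib, Finset.sum_const, card_univ, smul_eq_mul, ← card_filter] at hsum
    have h1 := h r
    have h2 := card_le_card hcross
    have h3 := Nat.mul_le_mul_left (Fintype.card J) hdim
    rw [mul_add, mul_add, mul_one] at h3
    omega)
  refine ⟨φ, fun j C hM hN => ?_⟩
  have key : ∀ C : Set B, o ∉ C → OneSided C (M j) →
      (∀ x ∈ s, φ x = some j → OneSided C (N x)) → ∀ a, a ∉ C := by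
    intro C ho hM hN a ha
    let f : W →ₗ[ℚ] ℚ := ∑ b : {b : B // b ≠ o}, if b.1 ∈ C then LinearMap.proj b else 0
    have hf : ∀ a, f (vec a) = if a ∈ C then 1 else 0 := by
      intro a
      have h0 : f (vec a) =
          ∑ b : {b : B // b ≠ o}, if b.1 = a then (if a ∈ C then 1 else 0) else 0 := by
        simp only [f, LinearMap.sum_apply]
        refine Finset.sum_congr rfl fun b _ => ?_
        by_cases hba : b.1 = a
        · rw [if_pos hba]
          subst hba
          split_ifs
          · exact if_pos rfl
          · rfl
        · rw [if_neg hba]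
          split_ifs
          · exact if_neg hba
          · rfl
      rw [h0]
      by_cases hao : a = o
      · subst hao
        rw [if_neg ho]
        simp
      · rw [Finset.sum_eq_single ⟨a, hao⟩]
        · simp
        · intro b _ hb
          rw [if_neg (fun hh => hb (Subtype.ext hh))]
        · simp
    have hker : ∀ X, OneSided C X → D X ≤ LinearMap.ker f := by
      intro X hX
      refine Submodule.span_le.2 ?_
      rintro _ ⟨a, ha, b, hb, rfl⟩
      rw [SetLike.mem_coe, LinearMap.mem_ker, map_sub, hf, hf, sub_eq_zero]
      simp only [hX a ha b hb]
    have htop : (⊤ : Submodule ℚ W) ≤ LinearMap.ker f := by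
      rw [← hφ j]
      refine sup_le (hker _ hM) (Finset.sup_le fun x hx => ?_)
      rw [mem_filter] at hx
      exact hker _ (hN x hx.1 hx.2)
    have := htop (Submodule.mem_top (x := vec a))
    rw [LinearMap.mem_ker, hf, if_pos ha] at this
    exact one_ne_zero this
  intro a _ b _
  by_cases ho : o ∈ C
  · have := key Cᶜ (fun h => h ho) hM.compl (fun x hx hxj => (hN x hx hxj).compl)
    simp only [Set.mem_compl_iff, not_not] at this
    simp [this a, this b]
  · have := key C ho hM hN
    simp [this a, this b]

section

variable {B ν : Type}

theorem oneSided_compl_iff {C X : Set B} : OneSided Cᶜ X ↔ OneSided C X :=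
  ⟨fun h => by simpa using h.compl, OneSided.compl⟩

theorem oneSided_iff_subset {C X : Set B} : OneSided C X ↔ X ⊆ C ∨ X ⊆ Cᶜ := by
  constructor
  · intro h
    by_cases hX : ∃ a ∈ X, a ∈ C
    · obtain ⟨a, ha, haC⟩ := hX
      exact Or.inl fun b hb => (h a ha b hb).1 haC
    · push Not at hX
      exact Or.inr hX
  · rintro (h | h) a ha b hb
    · simp [h ha, h hb]
    · have h1 := h ha
      have h2 := h hb
      simp only [Set.mem_compl_iff] at h1 h2
      simp [h1, h2]

/-- The nodes of `s` whose feet lie on both sides of `X`. -/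
noncomputable def crossing (N : ν → Set B) (s : Finset ν) (X : Set B) : Finset ν :=
  s.filter fun x => ¬ OneSided X (N x)

/-- The nodes of `s` whose feet all lie in `X`. -/
noncomputable def inside (N : ν → Set B) (s : Finset ν) (X : Set B) : Finset ν :=
  s.filter fun x => N x ⊆ X

theorem crossing_compl (N : ν → Set B) (s : Finset ν) (X : Set B) :
    crossing N s Xᶜ = crossing N s X := by
  simp only [crossing, oneSided_compl_iff]

theorem card_crossing_add_inside (N : ν → Set B) (s : Finset ν) (hs : ∀ x ∈ s, (N x).Nonempty)
    (X : Set B) :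
    (crossing N s X).card + (inside N s X).card + (inside N s Xᶜ).card = s.card := by
  have h1 : Disjoint (crossing N s X) (inside N s X) := by
    rw [Finset.disjoint_left]
    intro x hx hx'
    simp only [crossing, inside, mem_filter] at hx hx'
    exact hx.2 (oneSided_iff_subset.2 (Or.inl hx'.2))
  have h2 : Disjoint (crossing N s X ∪ inside N s X) (inside N s Xᶜ) := by
    rw [Finset.disjoint_left]
    intro x hx hx'
    simp only [crossing, inside, mem_filter, mem_union] at hx hx'
    rcases hx with hx | hx
    · exact hx.2 (oneSided_iff_subset.2 (Or.inr hx'.2))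
    · obtain ⟨a, ha⟩ := hs x hx.1
      exact hx'.2 ha (hx.2 ha)
  rw [← card_union_of_disjoint h1, ← card_union_of_disjoint h2]
  congr 1
  ext x
  simp only [crossing, inside, mem_filter, mem_union, oneSided_iff_subset]
  tauto

/-- Feet sets of size at most `m` meet at most `m` classes each. -/
theorem sum_card_meeting_le [Fintype B] (r : Setoid B) (N : ν → Set B) (s : Finset ν) (m : ℕ)
    (hm : ∀ x ∈ s, (N x).ncard ≤ m) :
    ∑ q : Quotient r, (s.filter fun x => ∃ a ∈ N x, Quotient.mk r a = q).card ≤ m * s.card := by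
  simp only [card_filter]
  rw [Finset.sum_comm, mul_comm, ← smul_eq_mul, ← Finset.sum_const]
  refine Finset.sum_le_sum fun x hx => ?_
  rw [← card_filter]
  refine le_trans ?_ (hm x hx)
  rw [← Set.ncard_coe_finset]
  refine le_trans (Set.ncard_le_ncard ?_ ((Set.toFinite (N x)).image (Quotient.mk r)))
    (Set.ncard_image_le (Set.toFinite _))
  intro q hq
  rw [mem_coe, mem_filter] at hq
  exact hq.2

/-- A lower bound on the items crossing a partition into at least three classes. -/
theorem card_crosses_of_three_le [Fintype B] (k : ℕ) (I D : Finset ν) (N : ν → Set B)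
    (hI : ∀ x ∈ I, (N x).ncard ≤ 3) (hD1 : ∀ x ∈ D, (N x).Nonempty)
    (hD2 : ∀ x ∈ D, (N x).ncard ≤ 2) (hDc : D.card ≤ 36 * k)
    (h1 : ∀ X : Set B, X.Nonempty → Xᶜ.Nonempty →
      32 * k ≤ (crossing N I X).card + (crossing N D X).card + (inside N D X).card)
    (r : Setoid B) (hr : 2 ≤ Fintype.card (Quotient r)) :
    32 * k * Fintype.card (Quotient r) ≤ 3 * (I.filter fun x => Crosses r (N x)).card + 72 * k := by
  have hcl : ∀ q : Quotient r, 32 * k ≤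
      ((I.filter fun x => Crosses r (N x)).filter fun x => ∃ a ∈ N x, Quotient.mk r a = q).card +
      (D.filter fun x => ∃ a ∈ N x, Quotient.mk r a = q).card := by
    intro q
    obtain ⟨q', hq'⟩ := Fintype.exists_ne_of_one_lt_card (by omega) q
    obtain ⟨a, rfl⟩ := Quotient.exists_rep q
    obtain ⟨b, rfl⟩ := Quotient.exists_rep q'
    let X : Set B := {c | Quotient.mk r c = Quotient.mk r a}
    have hX := h1 X ⟨a, rfl⟩ ⟨b, hq'⟩
    have hmeet : ∀ x, ¬ OneSided X (N x) → ∃ c ∈ N x, Quotient.mk r c = Quotient.mk r a := by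
      intro x hx
      by_contra! hc
      exact hx (oneSided_iff_subset.2 (Or.inr fun c hcN => hc c hcN))
    have hA : (crossing N I X).card ≤ ((I.filter fun x => Crosses r (N x)).filter
        fun x => ∃ c ∈ N x, Quotient.mk r c = Quotient.mk r a).card := by
      refine card_le_card fun x hx => ?_
      simp only [crossing, mem_filter] at hx ⊢
      refine ⟨⟨hx.1, ?_⟩, hmeet x hx.2⟩
      by_contra hc
      refine hx.2 fun c hcN d hdN => ?_
      have : r c d := by
        by_contra hcd
        exact hc ⟨c, hcN, d, hdN, hcd⟩
      simp only [X, Set.mem_ofPred_eq, Quotient.sound this]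
    have hB : (crossing N D X).card + (inside N D X).card ≤
        (D.filter fun x => ∃ c ∈ N x, Quotient.mk r c = Quotient.mk r a).card := by
      rw [← card_union_of_disjoint]
      · refine card_le_card fun x hx => ?_
        simp only [crossing, inside, mem_filter, mem_union] at hx ⊢
        rcases hx with hx | hx
        · exact ⟨hx.1, hmeet x hx.2⟩
        · obtain ⟨c, hc⟩ := hD1 x hx.1
          exact ⟨hx.1, c, hc, hx.2 hc⟩
      · rw [Finset.disjoint_left]
        intro x hx hx'
        simp only [crossing, inside, mem_filter] at hx hx'
        exact hx.2 (oneSided_iff_subset.2 (Or.inl hx'.2))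
    omega
  have hsum := Finset.sum_le_sum fun q (_ : q ∈ (univ : Finset (Quotient r))) => hcl q
  rw [Finset.sum_const, card_univ, smul_eq_mul, Finset.sum_add_distrib] at hsum
  have hs1 := sum_card_meeting_le r N (I.filter fun x => Crosses r (N x)) 3
    (fun x hx => hI x (mem_filter.1 hx).1)
  have hs2 := sum_card_meeting_le r N D 2 hD2
  rw [mul_comm]
  omega

end

section

variable {B ν : Type}

/-- The set `C` does not separate any two points of `Y`, for every `C` respected by the nodes
of colour `i`. -/
def ColorConnects (N : ν → Set B) (I : Finset ν) {κ : Type} (φ : ν → Option κ) (i : κ)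
    (Y : Set B) : Prop :=
  ∀ C : Set B, (∀ x ∈ I, φ x = some i → OneSided C (N x)) → OneSided C Y

theorem exists_node_of_colorConnects {N : ν → Set B} {I : Finset ν} {κ : Type} {φ : ν → Option κ}
    {i : κ} {Y : Set B} (h : ColorConnects N I φ i Y) {u w : B} (hu : u ∈ Y) (hw : w ∈ Y)
    (huw : w ≠ u) : ∃ x ∈ I, φ x = some i ∧ u ∈ N x := by
  by_contra! hc
  have := h {u} (fun x hx hxi a ha b hb => by
    have h1 : a ≠ u := fun hh => hc x hx hxi (hh ▸ ha)
    have h2 : b ≠ u := fun hh => hc x hx hxi (hh ▸ hb)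
    simp [h1, h2]) u hu w hw
  simp [huw] at this

theorem two_le_card_of_colorConnects {N : ν → Set B} {I : Finset ν} {k : ℕ}
    {φ : ν → Option (Fin k × Fin 2)} {i : Fin k} {Y : Set B}
    (h : ∀ a : Fin 2, ColorConnects N I φ (i, a) Y) {u w : B} (hu : u ∈ Y) (hw : w ∈ Y)
    (huw : w ≠ u) :
    2 ≤ (I.filter fun x => (φ x).map Prod.fst = some i ∧ u ∈ N x).card := by
  obtain ⟨x, hxI, hx, hux⟩ := exists_node_of_colorConnects (h 0) hu hw huw
  obtain ⟨y, hyI, hy, huy⟩ := exists_node_of_colorConnects (h 1) hu hw huw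
  have hxy : x ≠ y := by
    rintro rfl
    rw [hx] at hy
    simp at hy
  refine (card_pair hxy).ge.trans (card_le_card fun z hz => ?_)
  rw [mem_insert, mem_singleton] at hz
  rw [mem_filter]
  rcases hz with rfl | rfl
  · exact ⟨hxI, by rw [hx]; rfl, hux⟩
  · exact ⟨hyI, by rw [hy]; rfl, huy⟩

/-- Doubly connected packing when no vertex set is crossed by few items. -/
theorem exists_double_packing [Fintype B] (k : ℕ) (I D : Finset ν) (N : ν → Set B)
    (hI : ∀ x ∈ I, (N x).ncard ≤ 3) (hD1 : ∀ x ∈ D, (N x).Nonempty)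
    (hD2 : ∀ x ∈ D, (N x).ncard ≤ 2) (hDc : D.card ≤ 36 * k)
    (h1 : ∀ X : Set B, X.Nonempty → Xᶜ.Nonempty →
      32 * k ≤ (crossing N I X).card + (crossing N D X).card + (inside N D X).card)
    (h2 : ∀ X : Set B, X.Nonempty → Xᶜ.Nonempty → 2 * k ≤ (crossing N I X).card) :
    ∃ φ : ν → Option (Fin k × Fin 2), ∀ j, ColorConnects N I φ j Set.univ := by
  obtain ⟨φ, hφ⟩ := exists_connected_distribution (J := Fin k × Fin 2) I N (fun _ => ∅) (by
    intro r
    rw [Fintype.card_prod, Fintype.card_fin, Fintype.card_fin]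
    rcases lt_or_ge (Fintype.card (Quotient r)) 2 with hr | hr
    · have : k * 2 * Fintype.card (Quotient r) ≤ k * 2 * 1 := Nat.mul_le_mul_left _ (by omega)
      omega
    · have h3 := card_crosses_of_three_le k I D N hI hD1 hD2 hDc h1 r hr
      rcases hr.lt_or_eq with hr' | hr'
      · have h4 : k * 3 ≤ k * Fintype.card (Quotient r) := Nat.mul_le_mul_left _ hr'
        have h5 : 32 * k * Fintype.card (Quotient r) = 32 * (k * Fintype.card (Quotient r)) := by
          ring
        have h6 : k * 2 * Fintype.card (Quotient r) = 2 * (k * Fintype.card (Quotient r)) := by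
          ring
        omega
      · obtain ⟨q, q', hq⟩ := Fintype.exists_pair_of_one_lt_card (α := Quotient r) (by omega)
        obtain ⟨a, rfl⟩ := Quotient.exists_rep q
        obtain ⟨b, rfl⟩ := Quotient.exists_rep q'
        have h4 := h2 {c | Quotient.mk r c = Quotient.mk r a} ⟨a, rfl⟩ ⟨b, Ne.symm hq⟩
        have h5 : crossing N I {c | Quotient.mk r c = Quotient.mk r a} ⊆
            I.filter fun x => Crosses r (N x) := by
          intro x hx
          simp only [crossing, mem_filter] at hx ⊢
          refine ⟨hx.1, ?_⟩
          by_contra hc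
          refine hx.2 fun c hcN d hdN => ?_
          have : r c d := by
            by_contra hcd
            exact hc ⟨c, hcN, d, hdN, hcd⟩
          simp only [Set.mem_ofPred_eq, Quotient.sound this]
        have h6 := card_le_card h5
        rw [← hr']
        omega)
  refine ⟨φ, fun j C hC => hφ j C (fun a ha => ha.elim) hC⟩

/-- Doubly connected packing on both sides of a vertex set crossed by few items. -/
theorem exists_double_packing_of_few [Fintype B] (k : ℕ) (I D : Finset ν) (N : ν → Set B)
    (hI : ∀ x ∈ I, (N x).ncard ≤ 3) (hD1 : ∀ x ∈ D, (N x).Nonempty)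
    (hD2 : ∀ x ∈ D, (N x).ncard ≤ 2) (hDc : D.card ≤ 36 * k)
    (h1 : ∀ X : Set B, X.Nonempty → Xᶜ.Nonempty →
      32 * k ≤ (crossing N I X).card + (crossing N D X).card + (inside N D X).card)
    (X : Set B) (hX : X.Nonempty) (hXc : Xᶜ.Nonempty) (hfew : (crossing N I X).card < 2 * k) :
    ∃ φ : ν → Option (Fin k × Fin 2), ∀ j, ColorConnects N (I \ crossing N I X) φ j X ∧
      ColorConnects N (I \ crossing N I X) φ j Xᶜ := by
  obtain ⟨x0, hx0⟩ := hX
  obtain ⟨y0, hy0⟩ := hXc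
  obtain ⟨φ, hφ⟩ := exists_connected_distribution (J := Fin k × Fin 2) (I \ crossing N I X) N
    (fun _ => {x0, y0}) (by
    intro r
    rw [Fintype.card_prod, Fintype.card_fin, Fintype.card_fin]
    let r' : Setoid B := ⟨fun a b => r a b ∧ (a ∈ X ↔ b ∈ X), fun a => ⟨r.refl a, Iff.rfl⟩,
      fun h => ⟨r.symm h.1, h.2.symm⟩, fun h h' => ⟨r.trans h.1 h'.1, h.2.trans h'.2⟩⟩
    let g : Quotient r' → Quotient r := Quotient.map' id fun a b h => h.1
    have hg : Function.Surjective g := by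
      intro q
      obtain ⟨a, rfl⟩ := Quotient.exists_rep q
      exact ⟨Quotient.mk r' a, rfl⟩
    have hcard : Fintype.card (Quotient r) ≤ Fintype.card (Quotient r') :=
      Fintype.card_le_of_surjective g hg
    have hxy : ¬ r' x0 y0 := fun h => hy0 (h.2.1 hx0)
    have h2r' : 2 ≤ Fintype.card (Quotient r') :=
      Fintype.one_lt_card_iff.2 ⟨Quotient.mk r' x0, Quotient.mk r' y0,
        fun h => hxy (Quotient.exact h)⟩
    have h3 := card_crosses_of_three_le k I D N hI hD1 hD2 hDc h1 r' h2r'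
    have h4 : (I.filter fun x => Crosses r' (N x)).card ≤
        ((I \ crossing N I X).filter fun x => Crosses r (N x)).card + (crossing N I X).card := by
      refine le_trans (card_le_card ?_) (card_union_le _ _)
      intro x hx
      simp only [mem_filter, mem_union, mem_sdiff] at hx ⊢
      by_cases hxc : x ∈ crossing N I X
      · exact Or.inr hxc
      · refine Or.inl ⟨⟨hx.1, hxc⟩, ?_⟩
        obtain ⟨a, ha, b, hb, hab⟩ := hx.2
        refine ⟨a, ha, b, hb, fun h => hab ⟨h, ?_⟩⟩
        simp only [crossing, mem_filter, not_and, not_not] at hxc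
        exact hxc hx.1 a ha b hb
    have h5 : 32 * k * Fintype.card (Quotient r') = 32 * (k * Fintype.card (Quotient r')) := by ring
    have h6 : k * 2 * Fintype.card (Quotient r) = 2 * (k * Fintype.card (Quotient r)) := by ring
    have h7 : k * Fintype.card (Quotient r) ≤ k * Fintype.card (Quotient r') :=
      Nat.mul_le_mul_left _ hcard
    rcases lt_or_ge (Fintype.card (Quotient r')) 3 with hr | hr
    · by_cases hrxy : r x0 y0
      · have hlt : Fintype.card (Quotient r) < Fintype.card (Quotient r') := by
          refine lt_of_le_of_ne hcard fun heq => hxy (Quotient.exact ?_)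
          have hinj := ((Fintype.bijective_iff_surjective_and_card g).2 ⟨hg, heq.symm⟩).1
          exact hinj (Quotient.sound hrxy : Quotient.mk r x0 = Quotient.mk r y0)
        have : k * Fintype.card (Quotient r) ≤ k * 1 := Nat.mul_le_mul_left _ (by omega)
        omega
      · have : (univ.filter fun _ : Fin k × Fin 2 => Crosses r {x0, y0}).card = k * 2 := by
          rw [filter_true_of_mem]
          · simp
          · intro _ _
            exact ⟨x0, by simp, y0, by simp, hrxy⟩
        have : k * Fintype.card (Quotient r) ≤ k * 2 := Nat.mul_le_mul_left _ (by omega)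
        omega
    · have : k * 3 ≤ k * Fintype.card (Quotient r') := Nat.mul_le_mul_left _ hr
      omega)
  have key : ∀ X' : Set B, ∀ z w : B, z ∈ X' → w ∉ X' →
      (∀ x ∈ I \ crossing N I X, OneSided X' (N x)) → ({x0, y0} : Set B) ⊆ {z, w} →
      ∀ j, ColorConnects N (I \ crossing N I X) φ j X' := by
    intro X' z w hz hw hside hsub j C hC
    have hall := hφ j ((C ∩ X') ∪ {b | b ∉ X' ∧ z ∈ C}) (by
      intro a ha b hb
      have ha' := hsub ha
      have hb' := hsub hb
      have : ∀ a, a ∈ ({z, w} : Set B) → (a ∈ (C ∩ X') ∪ {b | b ∉ X' ∧ z ∈ C} ↔ z ∈ C) := by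
        rintro a (rfl | rfl)
        · simp [hz]
        · simp [hw]
      rw [this a ha', this b hb']) (by
      intro x hx hxj a ha b hb
      have h1 := hC x hx hxj a ha b hb
      have h2 := hside x hx a ha b hb
      simp only [Set.mem_union, Set.mem_inter_iff, Set.mem_ofPred_eq]
      tauto)
    intro a ha b hb
    have := hall a (Set.mem_univ _) b (Set.mem_univ _)
    simpa [ha, hb] using this
  have hside : ∀ x ∈ I \ crossing N I X, OneSided X (N x) := by
    intro x hx
    by_contra hc
    exact (mem_sdiff.1 hx).2 (mem_filter.2 ⟨(mem_sdiff.1 hx).1, hc⟩)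
  refine ⟨φ, fun j => ⟨key X x0 y0 hx0 hy0 hside subset_rfl j,
    key Xᶜ y0 x0 hy0 (fun h => h hx0) (fun x hx => (hside x hx).compl) ?_ j⟩⟩
  rw [Set.pair_comm]

end

section

variable {B ν : Type}

theorem exists_subset_card_both (s : Finset ν) (m : ℕ) (h : 2 * m ≤ s.card) :
    ∃ t ⊆ s, m ≤ t.card ∧ m ≤ (s \ t).card := by
  obtain ⟨t, ht, hc⟩ := exists_subset_card_eq (show m ≤ s.card by omega)
  refine ⟨t, ht, hc.ge, ?_⟩
  rw [card_sdiff_of_subset ht]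
  omega

/-- The packing lemma: items `I` may be coloured freely, nodes in `D` have a prescribed colour and
are either used fully or attached only to their home foot. -/
theorem exists_balanced_packing [Fintype B] [Nonempty B] (k : ℕ) (I D : Finset ν)
    (N : ν → Set B) (P : ν → Fin k) 
    (hI : ∀ x ∈ I, (N x).ncard ≤ 3) (hD1 : ∀ x ∈ D, (N x).Nonempty)
    (hD2 : ∀ x ∈ D, (N x).ncard ≤ 2) (hDc : D.card ≤ 36 * k)
    (hP : ∀ i, 2 ≤ (D.filter fun x => P x = i).card)
    (h1 : ∀ X : Set B, X.Nonempty → Xᶜ.Nonempty →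
      32 * k ≤ (crossing N I X).card + (crossing N D X).card + (inside N D X).card)
    (h2 : ∀ X : Set B, X.Nonempty → Xᶜ.Nonempty → 2 * k ≤ (crossing N I X).card ∨
      D.card ≤ (crossing N I X).card + (crossing N D X).card + (inside N D X).card) :
    ∃ (φ : ν → Option (Fin k)) (home : ν → B) (full : Finset ν), full ⊆ D ∧
      (∀ x ∈ D, home x ∈ N x) ∧
      (∀ i, ∀ C : Set B, (∀ x ∈ I, φ x = some i → OneSided C (N x)) →
        (∀ x ∈ full, P x = i → OneSided C (N x)) → OneSided C Set.univ) ∧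
      ∀ u, (∀ i, 2 ≤ (I.filter fun x => φ x = some i ∧ u ∈ N x).card +
          (D.filter fun x => P x = i ∧ u ∈ N x ∧ (home x = u ∨ x ∈ full)).card) ∨
        2 * k ≤ (I.filter fun x => φ x = none ∧ u ∈ N x).card +
          (D.filter fun x => u ∈ N x ∧ x ∉ full ∧ home x ≠ u).card := by
  obtain ⟨b0⟩ := ‹Nonempty B›
  have hhome : ∀ x, ∃ b, x ∈ D → b ∈ N x := fun x => by
    by_cases hx : x ∈ D
    · exact (hD1 x hx).imp fun b hb _ => hb
    · exact ⟨b0, fun h => absurd h hx⟩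
  choose home0 hhome0 using hhome
  by_cases hB : ∀ b : B, b = b0
  · refine ⟨fun _ => none, home0, ∅, empty_subset _, hhome0, ?_, fun u => Or.inl fun i => ?_⟩
    · intro i C _ _ a _ b _
      rw [hB a, hB b]
    · refine (hP i).trans (le_trans (card_le_card fun x hx => ?_) (Nat.le_add_left _ _))
      rw [mem_filter] at hx ⊢
      have h3 : home0 x = u := by rw [hB (home0 x), hB u]
      exact ⟨hx.1, hx.2, h3 ▸ hhome0 x hx.1, Or.inl h3⟩
  push Not at hB
  obtain ⟨b1, hb1⟩ := hB
  by_cases hbad : ∀ X : Set B, X.Nonempty → Xᶜ.Nonempty → 2 * k ≤ (crossing N I X).card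
  · obtain ⟨φ, hφ⟩ := exists_double_packing k I D N hI hD1 hD2 hDc h1 hbad
    refine ⟨fun x => (φ x).map Prod.fst, home0, ∅, empty_subset _, hhome0, ?_,
      fun u => Or.inl fun i => ?_⟩
    · intro i C hC _
      exact hφ (i, 0) C fun x hx hxi => hC x hx (by simp [hxi])
    · obtain ⟨w, hw⟩ : ∃ w, w ≠ u := by
        by_cases h : b0 = u
        · exact ⟨b1, h ▸ hb1⟩
        · exact ⟨b0, h⟩
      exact (two_le_card_of_colorConnects (fun a => hφ (i, a)) (Set.mem_univ u)
        (Set.mem_univ w) hw).trans (Nat.le_add_right _ _)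
  push Not at hbad
  obtain ⟨X, hX, hXc, hfew⟩ := hbad
  obtain ⟨φ, hφ⟩ := exists_double_packing_of_few k I D N hI hD1 hD2 hDc h1 X hX hXc hfew
  have hXc' : Xᶜᶜ.Nonempty := by simpa using hX
  have hsplit := card_crossing_add_inside N D hD1 X
  have h2X := (h2 X hX hXc).resolve_left (by omega)
  have h2Y := (h2 Xᶜ hXc hXc').resolve_left (by rw [crossing_compl]; omega)
  have h1X := h1 X hX hXc
  rw [crossing_compl, crossing_compl] at h2Y
  -- distribute the straddling nodes over the two sides
  obtain ⟨T, hTs, hT1, hT2⟩ := exists_subset_card_both (crossing N D X) (3 * k) (by omega)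
  have hstr : ∀ x, x ∈ crossing N D X → (∃ a ∈ N x, a ∈ X) ∧ ∃ a ∈ N x, a ∉ X := by
    intro x hx
    have hx' := (mem_filter.1 hx).2
    rw [oneSided_iff_subset, not_or, Set.not_subset, Set.not_subset] at hx'
    obtain ⟨⟨a, ha, ha'⟩, b, hb, hb'⟩ := hx'
    exact ⟨⟨b, hb, by simpa using hb'⟩, a, ha, ha'⟩
  have hhome : ∀ x, ∃ b, (x ∈ D → b ∈ N x) ∧ (x ∈ T → b ∈ X) ∧
      (x ∈ crossing N D X \ T → b ∉ X) := by
    intro x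
    by_cases hx : x ∈ crossing N D X
    · obtain ⟨⟨a, ha, ha'⟩, b, hb, hb'⟩ := hstr x hx
      by_cases hxT : x ∈ T
      · exact ⟨a, fun _ => ha, fun _ => ha', fun h => absurd hxT (mem_sdiff.1 h).2⟩
      · exact ⟨b, fun _ => hb, fun h => absurd h hxT, fun _ => hb'⟩
    · exact ⟨home0 x, hhome0 x, fun h => absurd (hTs h) hx,
        fun h => absurd (mem_sdiff.1 h).1 hx⟩
  choose home hhN hhX hhY using hhome
  -- choose a connecting node for every colour
  let Z : Finset (Fin k) := univ.filter fun i => ∀ x ∈ crossing N D X, P x ≠ i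
  have hfull : ∀ i, ∃ x, i ∉ Z → x ∈ crossing N D X ∧ P x = i := by
    intro i
    by_cases hi : i ∈ Z
    · obtain ⟨x, _⟩ := card_pos.1 (lt_of_lt_of_le two_pos (hP i))
      exact ⟨x, fun h => absurd hi h⟩
    · simp only [Z, mem_filter, mem_univ, true_and, not_forall, not_not] at hi
      obtain ⟨x, hx, hxi⟩ := hi
      exact ⟨x, fun _ => ⟨hx, hxi⟩⟩
  choose c hc using hfull
  let full : Finset ν := Zᶜ.image c
  have hfullc : full.card ≤ k := by
    refine card_image_le.trans ((card_le_univ _).trans ?_)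
    simp
  have hfulls : full ⊆ crossing N D X := by
    intro x hx
    obtain ⟨i, hi, rfl⟩ := mem_image.1 hx
    exact (hc i (mem_compl.1 hi)).1
  have hZ : Z.card ≤ (crossing N I X).card := by
    have h3 : 2 * Z.card ≤ ((inside N D X) ∪ (inside N D Xᶜ)).card := by
      rw [mul_comm, ← smul_eq_mul, ← Finset.sum_const]
      rw [card_eq_sum_card_fiberwise (f := P) (t := univ) (fun _ _ => mem_univ _)]
      refine (Finset.sum_le_sum fun i hi => ?_).trans
        (Finset.sum_le_sum_of_subset (subset_univ Z))
      refine (hP i).trans (card_le_card fun x hx => ?_)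
      simp only [mem_filter, mem_union, inside] at hx ⊢
      refine ⟨?_, hx.2⟩
      have hxc : x ∉ crossing N D X := fun h => (mem_filter.1 hi).2 x h hx.2
      simp only [crossing, mem_filter, not_and, not_not] at hxc
      exact (oneSided_iff_subset.1 (hxc hx.1)).imp (fun h => ⟨hx.1, h⟩) (fun h => ⟨hx.1, h⟩)
    have h4 := h3.trans (card_union_le _ _)
    omega
  obtain ⟨x1, hx1⟩ := card_pos.1 (show 0 < (crossing N D X).card by omega)
  have : Nonempty ν := ⟨x1⟩
  obtain ⟨g, hgZ, hginj⟩ := (Finset.finite_toSet Z).exists_injOn_of_encard_le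
    (t := (crossing N I X : Set ν)) (by
      rw [Set.encard_coe_eq_coe_finsetCard, Set.encard_coe_eq_coe_finsetCard]
      exact_mod_cast hZ)
  let ψ : ν → Option (Fin k) := fun x =>
    if x ∈ crossing N I X then
      (if h : ∃ i, i ∈ Z ∧ g i = x then some h.choose else none)
    else (φ x).map Prod.fst
  have hψ1 : ∀ x ∈ I \ crossing N I X, ψ x = (φ x).map Prod.fst := fun x hx =>
    if_neg (mem_sdiff.1 hx).2
  have hψ2 : ∀ i ∈ Z, ψ (g i) = some i := by
    intro i hi
    have hex : ∃ i', i' ∈ Z ∧ g i' = g i := ⟨i, hi, rfl⟩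
    simp only [ψ]
    rw [if_pos (by exact hgZ hi), dif_pos hex]
    exact congrArg some (hginj hex.choose_spec.1 hi hex.choose_spec.2)
  have hside : ∀ i C, (∀ x ∈ I, ψ x = some i → OneSided C (N x)) →
      OneSided C X ∧ OneSided C Xᶜ := by
    intro i C hC
    have : ∀ x ∈ I \ crossing N I X, φ x = some (i, 0) → OneSided C (N x) := fun x hx hxi =>
      hC x (mem_sdiff.1 hx).1 (by rw [hψ1 x hx, hxi]; rfl)
    exact ⟨(hφ (i, 0)).1 C this, (hφ (i, 0)).2 C this⟩
  have hvertex : ∀ Y : Set B, (∀ j, ColorConnects N (I \ crossing N I X) φ j Y) → ∀ u ∈ Y,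
      (∃ w ∈ Y, w ≠ u) → ∀ i, 2 ≤ (I.filter fun x => ψ x = some i ∧ u ∈ N x).card := by
    rintro Y hY u hu ⟨w, hw, hwu⟩ i
    refine (two_le_card_of_colorConnects (fun a => hY (i, a)) hu hw hwu).trans (card_le_card ?_)
    intro x hx
    rw [mem_filter] at hx ⊢
    exact ⟨(mem_sdiff.1 hx.1).1, by rw [hψ1 x hx.1]; exact hx.2.1, hx.2.2⟩
  have hfree : ∀ u, ∀ T' ⊆ crossing N D X, 3 * k ≤ T'.card →
      (∀ x ∈ T', u ∈ N x ∧ home x ≠ u) →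
      2 * k ≤ (D.filter fun x => u ∈ N x ∧ x ∉ full ∧ home x ≠ u).card := by
    intro u T' hT' hcard hT'u
    have h3 : (T' \ full).card ≤ (D.filter fun x => u ∈ N x ∧ x ∉ full ∧ home x ≠ u).card := by
      refine card_le_card fun x hx => ?_
      rw [mem_sdiff] at hx
      rw [mem_filter]
      exact ⟨(mem_filter.1 (hT' hx.1)).1, (hT'u x hx.1).1, hx.2, (hT'u x hx.1).2⟩
    have h4 := le_card_sdiff full T'
    omega
  refine ⟨ψ, home, full, hfulls.trans (filter_subset _ _), hhN, ?_, fun u => ?_⟩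
  · intro i C hC hCf
    obtain ⟨hCX, hCY⟩ := hside i C hC
    obtain ⟨x, a, b, hCx, haN, haX, hbN, hbX⟩ : ∃ x a b, OneSided C (N x) ∧ a ∈ N x ∧ a ∈ X ∧
        b ∈ N x ∧ b ∉ X := by
      by_cases hi : i ∈ Z
      · have hgi : g i ∈ crossing N I X := hgZ hi
        have hgi' := (mem_filter.1 hgi).2
        rw [oneSided_iff_subset, not_or, Set.not_subset, Set.not_subset] at hgi'
        obtain ⟨⟨a, ha, ha'⟩, b, hb, hb'⟩ := hgi'
        exact ⟨g i, b, a, hC _ (mem_filter.1 hgi).1 (hψ2 i hi), hb, by simpa using hb', ha, ha'⟩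
      · obtain ⟨hc1, hc2⟩ := hc i hi
        obtain ⟨⟨a, ha, ha'⟩, b, hb, hb'⟩ := hstr _ hc1
        exact ⟨c i, a, b, hCf _ (mem_image.2 ⟨i, mem_compl.2 hi, rfl⟩) hc2, ha, ha', hb, hb'⟩
    have hab := hCx a haN b hbN
    have hall : ∀ z, (z ∈ C ↔ a ∈ C) := by
      intro z
      by_cases hz : z ∈ X
      · exact hCX z hz a haX
      · exact (hCY z hz b hbX).trans hab.symm
    intro z _ w _
    rw [hall z, hall w]
  · by_cases hu : u ∈ X
    · by_cases hw : ∃ w ∈ X, w ≠ u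
      · exact Or.inl fun i => (hvertex X (fun j => (hφ j).1) u hu hw i).trans (Nat.le_add_right _ _)
      · push Not at hw
        refine Or.inr ((hfree u _ sdiff_subset hT2 fun x hx => ?_).trans (Nat.le_add_left _ _))
        obtain ⟨⟨a, ha, ha'⟩, -⟩ := hstr x (mem_sdiff.1 hx).1
        exact ⟨hw a ha' ▸ ha, fun h => hhY x hx (h ▸ hu)⟩
    · by_cases hw : ∃ w ∈ Xᶜ, w ≠ u
      · exact Or.inl fun i => (hvertex Xᶜ (fun j => (hφ j).2) u hu hw i).trans
          (Nat.le_add_right _ _)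
      · push Not at hw
        refine Or.inr ((hfree u _ hTs hT1 fun x hx => ?_).trans (Nat.le_add_left _ _))
        obtain ⟨-, a, ha, ha'⟩ := hstr x (hTs hx)
        exact ⟨hw a ha' ▸ ha, fun h => hu (h ▸ hhX x hx)⟩

end

section

variable {V E : Type}

/-- The edge `e` is incident to `u`. -/
def Inc (p q : E → V) (u : V) (e : E) : Prop := p e = u ∨ q e = u

/-- The edge `e` leaves the vertex set `X`. -/
def Leaves (p q : E → V) (X : Set V) (e : E) : Prop := ¬ (p e ∈ X ↔ q e ∈ X)

/-- The edges of `F` leaving `X`. -/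
noncomputable def boundary (p q : E → V) (F : Finset E) (X : Set V) : Finset E :=
  F.filter (Leaves p q X)

/-- The edges of `F` incident to `u`. -/
noncomputable def star (p q : E → V) (F : Finset E) (u : V) : Finset E := F.filter (Inc p q u)

/-- Every vertex set separating two vertices of `S` is left by at least `K` edges. -/
def KConn (p q : E → V) (F : Finset E) (S : Set V) (K : ℕ) : Prop :=
  ∀ X : Set V, (∃ a ∈ S, a ∈ X) → (∃ b ∈ S, b ∉ X) → K ≤ (boundary p q F X).card

/-- The vertices `a` and `b` are connected by edges of `T`. -/
def Linked (p q : E → V) (T : Set E) (a b : V) : Prop :=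
  ∀ C : Set V, (∀ e ∈ T, (p e ∈ C ↔ q e ∈ C)) → (a ∈ C ↔ b ∈ C)

variable {p q : E → V} {F : Finset E} {k : ℕ}

theorem Linked.refl (T : Set E) (a : V) : Linked p q T a a := fun _ _ => Iff.rfl

theorem Linked.symm {T : Set E} {a b : V} (h : Linked p q T a b) : Linked p q T b a :=
  fun C hC => (h C hC).symm

theorem Linked.trans {T : Set E} {a b c : V} (h : Linked p q T a b) (h' : Linked p q T b c) :
    Linked p q T a c := fun C hC => (h C hC).trans (h' C hC)

theorem Linked.mono {T T' : Set E} {a b : V} (h : Linked p q T a b) (hT : T ⊆ T') :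
    Linked p q T' a b := fun C hC => h C fun e he => hC e (hT he)

theorem mem_boundary {X : Set V} {e : E} :
    e ∈ boundary p q F X ↔ e ∈ F ∧ Leaves p q X e := mem_filter

theorem mem_star {u : V} {e : E} : e ∈ star p q F u ↔ e ∈ F ∧ Inc p q u e := mem_filter

theorem leaves_compl {X : Set V} {e : E} : Leaves p q Xᶜ e ↔ Leaves p q X e :=
  not_congr not_iff_not

theorem boundary_compl (X : Set V) : boundary p q F Xᶜ = boundary p q F X := by
  simp only [boundary, leaves_compl]

theorem leaves_iff_exists {X : Set V} {e : E} :
    Leaves p q X e ↔ ∃ a b, Inc p q a e ∧ Inc p q b e ∧ a ∈ X ∧ b ∉ X := by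
  unfold Leaves Inc
  constructor
  · intro h
    by_cases hp : p e ∈ X
    · exact ⟨p e, q e, Or.inl rfl, Or.inr rfl, hp, fun hq => h (by simp [hp, hq])⟩
    · exact ⟨q e, p e, Or.inr rfl, Or.inl rfl, by_contra fun hq => h (by simp [hp, hq]), hp⟩
  · rintro ⟨a, b, ha | ha, hb | hb, haX, hbX⟩ h
    · exact hbX (hb ▸ ha ▸ haX)
    · exact hbX (hb ▸ h.1 (ha ▸ haX))
    · exact hbX (hb ▸ h.2 (ha ▸ haX))
    · exact hbX (hb ▸ ha ▸ haX)

theorem boundary_singleton_subset (u : V) : boundary p q F {u} ⊆ star p q F u := by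
  intro e he
  rw [mem_boundary, leaves_iff_exists] at he
  obtain ⟨he, a, b, ha, -, rfl, -⟩ := he
  exact mem_star.2 ⟨he, ha⟩

/-- The partial colouring `c` of the edge set `D` can be completed, after adding `r` more edges,
so that every colour occurs at least twice. -/
def Bal (c : E → Option (Fin k)) (D : Finset E) (r : ℕ) : Prop :=
  ∑ i, max 2 (D.filter fun e => c e = some i).card ≤ D.card + r

theorem Bal.of_counts {E' : Type} {c : E → Option (Fin k)} {D : Finset E} {r : ℕ}
    (h : Bal c D r) {c' : E' → Option (Fin k)} {D' : Finset E'} {r' : ℕ}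
    (hn : ∀ i, (D'.filter fun e => c' e = some i).card ≤ (D.filter fun e => c e = some i).card)
    (hD : D.card + r ≤ D'.card + r') : Bal c' D' r' :=
  (Finset.sum_le_sum fun i _ => max_le_max le_rfl (hn i)).trans (h.trans hD)

theorem sum_card_color (c : E → Option (Fin k)) (D : Finset E) :
    ∑ i, (D.filter fun e => c e = some i).card + (D.filter fun e => c e = none).card = D.card := by
  rw [card_eq_sum_card_fiberwise (s := D) (f := c) (t := univ) (fun _ _ => mem_univ _),
    Fintype.sum_option, add_comm]

theorem bal_of_two_le {c : E → Option (Fin k)} {D : Finset E} (r : ℕ)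
    (h : ∀ i, 2 ≤ (D.filter fun e => c e = some i).card) : Bal c D r := by
  have h1 := sum_card_color c D
  have h2 : ∑ i, max 2 (D.filter fun e => c e = some i).card =
      ∑ i, (D.filter fun e => c e = some i).card :=
    Finset.sum_congr rfl fun i _ => max_eq_right (h i)
  unfold Bal
  omega

theorem bal_of_free {c : E → Option (Fin k)} {D : Finset E} {r : ℕ}
    (h : 2 * k ≤ (D.filter fun e => c e = none).card + r) : Bal c D r := by
  have h1 := sum_card_color c D
  have h2 : ∑ i, max 2 (D.filter fun e => c e = some i).card ≤
      ∑ i : Fin k, (2 + (D.filter fun e => c e = some i).card) :=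
    Finset.sum_le_sum fun i _ => by omega
  rw [Finset.sum_add_distrib, Finset.sum_const, card_univ, Fintype.card_fin, smul_eq_mul] at h2
  unfold Bal
  omega

theorem Bal.exists_total (hk : 0 < k) {D : Finset E} : ∀ {c : E → Option (Fin k)},
    Bal c D 0 → ∃ P : E → Fin k, (∀ e ∈ D, ∀ i, c e = some i → P e = i) ∧
      ∀ i, 2 ≤ (D.filter fun e => P e = i).card := by
  suffices H : ∀ n, ∀ c : E → Option (Fin k), (D.filter fun e => c e = none).card = n →
      Bal c D 0 → ∃ P : E → Fin k, (∀ e ∈ D, ∀ i, c e = some i → P e = i) ∧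
      ∀ i, 2 ≤ (D.filter fun e => P e = i).card from fun {c} h => H _ c rfl h
  intro n
  induction n with
  | zero =>
    intro c hn h
    have h1 := sum_card_color c D
    have hnone := filter_eq_empty_iff.1 (card_eq_zero.1 hn)
    have h2 : ∀ i, max 2 (D.filter fun e => c e = some i).card =
        (D.filter fun e => c e = some i).card := by
      intro i
      refine le_antisymm ?_ (le_max_right _ _)
      by_contra hlt
      have := Finset.sum_lt_sum (s := univ)
        (fun i _ => le_max_right 2 (D.filter fun e => c e = some i).card)
        ⟨i, mem_univ i, not_le.1 hlt⟩
      unfold Bal at h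
      omega
    refine ⟨fun e => (c e).getD ⟨0, hk⟩, fun e _ i hi => by simp [hi], fun i => ?_⟩
    refine (max_eq_right_iff.1 (h2 i)).trans (card_le_card fun e he => ?_)
    rw [mem_filter] at he ⊢
    exact ⟨he.1, by simp [he.2]⟩
  | succ n ih =>
    intro c hn h
    obtain ⟨e, he⟩ := card_pos.1 (show 0 < (D.filter fun e => c e = none).card by omega)
    rw [mem_filter] at he
    have hstep : ∀ i : Fin k, Bal (Function.update c e (some i)) D 0 →
        ∃ P : E → Fin k, (∀ e ∈ D, ∀ i, c e = some i → P e = i) ∧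
        ∀ i, 2 ≤ (D.filter fun e => P e = i).card := by
      intro i hi
      obtain ⟨P, hP1, hP2⟩ := ih (Function.update c e (some i)) (by
        have : (D.filter fun e' => Function.update c e (some i) e' = none) =
            (D.filter fun e' => c e' = none).erase e := by
          ext e'
          by_cases hee : e' = e
          · subst hee; simp
          · simp [hee]
        rw [this, card_erase_of_mem (mem_filter.2 he), hn]
        rfl) hi
      refine ⟨P, fun e' he' j hj => hP1 e' he' j ?_, hP2⟩
      rw [Function.update_of_ne (fun hh => by rw [hh, he.2] at hj; cases hj), hj]
    have hcount : ∀ i j : Fin k, (D.filter fun e' => Function.update c e (some i) e' = some j) =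
        if j = i then insert e (D.filter fun e' => c e' = some j)
        else D.filter fun e' => c e' = some j := by
      intro i j
      ext e'
      by_cases hee : e' = e
      · subst hee
        by_cases hij : j = i
        · simp [hij, he.1]
        · simp [hij, Ne.symm hij, he.2]
      · by_cases hij : j = i <;> simp [hee, hij]
    have hnot : ∀ j, e ∉ D.filter fun e' => c e' = some j := by
      intro j hj
      rw [mem_filter, he.2] at hj
      cases hj.2
    by_cases hlow : ∃ i, (D.filter fun e => c e = some i).card < 2
    · obtain ⟨i, hi⟩ := hlow
      refine hstep i (le_trans (Finset.sum_le_sum fun j _ => ?_) h)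
      rw [hcount]
      split_ifs with hij
      · subst hij
        rw [card_insert_of_notMem (hnot j)]
        omega
      · exact le_rfl
    · push Not at hlow
      refine hstep ⟨0, hk⟩ (bal_of_two_le 0 fun j => (hlow j).trans (card_le_card ?_))
      rw [hcount]
      split_ifs
      · exact subset_insert _ _
      · exact subset_rfl

/-- The vertices that must be connected in colour `i`. -/
def Att (p q : E → V) (F : Finset E) (S : Set V) (v : V) (P : E → Fin k) (i : Fin k) (a : V) :
    Prop :=
  a ≠ v ∧ (a ∈ S ∨ ∃ e ∈ F, Inc p q v e ∧ Inc p q a e ∧ P e = i)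

/-- The colouring `c` extends the colouring `P` of the edges at `v`, connects all terminals in each
colour without using `v`, and is balanced at vertices of large degree. -/
structure GoodColoring (p q : E → V) (F : Finset E) (S : Set V) (v : V) (P : E → Fin k)
    (ρ : V → ℕ) (c : E → Option (Fin k)) : Prop where
  agree : ∀ e ∈ F, Inc p q v e → c e = some (P e)
  linked : ∀ i a b, Att p q F S v P i a → Att p q F S v P i b →
    Linked p q {e | e ∈ F ∧ c e = some i ∧ ¬ Inc p q v e} a b
  bal : ∀ u, u ≠ v → 34 * k ≤ (star p q F u).card + ρ u → Bal c (star p q F u) (ρ u)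

/-- The extension theorem for graphs with `n` edges. -/
def Extendable (k n : ℕ) : Prop :=
  ∀ (V E : Type) [Finite V] (p q : E → V) (F : Finset E) (S : Set V) (v : V) (P : E → Fin k)
    (ρ : V → ℕ), F.card = n → v ∈ S → (∃ s ∈ S, s ≠ v) → KConn p q F S (36 * k) →
    (star p q F v).card = 36 * k → (∀ i, 2 ≤ ((star p q F v).filter fun e => P e = i).card) →
    ∃ c, GoodColoring p q F S v P ρ c

theorem KConn.not_inc_of_erase {S : Set V} {v s : V} {e : E} (hS : KConn p q (F.erase e) S (36 * k))
    (he : e ∈ F) (hv : v ∈ S) (hs : s ∈ S) (hsv : s ≠ v) (hd : (star p q F v).card = 36 * k) :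
    ¬ Inc p q v e := by
  intro hinc
  have h1 := hS {v} ⟨v, hv, rfl⟩ ⟨s, hs, hsv⟩
  have h2 := card_le_card (boundary_singleton_subset (p := p) (q := q) (F := F.erase e) v)
  have h3 : star p q (F.erase e) v ⊆ (star p q F v).erase e := by
    intro e' he'
    rw [mem_star, mem_erase] at he'
    rw [mem_erase, mem_star]
    exact ⟨he'.1.1, he'.1.2, he'.2⟩
  have h4 := card_le_card h3
  rw [card_erase_of_mem (mem_star.2 ⟨he, hinc⟩)] at h4
  have h5 := card_pos.2 ⟨e, mem_star.2 ⟨he, hinc⟩⟩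
  omega

/-- Deleting a redundant edge. -/
theorem goodColoring_of_erase [Finite V] (ih : ∀ m < F.card, Extendable k m) {S : Set V} {v : V}
    {P : E → Fin k} {ρ : V → ℕ} (hv : v ∈ S) (hs : ∃ s ∈ S, s ≠ v)
    (hd : (star p q F v).card = 36 * k)
    (hP : ∀ i, 2 ≤ ((star p q F v).filter fun e => P e = i).card)
    {e : E} (he : e ∈ F) (hS : KConn p q (F.erase e) S (36 * k)) :
    ∃ c, GoodColoring p q F S v P ρ c := by
  have hinc : ¬ Inc p q v e := by
    obtain ⟨s, hs, hsv⟩ := hs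
    exact hS.not_inc_of_erase he hv hs hsv hd
  have hstar : star p q (F.erase e) v = star p q F v := by
    ext e'
    rw [mem_star, mem_star, mem_erase]
    refine ⟨fun h => ⟨h.1.2, h.2⟩, fun h => ⟨⟨?_, h.1⟩, h.2⟩⟩
    rintro rfl
    exact hinc h.2
  obtain ⟨c, hc⟩ := ih _ (card_erase_lt_of_mem he) V E p q (F.erase e) S v P
    (fun u => ρ u + if Inc p q u e then 1 else 0) rfl hv hs hS (hstar ▸ hd) (hstar ▸ hP)
  refine ⟨Function.update c e none, fun e' he' hi => ?_, fun i a b ha hb => ?_, fun u hu hdeg => ?_⟩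
  · have hne : e' ≠ e := by
      rintro rfl
      exact hinc hi
    rw [Function.update_of_ne hne]
    exact hc.agree e' (mem_erase.2 ⟨hne, he'⟩) hi
  · have hatt : ∀ a, Att p q F S v P i a → Att p q (F.erase e) S v P i a := by
      rintro a ⟨h1, h2⟩
      refine ⟨h1, h2.imp id ?_⟩
      rintro ⟨e', he', h3, h4⟩
      refine ⟨e', mem_erase.2 ⟨?_, he'⟩, h3, h4⟩
      rintro rfl
      exact hinc h3
    refine (hc.linked i a b (hatt a ha) (hatt b hb)).mono ?_
    rintro e' ⟨he', h1, h2⟩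
    rw [mem_erase] at he'
    exact ⟨he'.2, by rw [Function.update_of_ne he'.1]; exact h1, h2⟩
  · have hcard : (star p q F u).card = (star p q (F.erase e) u).card +
        if Inc p q u e then 1 else 0 := by
      split_ifs with h
      · have : star p q (F.erase e) u = (star p q F u).erase e := by
          ext e'
          simp only [mem_star, mem_erase, and_assoc]
        rw [this, card_erase_of_mem (mem_star.2 ⟨he, h⟩)]
        have := card_pos.2 ⟨e, mem_star.2 ⟨he, h⟩⟩
        omega
      · rw [add_zero]
        congr 1
        ext e'
        rw [mem_star, mem_star, mem_erase]
        refine ⟨fun h' => ⟨⟨?_, h'.1⟩, h'.2⟩, fun h' => ⟨h'.1.2, h'.2⟩⟩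
        rintro rfl
        exact h h'.2
    refine (hc.bal u hu (by omega)).of_counts (fun i => card_le_card fun e' he' => ?_) (by omega)
    rw [mem_filter, mem_star] at he' ⊢
    have hne : e' ≠ e := by
      rintro rfl
      simp at he'
    rw [Function.update_of_ne hne] at he'
    exact ⟨⟨mem_erase.2 ⟨hne, he'.1.1⟩, he'.1.2⟩, he'.2⟩

end

section

variable {V E : Type} {p q : E → V} {F : Finset E} {k : ℕ}

/-- The map contracting `X` to the vertex `x`. -/
noncomputable def contract (X : Set V) (x : V) (y : V) : V := if y ∈ X then x else y

/-- Connections in the graph obtained by contracting `X` lift if the relevant vertices of `X` are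
connected inside `X`. -/
theorem Linked.of_contract {X A : Set V} {x : V} {T T' : Set E} (hx : x ∈ A)
    (hA : ∀ a ∈ A, ∀ b ∈ A, Linked p q T' a b)
    (hT : ∀ e ∈ T, ∀ y, Inc p q y e → y ∈ X → y ∈ A) {a b : V} (ha : a ∈ X → a ∈ A)
    (hb : b ∈ X → b ∈ A)
    (h : Linked (contract X x ∘ p) (contract X x ∘ q) T (contract X x a) (contract X x b)) :
    Linked p q (T ∪ T') a b := by
  intro C hC
  have key : ∀ y, (y ∈ X → y ∈ A) → (contract X x y ∈ C ↔ y ∈ C) := by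
    intro y hy
    unfold contract
    split_ifs with hyX
    · exact hA x hx y (hy hyX) C fun e he => hC e (Or.inr he)
    · rfl
  have := h C fun e he => by
    rw [Function.comp, Function.comp, key _ (hT e he _ (Or.inl rfl)),
      key _ (hT e he _ (Or.inr rfl))]
    exact hC e (Or.inl he)
  rwa [key a ha, key b hb] at this

/-- Extending a colouring of the edges outside `X` into `X`, by applying the extension theorem to
the graph obtained by contracting the complement of `X`. -/
theorem exists_extension_inside [Finite V] (hk : 0 < k) {N : ℕ} (ih : ∀ m < N, Extendable k m)
    {X T : Set V} {x0 : V} (hTX : T ⊆ X) (hx0 : x0 ∈ T) (hd : (boundary p q F X).card ≤ 36 * k)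
    (hcut : ∀ Y ⊆ X, Y ≠ X → (∃ a ∈ T, a ∈ Y) → 36 * k ≤ (boundary p q F Y).card)
    (ρ : V → ℕ) {c0 : E → Option (Fin k)}
    (hbal : Bal c0 (boundary p q F X) (36 * k - (boundary p q F X).card))
    (hN : (F.filter fun e => p e ∈ X ∨ q e ∈ X).card + (36 * k - (boundary p q F X).card) < N) :
    ∃ c : E → Option (Fin k), (∀ e, ¬ (p e ∈ X ∧ q e ∈ X) → c e = c0 e) ∧
      (∀ i a b, (a ∈ X ∧ (a ∈ T ∨ ∃ e ∈ boundary p q F X, Inc p q a e ∧ c0 e = some i)) →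
        (b ∈ X ∧ (b ∈ T ∨ ∃ e ∈ boundary p q F X, Inc p q b e ∧ c0 e = some i)) →
        Linked p q {e | e ∈ F ∧ (p e ∈ X ∧ q e ∈ X) ∧ c e = some i} a b) ∧
      ∀ u ∈ X, (u ∈ T → (boundary p q F X).card = 36 * k) →
        34 * k ≤ (star p q F u).card + ρ u → Bal c (star p q F u) (ρ u) := by
  set d := (boundary p q F X).card with hdd
  let g : V → Option V := fun x => if x ∈ X then some x else none
  have hg1 : ∀ x u, g x = some u ↔ x ∈ X ∧ x = u := by
    intro x u
    by_cases hx : x ∈ X <;> simp [g, hx]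
  have hg2 : ∀ x, g x = none ↔ x ∉ X := by
    intro x
    by_cases hx : x ∈ X <;> simp [g, hx]
  let p' : E ⊕ Fin (36 * k - d) → Option V := Sum.elim (fun e => g (p e)) (fun _ => none)
  let q' : E ⊕ Fin (36 * k - d) → Option V := Sum.elim (fun e => g (q e)) (fun _ => some x0)
  let F' : Finset (E ⊕ Fin (36 * k - d)) :=
    (F.filter fun e => p e ∈ X ∨ q e ∈ X).disjSum univ
  have hF' : ∀ e, Sum.inl e ∈ F' ↔ e ∈ F ∧ (p e ∈ X ∨ q e ∈ X) := by
    intro e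
    simp [F']
  have hF'r : ∀ j, Sum.inr j ∈ F' := by
    intro j
    simp [F']
  have hcF' : F'.card < N := by
    rw [card_disjSum, card_univ, Fintype.card_fin]
    exact hN
  have hleave : ∀ Z : Set (Option V), none ∉ Z → ∀ e,
      (Leaves p' q' Z (Sum.inl e) ↔ Leaves p q {x | x ∈ X ∧ some x ∈ Z} e) := by
    intro Z hZ e
    have : ∀ x, g x ∈ Z ↔ x ∈ {x | x ∈ X ∧ some x ∈ Z} := by
      intro x
      by_cases hx : x ∈ X <;> simp [g, hx, hZ]
    simp only [Leaves, p', q', Sum.elim_inl, this]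
  have hstar0 : star p' q' F' none = (boundary p q F X).disjSum univ := by
    ext e
    rcases e with e | j
    · rw [mem_star, hF', inl_mem_disjSum, mem_boundary]
      simp only [Inc, p', q', Sum.elim_inl, hg2, Leaves]
      tauto
    · simp only [mem_star, hF'r, Inc, p', Sum.elim_inr, inr_mem_disjSum, mem_univ, true_or,
        and_self]
  obtain ⟨P, hP1, hP2⟩ := Bal.exists_total hk (D := star p' q' F' none)
    (c := Sum.elim c0 fun _ => none) (hbal.of_counts (fun i => by
      rw [hstar0]
      refine card_le_card_of_surjOn Sum.inl ?_
      rintro (e | j) he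
      · rw [mem_coe, mem_filter, inl_mem_disjSum] at he
        exact ⟨e, mem_filter.2 he, rfl⟩
      · rw [mem_coe, mem_filter] at he
        cases he.2) (by
      rw [hstar0, card_disjSum, card_univ, Fintype.card_fin]
      exact le_rfl))
  obtain ⟨c', hc'⟩ := ih _ hcF' (Option V) (E ⊕ Fin (36 * k - d)) p' q' F'
    (insert none (some '' T)) none P (fun u => u.elim 0 ρ) rfl (Set.mem_insert _ _)
    ⟨some x0, Or.inr ⟨x0, hx0, rfl⟩, by simp⟩ (by
      suffices H : ∀ Z : Set (Option V), none ∉ Z → (∃ a ∈ T, some a ∈ Z) →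
          36 * k ≤ (boundary p' q' F' Z).card by
        rintro Z ⟨a, ha, haZ⟩ ⟨b, hb, hbZ⟩
        by_cases hn : none ∈ Z
        · rw [← boundary_compl]
          refine H Zᶜ (fun h => h hn) ?_
          rcases hb with rfl | ⟨b, hb, rfl⟩
          · exact absurd hn hbZ
          · exact ⟨b, hb, hbZ⟩
        · refine H Z hn ?_
          rcases ha with rfl | ⟨a, ha, rfl⟩
          · exact absurd haZ hn
          · exact ⟨a, ha, haZ⟩
      rintro Z hn ⟨a, ha, haZ⟩
      by_cases hY : {x | x ∈ X ∧ some x ∈ Z} = X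
      · have hsub : (boundary p q F X).disjSum univ ⊆ boundary p' q' F' Z := by
          rintro (e | j) he
          · rw [inl_mem_disjSum, mem_boundary] at he
            rw [mem_boundary, hF', hleave Z hn, hY]
            refine ⟨⟨he.1, ?_⟩, he.2⟩
            have := he.2
            unfold Leaves at this
            tauto
          · rw [mem_boundary]
            refine ⟨hF'r j, fun h => hn (h.2 ?_)⟩
            have : x0 ∈ {x | x ∈ X ∧ some x ∈ Z} := by
              rw [hY]
              exact hTX hx0
            exact this.2
        have := card_le_card hsub
        rw [card_disjSum, card_univ, Fintype.card_fin] at this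
        omega
      · refine (hcut _ (fun x hx => hx.1) hY ⟨a, ha, hTX ha, haZ⟩).trans ?_
        rw [← card_map (s := boundary p q F {x | x ∈ X ∧ some x ∈ Z})
          (⟨Sum.inl, Sum.inl_injective⟩ : E ↪ E ⊕ Fin (36 * k - d))]
        refine card_le_card fun e' he' => ?_
        obtain ⟨e, he, rfl⟩ := mem_map.1 he'
        rw [mem_boundary] at he
        refine mem_boundary.2 ⟨(hF' e).2 ⟨he.1, ?_⟩, (hleave Z hn e).2 he.2⟩
        have := he.2
        simp only [Leaves, Set.mem_ofPred_eq] at this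
        tauto)
    (by rw [hstar0, card_disjSum, card_univ, Fintype.card_fin]; omega) hP2
  let c : E → Option (Fin k) := fun e => if p e ∈ X ∧ q e ∈ X then c' (Sum.inl e) else c0 e
  have hcin : ∀ e, (p e ∈ X ∧ q e ∈ X) → c e = c' (Sum.inl e) := fun e he => if_pos he
  have hcout : ∀ e, ¬ (p e ∈ X ∧ q e ∈ X) → c e = c0 e := fun e he => if_neg he
  have hbd : ∀ e ∈ boundary p q F X, Sum.inl e ∈ star p' q' F' none := by
    intro e he
    rw [hstar0, inl_mem_disjSum]
    exact he
  refine ⟨c, hcout, fun i a b ha hb => ?_, fun u hu huT hdeg => ?_⟩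
  · have hatt : ∀ a, (a ∈ X ∧ (a ∈ T ∨ ∃ e ∈ boundary p q F X, Inc p q a e ∧ c0 e = some i)) →
        Att p' q' F' (insert none (some '' T)) none P i (some a) := by
      rintro a ⟨haX, ha⟩
      refine ⟨by simp, ?_⟩
      rcases ha with ha | ⟨e, he, hae, hei⟩
      · exact Or.inl (Or.inr ⟨a, ha, rfl⟩)
      · have he' := mem_star.1 (hbd e he)
        refine Or.inr ⟨Sum.inl e, he'.1, he'.2, ?_, hP1 _ (hbd e he) i hei⟩
        rcases hae with rfl | rfl
        · exact Or.inl ((hg1 _ _).2 ⟨haX, rfl⟩)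
        · exact Or.inr ((hg1 _ _).2 ⟨haX, rfl⟩)
    intro C hC
    have := hc'.linked i _ _ (hatt a ha) (hatt b hb) (some '' C) (by
      rintro (e | j) ⟨he, hei, hnone⟩
      · have hin : p e ∈ X ∧ q e ∈ X := by
          simp only [Inc, p', q', Sum.elim_inl, hg2] at hnone
          tauto
        have := hC e ⟨((hF' e).1 he).1, hin, (hcin e hin).trans hei⟩
        simpa [p', q', g, hin.1, hin.2] using this
      · exact absurd (Or.inl rfl) hnone)
    simpa using this
  · have hst : ∀ e, e ∈ star p q F u → Sum.inl e ∈ star p' q' F' (some u) := by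
      intro e he
      rw [mem_star] at he ⊢
      rw [hF']
      simp only [Inc, p', q', Sum.elim_inl, hg1]
      rcases he with ⟨he, hpe | hqe⟩
      · exact ⟨⟨he, Or.inl (hpe ▸ hu)⟩, Or.inl ⟨hpe ▸ hu, hpe⟩⟩
      · exact ⟨⟨he, Or.inr (hqe ▸ hu)⟩, Or.inr ⟨hqe ▸ hu, hqe⟩⟩
    have hst' : star p' q' F' (some u) ⊆ (star p q F u).map ⟨Sum.inl, Sum.inl_injective⟩ := by
      rintro (e | j) he
      · rw [mem_star, hF'] at he
        simp only [Inc, p', q', Sum.elim_inl, hg1] at he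
        exact mem_map.2 ⟨e, mem_star.2 ⟨he.1.1, he.2.imp And.right And.right⟩, rfl⟩
      · exfalso
        rw [mem_star] at he
        simp only [Inc, p', q', Sum.elim_inr, reduceCtorEq, Option.some.injEq, false_or] at he
        have hj := j.2
        have := huT (he.2 ▸ hx0)
        omega
    have hst'' : (star p q F u).map ⟨Sum.inl, Sum.inl_injective⟩ ⊆ star p' q' F' (some u) := by
      intro e' he'
      obtain ⟨e, he, rfl⟩ := mem_map.1 he'
      exact hst e he
    have hcard : (star p' q' F' (some u)).card = (star p q F u).card := by
      rw [subset_antisymm hst' hst'', card_map]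
    refine (hc'.bal (some u) (by simp) (by rw [hcard]; exact hdeg)).of_counts (fun i => ?_)
      (by rw [hcard]; rfl)
    rw [← card_map (⟨Sum.inl, Sum.inl_injective⟩ : E ↪ E ⊕ Fin (36 * k - d))]
    refine card_le_card fun e' he' => ?_
    obtain ⟨e, he, rfl⟩ := mem_map.1 he'
    rw [mem_filter] at he ⊢
    refine ⟨hst e he.1, ?_⟩
    change c' (Sum.inl e) = some i
    by_cases hin : p e ∈ X ∧ q e ∈ X
    · rw [← hcin e hin]
      exact he.2
    · have hb : e ∈ boundary p q F X := by
        rw [mem_boundary]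
        refine ⟨(mem_star.1 he.1).1, ?_⟩
        have h1 : p e ∈ X ∨ q e ∈ X := by
          rcases (mem_star.1 he.1).2 with h | h
          · exact Or.inl (h ▸ hu)
          · exact Or.inr (h ▸ hu)
        unfold Leaves
        tauto
      rw [hcout e hin] at he
      have h2 := mem_star.1 (hbd e hb)
      rw [hc'.agree _ h2.1 h2.2, hP1 _ (hbd e hb) i he.2]

end

section

variable {V E : Type} {p q : E → V} {F : Finset E} {k : ℕ}

/-- The edges of `F` that survive the contraction of `X`. -/
noncomputable def outer (p q : E → V) (F : Finset E) (X : Set V) : Finset E :=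
  F.filter fun e => ¬ (p e ∈ X ∧ q e ∈ X)

theorem mem_outer {X : Set V} {e : E} :
    e ∈ outer p q F X ↔ e ∈ F ∧ ¬ (p e ∈ X ∧ q e ∈ X) := mem_filter

theorem contract_of_notMem {X : Set V} {x u : V} (hu : u ∉ X) : contract X x u = u := if_neg hu

theorem contract_of_mem {X : Set V} {x u : V} (hu : u ∈ X) : contract X x u = x := if_pos hu

theorem contract_eq_iff {X : Set V} {x y u : V} (hx : x ∈ X) (hu : u ∉ X) :
    contract X x y = u ↔ y = u := by
  unfold contract
  split_ifs with hy
  · exact ⟨fun h => absurd (h ▸ hx) hu, fun h => absurd (h ▸ hy) hu⟩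
  · rfl

theorem contract_eq_self_iff {X : Set V} {x y : V} (hx : x ∈ X) : contract X x y = x ↔ y ∈ X := by
  unfold contract
  split_ifs with hy
  · simp [hy]
  · exact ⟨fun h => h ▸ hx, fun h => absurd h hy⟩

theorem inc_contract_iff {X : Set V} {x u : V} (hx : x ∈ X) (hu : u ∉ X) (e : E) :
    Inc (contract X x ∘ p) (contract X x ∘ q) u e ↔ Inc p q u e := by
  simp only [Inc, Function.comp, contract_eq_iff hx hu]

theorem star_contract {X : Set V} {x u : V} (hx : x ∈ X) (hu : u ∉ X) :
    star (contract X x ∘ p) (contract X x ∘ q) (outer p q F X) u = star p q F u := by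
  ext e
  rw [mem_star, mem_star, mem_outer, inc_contract_iff hx hu]
  refine ⟨fun h => ⟨h.1.1, h.2⟩, fun h => ⟨⟨h.1, fun h' => ?_⟩, h.2⟩⟩
  rcases h.2 with h2 | h2
  · exact hu (h2 ▸ h'.1)
  · exact hu (h2 ▸ h'.2)

theorem star_contract_self {X : Set V} {x : V} (hx : x ∈ X) :
    star (contract X x ∘ p) (contract X x ∘ q) (outer p q F X) x = boundary p q F X := by
  ext e
  rw [mem_star, mem_boundary, mem_outer]
  simp only [Inc, Function.comp, contract_eq_self_iff hx, Leaves]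
  tauto

theorem boundary_contract {X : Set V} {x : V} (Z : Set V) :
    boundary (contract X x ∘ p) (contract X x ∘ q) (outer p q F X) Z =
      boundary p q F (contract X x ⁻¹' Z) := by
  ext e
  rw [mem_boundary, mem_boundary, mem_outer]
  simp only [Leaves, Function.comp, Set.mem_preimage]
  refine ⟨fun h => ⟨h.1.1, h.2⟩, fun h => ⟨⟨h.1, fun h' => h.2 ?_⟩, h.2⟩⟩
  rw [contract_of_mem h'.1, contract_of_mem h'.2]

/-- Decomposing along a tight set with edges on both sides. -/
theorem goodColoring_of_tight [Finite V] (hk : 0 < k) (ih : ∀ m < F.card, Extendable k m)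
    {S : Set V} {v : V} {P : E → Fin k} {ρ : V → ℕ} (hv : v ∈ S)
    (hS : KConn p q F S (36 * k)) (hd : (star p q F v).card = 36 * k)
    (hP : ∀ i, 2 ≤ ((star p q F v).filter fun e => P e = i).card)
    {X : Set V} (hvX : v ∉ X) {x0 : V} (hx0S : x0 ∈ S) (hx0 : x0 ∈ X)
    (htight : (boundary p q F X).card = 36 * k)
    (hin : ∃ e ∈ F, p e ∈ X ∧ q e ∈ X) (hout : ∃ e ∈ F, p e ∉ X ∧ q e ∉ X) :
    ∃ c, GoodColoring p q F S v P ρ c := by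
  have hx0v : x0 ≠ v := fun h => hvX (h ▸ hx0)
  have hlt : (outer p q F X).card < F.card := by
    obtain ⟨e, he, heX⟩ := hin
    exact card_lt_card (filter_ssubset.2 ⟨e, he, fun h => h heX⟩)
  have hstar := star_contract (p := p) (q := q) (F := F) hx0 hvX
  obtain ⟨c0, hc0⟩ := ih _ hlt V E (contract X x0 ∘ p) (contract X x0 ∘ q) (outer p q F X)
    (insert x0 (S \ X)) v P (fun u => if u = x0 then 0 else ρ u) rfl (Or.inr ⟨hv, hvX⟩)
    ⟨x0, Or.inl rfl, hx0v⟩ (by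
      have hmem : ∀ a ∈ insert x0 (S \ X), a ∈ S ∧ contract X x0 a = a := by
        rintro a (rfl | ha)
        · exact ⟨hx0S, contract_of_mem hx0⟩
        · exact ⟨ha.1, contract_of_notMem ha.2⟩
      rintro Z ⟨a, ha, haZ⟩ ⟨b, hb, hbZ⟩
      rw [boundary_contract]
      obtain ⟨ha1, ha2⟩ := hmem a ha
      obtain ⟨hb1, hb2⟩ := hmem b hb
      exact hS _ ⟨a, ha1, by rwa [Set.mem_preimage, ha2]⟩
        ⟨b, hb1, by rwa [Set.mem_preimage, hb2]⟩)
    (by rw [hstar, hd]) (by rw [hstar]; exact hP)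
  have hbal0 := hc0.bal x0 hx0v (by
    rw [star_contract_self hx0, htight]
    omega)
  rw [star_contract_self hx0, if_pos rfl] at hbal0
  obtain ⟨c, hcout, hcl, hcb⟩ := exists_extension_inside hk ih (X := X) (T := S ∩ X) (x0 := x0)
    (F := F) (p := p) (q := q) Set.inter_subset_right ⟨hx0S, hx0⟩ htight.le
    (fun Y hYX _ ⟨a, ha, haY⟩ => hS Y ⟨a, ha.1, haY⟩ ⟨v, hv, fun h => hvX (hYX h)⟩) ρ
    (c0 := c0) (by rwa [htight, Nat.sub_self]) (by
      rw [htight, Nat.sub_self, add_zero]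
      obtain ⟨e, he, heX⟩ := hout
      exact card_lt_card (filter_ssubset.2 ⟨e, he, by tauto⟩))
  have hnot : ∀ e u, u ∉ X → Inc p q u e → ¬ (p e ∈ X ∧ q e ∈ X) := by
    rintro e u hu (h | h) h'
    · exact hu (h ▸ h'.1)
    · exact hu (h ▸ h'.2)
  refine ⟨c, fun e he hi => ?_, fun i a b ha hb => ?_, fun u huv hdeg => ?_⟩
  · rw [hcout e (hnot e v hvX hi)]
    exact hc0.agree e (mem_outer.2 ⟨he, hnot e v hvX hi⟩) ((inc_contract_iff hx0 hvX e).2 hi)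
  · let A : Set V := {a | a ∈ X ∧ (a ∈ S ∩ X ∨
      ∃ e ∈ boundary p q F X, Inc p q a e ∧ c0 e = some i)}
    have hbd : ∀ e ∈ F, ¬ (p e ∈ X ∧ q e ∈ X) → ∀ y, Inc p q y e → y ∈ X →
        e ∈ boundary p q F X := by
      intro e he hne y hy hyX
      rw [mem_boundary]
      refine ⟨he, ?_⟩
      unfold Leaves
      rcases hy with rfl | rfl <;> tauto
    have hAtt : ∀ a, Att p q F S v P i a → (a ∈ X → a ∈ A) ∧
        Att (contract X x0 ∘ p) (contract X x0 ∘ q) (outer p q F X) (insert x0 (S \ X)) v P i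
          (contract X x0 a) := by
      rintro a ⟨hav, ha⟩
      constructor
      · intro haX
        refine ⟨haX, ha.imp (fun h => ⟨h, haX⟩) ?_⟩
        rintro ⟨e, he, hve, hae, hPe⟩
        refine ⟨e, hbd e he (hnot e v hvX hve) a hae haX, hae, ?_⟩
        rw [hc0.agree e (mem_outer.2 ⟨he, hnot e v hvX hve⟩)
          ((inc_contract_iff hx0 hvX e).2 hve), hPe]
      · by_cases haX : a ∈ X
        · rw [contract_of_mem haX]
          exact ⟨hx0v, Or.inl (Or.inl rfl)⟩
        · rw [contract_of_notMem haX]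
          refine ⟨hav, ha.imp (fun h => Or.inr ⟨h, haX⟩) ?_⟩
          rintro ⟨e, he, hve, hae, hPe⟩
          exact ⟨e, mem_outer.2 ⟨he, hnot e v hvX hve⟩, (inc_contract_iff hx0 hvX e).2 hve,
            (inc_contract_iff hx0 haX e).2 hae, hPe⟩
    have hl := Linked.of_contract (A := A) (p := p) (q := q)
      (T' := {e | e ∈ F ∧ (p e ∈ X ∧ q e ∈ X) ∧ c e = some i})
      ⟨hx0, Or.inl ⟨hx0S, hx0⟩⟩ (fun a ha b hb => hcl i a b ha hb)
      (fun e he y hy hyX => ⟨hyX, Or.inr ⟨e, hbd e (mem_outer.1 he.1).1 (mem_outer.1 he.1).2 y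
        hy hyX, hy, he.2.1⟩⟩) (hAtt a ha).1 (hAtt b hb).1
      (hc0.linked i _ _ (hAtt a ha).2 (hAtt b hb).2)
    refine hl.mono ?_
    rintro e (⟨he, hei, hve⟩ | ⟨he, heX, hei⟩)
    · rw [mem_outer] at he
      exact ⟨he.1, (hcout e he.2).trans hei, fun h => hve ((inc_contract_iff hx0 hvX e).2 h)⟩
    · exact ⟨he, hei, fun h => hnot e v hvX h heX⟩
  · by_cases huX : u ∈ X
    · exact hcb u huX (fun _ => htight) hdeg
    · have hux : u ≠ x0 := fun h => huX (h ▸ hx0)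
      have h1 := hc0.bal u huv (by
        rw [star_contract hx0 huX, if_neg hux]
        exact hdeg)
      rw [star_contract hx0 huX, if_neg hux] at h1
      refine h1.of_counts (fun i => card_le_card fun e he => ?_) le_rfl
      rw [mem_filter] at he ⊢
      refine ⟨he.1, ?_⟩
      rw [← hcout e (hnot e u huX (mem_star.1 he.1).2)]
      exact he.2

end

section

variable {V E : Type} {p q : E → V} {F : Finset E} {k : ℕ}

/-- The edge `e` has an end in `X` and the other end in `Y`. -/
def Joins (p q : E → V) (X Y : Set V) (e : E) : Prop := p e ∈ X ∧ q e ∈ Y ∨ p e ∈ Y ∧ q e ∈ X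

/-- The number of edges of `F` between `X` and `Y`. -/
noncomputable def numJoining (p q : E → V) (F : Finset E) (X Y : Set V) : ℕ :=
  (F.filter (Joins p q X Y)).card

theorem card_boundary_inter_add_union (A B : Set V) :
    (boundary p q F (A ∩ B)).card + (boundary p q F (A ∪ B)).card ≤
      (boundary p q F A).card + (boundary p q F B).card := by
  simp only [boundary, card_filter, ← Finset.sum_add_distrib]
  refine Finset.sum_le_sum fun e _ => ?_
  simp only [Leaves, Set.mem_inter_iff, Set.mem_union]
  by_cases h1 : p e ∈ A <;> by_cases h2 : q e ∈ A <;> by_cases h3 : p e ∈ B <;>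
    by_cases h4 : q e ∈ B <;> simp [h1, h2, h3, h4]

theorem card_boundary_diff_add_diff (A B : Set V) :
    (boundary p q F (A \ B)).card + (boundary p q F (B \ A)).card +
      2 * numJoining p q F (A ∩ B) (A ∪ B)ᶜ ≤
      (boundary p q F A).card + (boundary p q F B).card := by
  simp only [boundary, numJoining, card_filter, ← Finset.sum_add_distrib, Finset.mul_sum]
  refine Finset.sum_le_sum fun e _ => ?_
  simp only [Leaves, Joins, Set.mem_inter_iff, Set.mem_union, Set.mem_sdiff, Set.mem_compl_iff]
  by_cases h1 : p e ∈ A <;> by_cases h2 : q e ∈ A <;> by_cases h3 : p e ∈ B <;>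
    by_cases h4 : q e ∈ B <;> simp [h1, h2, h3, h4]

theorem card_boundary_insert_add (hloop : ∀ e ∈ F, p e ≠ q e) {D : Set V} {w : V} (hw : w ∉ D) :
    (boundary p q F (insert w D)).card + 2 * numJoining p q F {w} D =
      (boundary p q F D).card + (star p q F w).card := by
  simp only [boundary, star, numJoining, card_filter, ← Finset.sum_add_distrib, Finset.mul_sum]
  refine Finset.sum_congr rfl fun e he => ?_
  have hl := hloop e he
  simp only [Leaves, Joins, Inc, Set.mem_insert_iff, Set.mem_singleton_iff]
  by_cases h1 : p e = w <;> by_cases h2 : q e = w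
  · exact absurd (h1.trans h2.symm) hl
  · by_cases h4 : q e ∈ D <;> simp [h1, h2, h4, hw]
  · by_cases h4 : p e ∈ D <;> simp [h1, h2, h4, hw]
  · by_cases h3 : p e ∈ D <;> by_cases h4 : q e ∈ D <;> simp [h1, h2, h3, h4]

theorem numJoining_mono {X Y Y' : Set V} (h : Y ⊆ Y') :
    numJoining p q F X Y ≤ numJoining p q F X Y' :=
  card_le_card (monotone_filter_right _ fun _ _ he =>
    he.imp (fun h' => ⟨h'.1, h h'.2⟩) fun h' => ⟨h h'.1, h'.2⟩)

theorem numJoining_union_le {X Y Y' : Set V} :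
    numJoining p q F X (Y ∪ Y') ≤ numJoining p q F X Y + numJoining p q F X Y' := by
  refine (card_le_card fun e he => ?_).trans (card_union_le _ _)
  simp only [mem_union, mem_filter, Joins, Set.mem_union] at he ⊢
  tauto

theorem joins_singleton_of_inc {w : V} {e : E} (hl : p e ≠ q e) (h : Inc p q w e) :
    ∃ a, a ≠ w ∧ Inc p q a e ∧ Joins p q {w} {a} e := by
  rcases h with h | h
  · exact ⟨q e, fun h' => hl (h.trans h'.symm), Or.inr rfl, Or.inl ⟨h, rfl⟩⟩
  · exact ⟨p e, fun h' => hl (h'.trans h.symm), Or.inl rfl, Or.inr ⟨rfl, h⟩⟩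

theorem Joins.mem_iff {w a : V} {e : E} (hj : Joins p q {w} {a} e) {D : Set V} (hw : w ∉ D) :
    Joins p q {w} D e ↔ a ∈ D := by
  simp only [Joins, Set.mem_singleton_iff] at hj ⊢
  rcases hj with ⟨h1, h2⟩ | ⟨h1, h2⟩
  · rw [h1, h2]
    exact ⟨fun h => h.elim (fun h => h.2) fun h => absurd h.1 hw, fun h => Or.inl ⟨rfl, h⟩⟩
  · rw [h1, h2]
    exact ⟨fun h => h.elim (fun h => absurd h.2 hw) fun h => h.1, fun h => Or.inr ⟨h, rfl⟩⟩

/-- `X` contains a single terminal, which carries all edges leaving `X`, and no edge lies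
inside `X`. -/
def IsTrivialSet (p q : E → V) (F : Finset E) (S X : Set V) : Prop :=
  ∃ t ∈ S, t ∈ X ∧ (∀ s ∈ S, s ∈ X → s = t) ∧ (∀ e ∈ F, ¬ (p e ∈ X ∧ q e ∈ X)) ∧
    boundary p q F X = star p q F t

/-- No redundant edge and no nontrivial tight cut. -/
structure Reduced (p q : E → V) (F : Finset E) (S : Set V) (K : ℕ) : Prop where
  conn : KConn p q F S K
  loopless : ∀ e ∈ F, p e ≠ q e
  tight : ∀ X : Set V, (∃ a ∈ S, a ∈ X) → (∃ b ∈ S, b ∉ X) → (boundary p q F X).card = K →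
    IsTrivialSet p q F S X ∨ IsTrivialSet p q F S Xᶜ
  covered : ∀ e ∈ F, ∃ t ∈ S, Inc p q t e ∧ (star p q F t).card = K

/-- A set violating the cut condition after splitting off two edges from `w` into it. -/
structure Dangerous (p q : E → V) (F : Finset E) (S : Set V) (K : ℕ) (w : V) (D : Set V) :
    Prop where
  meets : ∃ a ∈ S, a ∈ D
  misses : ∃ b ∈ S, b ∉ D
  notMem : w ∉ D
  card_le : (boundary p q F D).card ≤ K + 1

variable {S : Set V} {K : ℕ} {w : V}

theorem Dangerous.two_mul_le (hR : Reduced p q F S K) (hw : w ∉ S) {D : Set V}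
    (hD : Dangerous p q F S K w D) : 2 * numJoining p q F {w} D ≤ (star p q F w).card + 1 := by
  have h1 := card_boundary_insert_add (p := p) (q := q) hR.loopless hD.notMem
  obtain ⟨a, ha, haD⟩ := hD.meets
  obtain ⟨b, hb, hbD⟩ := hD.misses
  have h2 := hR.conn (insert w D) ⟨a, ha, Or.inr haD⟩
    ⟨b, hb, by rintro (rfl | h) <;> contradiction⟩
  have h3 := hD.card_le
  omega

theorem Dangerous.half_le (hR : Reduced p q F S K) (hK : Even K) {D : Set V}
    (hD : Dangerous p q F S K w D) {u u' : V} (hu : u ∈ D) (huK : (star p q F u).card = K)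
    (hu'S : u' ∈ S) (hu' : u' ∈ D) (hne : u' ≠ u) : K ≤ 2 * numJoining p q F {u} (D \ {u}) := by
  have h1 := card_boundary_insert_add (p := p) (q := q) hR.loopless (D := D \ {u}) (w := u)
    (by simp)
  rw [Set.insert_sdiff_singleton, Set.insert_eq_of_mem hu] at h1
  obtain ⟨b, hb, hbD⟩ := hD.misses
  have h2 := hR.conn (D \ {u}) ⟨u', hu'S, hu', hne⟩ ⟨b, hb, fun h => hbD h.1⟩
  have h3 := hD.card_le
  obtain ⟨m, rfl⟩ := hK
  omega

theorem Reduced.neighbor (hR : Reduced p q F S K) (hw : w ∉ S) {e : E} {a : V} (he : e ∈ F)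
    (ha : Joins p q {w} {a} e) : a ∈ S ∧ (star p q F a).card = K := by
  obtain ⟨t, htS, hte, htK⟩ := hR.covered e he
  have : t = a := by
    have htw : t ≠ w := fun h => hw (h ▸ htS)
    rcases ha with ⟨h1, h2⟩ | ⟨h1, h2⟩ <;> rw [Set.mem_singleton_iff] at h1 h2 <;>
      rcases hte with h | h
    · exact absurd (h.symm.trans h1) htw
    · exact h.symm.trans h2
    · exact h.symm.trans h1
    · exact absurd (h.symm.trans h2) htw
  exact this ▸ ⟨htS, htK⟩

/-- Two edges at a vertex of degree at least four outside `S` can be split off. -/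
theorem Reduced.exists_splittable [Finite V] (hR : Reduced p q F S K) (hK : Even K) (hw : w ∉ S)
    (hd : 4 ≤ (star p q F w).card) :
    ∃ e ∈ F, ∃ f ∈ F, ∃ a b, Joins p q {w} {a} e ∧ Joins p q {w} {b} f ∧ e ≠ f ∧
      ∀ D, Dangerous p q F S K w D → a ∈ D → b ∉ D := by
  by_contra hcon
  push Not at hcon
  have hnbr : ∀ e ∈ F, ∀ a, Joins p q {w} {a} e → a ∈ S ∧ (star p q F a).card = K :=
    fun e he a ha => hR.neighbor hw he ha
  have hex : ∀ {D : Set V}, w ∉ D → numJoining p q F {w} D < (star p q F w).card →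
      ∃ e ∈ F, ∃ a, Joins p q {w} {a} e ∧ a ∉ D := by
    intro D hwD hlt
    by_contra hall
    push Not at hall
    refine hlt.not_ge (card_le_card fun e he => ?_)
    rw [mem_star] at he
    obtain ⟨a, -, -, hj⟩ := joins_singleton_of_inc (hR.loopless e he.1) he.2
    exact mem_filter.2 ⟨he.1, (hj.mem_iff hwD).2 (hall e he.1 a hj)⟩
  have hpair : ∀ e ∈ F, ∀ f ∈ F, ∀ a b, Joins p q {w} {a} e → Joins p q {w} {b} f → a ≠ b →
      ∃ D, Dangerous p q F S K w D ∧ a ∈ D ∧ b ∈ D := by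
    intro e he f hf a b hja hjb hab
    refine hcon e he f hf a b hja hjb ?_
    rintro rfl
    have haw : a ≠ w := fun h => hw (h ▸ (hnbr e he a hja).1)
    have hbw : b ≠ w := fun h => hw (h ▸ (hnbr e hf b hjb).1)
    simp only [Joins, Set.mem_singleton_iff] at hja hjb
    rcases hja with ⟨h1, h2⟩ | ⟨h1, h2⟩ <;> rcases hjb with ⟨h3, h4⟩ | ⟨h3, h4⟩
    · exact hab (h2.symm.trans h4)
    · exact hbw (h3.symm.trans h1)
    · exact haw (h1.symm.trans h3)
    · exact hab (h1.symm.trans h3)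
  -- a dangerous set with the largest number of edges to `w`
  obtain ⟨D0, hD0⟩ : ∃ D, Dangerous p q F S K w D := by
    obtain ⟨e, f, he, hf, hef⟩ : ∃ e f, e ∈ star p q F w ∧ f ∈ star p q F w ∧ e ≠ f := by
      obtain ⟨e, he, f, hf, hef⟩ := one_lt_card.1 (show 1 < (star p q F w).card by omega)
      exact ⟨e, f, he, hf, hef⟩
    rw [mem_star] at he hf
    obtain ⟨a, -, -, hja⟩ := joins_singleton_of_inc (hR.loopless e he.1) he.2
    obtain ⟨b, -, -, hjb⟩ := joins_singleton_of_inc (hR.loopless f hf.1) hf.2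
    obtain ⟨D, hD, -⟩ := hcon e he.1 f hf.1 a b hja hjb hef
    exact ⟨D, hD⟩
  obtain ⟨D, hD, hmax⟩ := Set.exists_max_image {D | Dangerous p q F S K w D}
    (fun D => numJoining p q F {w} D) (Set.toFinite _) ⟨D0, hD0⟩
  replace hD : Dangerous p q F S K w D := hD
  replace hmax : ∀ D', Dangerous p q F S K w D' →
    numJoining p q F {w} D' ≤ numJoining p q F {w} D := hmax
  have hDle := hD.two_mul_le hR hw
  obtain ⟨e3, he3, u3, hj3, hu3⟩ := hex hD.notMem (by omega)
  have hstrict : ∀ {D'}, D ∩ {x | ∃ e ∈ F, Joins p q {w} {x} e} ⊆ D' → u3 ∈ D' → w ∉ D' →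
      numJoining p q F {w} D < numJoining p q F {w} D' := by
    intro D' hsub h3 hwD'
    refine card_lt_card ((ssubset_iff_of_subset fun e he => ?_).2 ⟨e3, ?_, ?_⟩)
    · rw [mem_filter] at he ⊢
      have hinc : Inc p q w e := by
        rcases he.2 with h | h
        · exact Or.inl h.1
        · exact Or.inr h.2
      obtain ⟨a, -, -, hj⟩ := joins_singleton_of_inc (hR.loopless e he.1) hinc
      exact ⟨he.1, (hj.mem_iff hwD').2 (hsub ⟨(hj.mem_iff hD.notMem).1 he.2, e, he.1, hj⟩)⟩
    · exact mem_filter.2 ⟨he3, (hj3.mem_iff hwD').2 h3⟩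
    · exact fun h => hu3 ((hj3.mem_iff hD.notMem).1 (mem_filter.1 h).2)
  -- two distinct neighbours of `w` in `D`
  obtain ⟨e1, he1, u1, hj1, hu1⟩ : ∃ e ∈ F, ∃ a, Joins p q {w} {a} e ∧ a ∈ D := by
    by_contra hnone
    push Not at hnone
    have h3 := hnbr e3 he3 u3 hj3
    obtain ⟨s, hs, hsne⟩ : ∃ s ∈ S, s ≠ u3 := by
      obtain ⟨a, ha, haD⟩ := hD.meets
      exact ⟨a, ha, fun h => hu3 (h ▸ haD)⟩
    have hdang : Dangerous p q F S K w {u3} :=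
      ⟨⟨u3, h3.1, rfl⟩, ⟨s, hs, hsne⟩, fun h => hw (h ▸ h3.1),
        (card_le_card (boundary_singleton_subset u3)).trans (by omega)⟩
    refine (hmax _ hdang).not_gt (hstrict ?_ rfl hdang.notMem)
    rintro x ⟨hxD, e, he, hj⟩
    exact absurd hxD (hnone e he x hj)
  obtain ⟨hu1S, hu1K⟩ := hnbr e1 he1 u1 hj1
  obtain ⟨hu3S, hu3K⟩ := hnbr e3 he3 u3 hj3
  have h13 : u1 ≠ u3 := fun h => hu3 (h ▸ hu1)
  obtain ⟨D', hD', hu1', hu3'⟩ := hpair e1 he1 e3 he3 u1 u3 hj1 hj3 h13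
  obtain ⟨u2, hu2S, hu2, h21⟩ : ∃ u2 ∈ S, u2 ∈ D ∧ u2 ≠ u1 := by
    by_contra hone
    push Not at hone
    refine (hmax _ hD').not_gt (hstrict ?_ hu3' hD'.notMem)
    rintro x ⟨hxD, e, he, hj⟩
    rw [hone x (hnbr e he x hj).1 hxD]
    exact hu1'
  have hD'le := hD'.two_mul_le hR hw
  -- complements containing `w` and one of its neighbours are not trivial
  have hnontriv : ∀ {X : Set V} {e a}, e ∈ F → Joins p q {w} {a} e → w ∉ X → a ∉ X →
      ¬ IsTrivialSet p q F S Xᶜ := by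
    rintro X e a he hj hwX haX ⟨t, -, -, -, h, -⟩
    rcases hj with ⟨h1, h2⟩ | ⟨h1, h2⟩ <;> rw [Set.mem_singleton_iff] at h1 h2 <;>
      refine h e he ⟨?_, ?_⟩ <;> simp [h1, h2, hwX, haX]
  by_cases hcov : ∃ b ∈ S, b ∉ D ∪ D'
  · have hun : ¬ (boundary p q F (D ∪ D')).card ≤ K + 1 := by
      intro hle
      have hdang : Dangerous p q F S K w (D ∪ D') := ⟨⟨u1, hu1S, Or.inl hu1⟩, hcov,
        fun h => h.elim hD.notMem hD'.notMem, hle⟩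
      exact (hmax _ hdang).not_gt (hstrict (fun x hx => Or.inl hx.1) (Or.inr hu3') hdang.notMem)
    have hsub := card_boundary_inter_add_union (p := p) (q := q) (F := F) D D'
    have h1 := hR.conn (D ∩ D') ⟨u1, hu1S, hu1, hu1'⟩ ⟨u3, hu3S, fun h => hu3 h.1⟩
    have h2 := hD.card_le
    have h3 := hD'.card_le
    rcases hR.tight (D ∩ D') ⟨u1, hu1S, hu1, hu1'⟩ ⟨u3, hu3S, fun h => hu3 h.1⟩ (by omega) with
      ht | ht
    · obtain ⟨t, -, -, htu, hno, -⟩ := ht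
      have ha := hD.half_le hR hK hu1 hu1K hu2S hu2 h21
      have hb := hD'.half_le hR hK hu1' hu1K hu3S hu3' h13.symm
      have hlt : numJoining p q F {u1} (D \ {u1}) + numJoining p q F {u1} (D' \ {u1}) <
          (star p q F u1).card := by
        unfold numJoining
        rw [← card_union_of_disjoint]
        · refine card_lt_card ((ssubset_iff_of_subset fun e he => ?_).2 ⟨e1, ?_, ?_⟩)
          · rw [mem_union, mem_filter, mem_filter] at he
            rw [mem_star]
            rcases he with ⟨he, h | h⟩ | ⟨he, h | h⟩
            exacts [⟨he, Or.inl h.1⟩, ⟨he, Or.inr h.2⟩, ⟨he, Or.inl h.1⟩, ⟨he, Or.inr h.2⟩]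
          · rw [mem_star]
            exact ⟨he1, hj1.elim (fun h => Or.inr h.2) fun h => Or.inl h.1⟩
          · rw [mem_union, mem_filter, mem_filter]
            have hwu : ¬ w = u1 := fun h => hD.notMem (h ▸ hu1)
            have := hD.notMem
            have := hD'.notMem
            simp only [Joins, Set.mem_singleton_iff, Set.mem_sdiff] at hj1 ⊢
            rcases hj1 with ⟨h1, h2⟩ | ⟨h1, h2⟩ <;> rw [h1, h2] <;> tauto
        · rw [Finset.disjoint_left]
          intro e he he'
          rw [mem_filter] at he he'
          have := hno e he.1
          have h5 := he.2
          have h6 := he'.2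
          simp only [Joins, Set.mem_singleton_iff, Set.mem_sdiff, Set.mem_inter_iff] at this h5 h6
          rcases h5 with ⟨h5, h7⟩ | ⟨h5, h7⟩ <;> rcases h6 with ⟨h6, h8⟩ | ⟨h6, h8⟩
          · exact this ⟨h5 ▸ ⟨hu1, hu1'⟩, h7.1, h8.1⟩
          · exact h7.2 h8
          · exact h5.2 h6
          · exact this ⟨⟨h5.1, h6.1⟩, h7 ▸ ⟨hu1, hu1'⟩⟩
      omega
    · exact hnontriv he3 hj3 (fun h => hD.notMem h.1) (fun h => hu3 h.1) ht
  · push Not at hcov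
    have hpos := card_boundary_diff_add_diff (p := p) (q := q) (F := F) D D'
    obtain ⟨b, hbS, hbD'⟩ := hD'.misses
    have hbD : b ∈ D := (hcov b hbS).resolve_right hbD'
    have s1 : ∃ a ∈ S, a ∈ D \ D' := ⟨b, hbS, hbD, hbD'⟩
    have s1' : ∃ a ∈ S, a ∉ D \ D' := ⟨u1, hu1S, fun h => h.2 hu1'⟩
    have s2 : ∃ a ∈ S, a ∈ D' \ D := ⟨u3, hu3S, hu3', hu3⟩
    have s2' : ∃ a ∈ S, a ∉ D' \ D := ⟨u1, hu1S, fun h => h.2 hu1⟩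
    have h1 := hR.conn _ s1 s1'
    have h2 := hR.conn _ s2 s2'
    have h3 := hD.card_le
    have h4 := hD'.card_le
    have hwI : w ∉ D ∩ D' := fun h => hD.notMem h.1
    have hwI1 : w ∉ D \ D' := fun h => hD.notMem h.1
    have hwI2 : w ∉ D' \ D := fun h => hD'.notMem h.1
    have h5 : numJoining p q F {w} (D ∩ D') ≤ numJoining p q F (D ∩ D') (D ∪ D')ᶜ := by
      refine card_le_card (monotone_filter_right _ fun e _ he => ?_)
      have hwU : w ∈ (D ∪ D')ᶜ := fun h => h.elim hD.notMem hD'.notMem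
      rcases he with ⟨h, h'⟩ | ⟨h, h'⟩ <;> rw [Set.mem_singleton_iff] at *
      · exact Or.inr ⟨h ▸ hwU, h'⟩
      · exact Or.inl ⟨h, h' ▸ hwU⟩
    have h6 : 1 ≤ numJoining p q F {w} (D ∩ D') :=
      card_pos.2 ⟨e1, mem_filter.2 ⟨he1, (hj1.mem_iff hwI).2 ⟨hu1, hu1'⟩⟩⟩
    have hdisj : ∀ {X Y : Set V}, w ∉ X → w ∉ Y → Disjoint X Y →
        numJoining p q F {w} X + numJoining p q F {w} Y ≤ numJoining p q F {w} (X ∪ Y) := by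
      intro X Y hX hY hXY
      unfold numJoining
      rw [← card_union_of_disjoint]
      · refine card_le_card fun e he => ?_
        simp only [mem_union, mem_filter, Joins, Set.mem_union] at he ⊢
        tauto
      · rw [Finset.disjoint_left]
        intro e he he'
        rw [mem_filter] at he he'
        rcases he.2 with ⟨h, h'⟩ | ⟨h, h'⟩ <;> rcases he'.2 with ⟨h6, h8⟩ | ⟨h6, h8⟩
        · exact Set.disjoint_left.1 hXY h' h8
        · exact hY ((Set.mem_singleton_iff.1 h) ▸ h6)
        · exact hX ((Set.mem_singleton_iff.1 h6) ▸ h)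
        · exact Set.disjoint_left.1 hXY h h6
    have h7 := hdisj hwI1 hwI (Set.disjoint_left.2 fun x hx hx' => hx.2 hx'.2)
    have h8 := hdisj hwI2 hwI (Set.disjoint_left.2 fun x hx hx' => hx.2 hx'.1)
    rw [Set.sdiff_union_inter] at h7
    rw [Set.inter_comm, Set.sdiff_union_inter] at h8
    have h9 : (star p q F w).card ≤ numJoining p q F {w} (D \ D') +
        (numJoining p q F {w} (D' \ D) + numJoining p q F {w} (D ∩ D')) := by
      refine le_trans (card_le_card fun e he => ?_) (numJoining_union_le.trans
        (Nat.add_le_add_left numJoining_union_le _))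
      rw [mem_star] at he
      obtain ⟨a, -, -, hj⟩ := joins_singleton_of_inc (hR.loopless e he.1) he.2
      refine mem_filter.2 ⟨he.1, (hj.mem_iff ?_).2 ?_⟩
      · rintro (h | h | h)
        exacts [hwI1 h, hwI2 h, hwI h]
      · rcases hcov a (hnbr e he.1 a hj).1 with h | h
        · by_cases h' : a ∈ D'
          exacts [Or.inr (Or.inr ⟨h, h'⟩), Or.inl ⟨h, h'⟩]
        · by_cases h' : a ∈ D
          exacts [Or.inr (Or.inr ⟨h', h⟩), Or.inr (Or.inl ⟨h, h'⟩)]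
    rw [Set.inter_comm] at h8
    obtain ⟨ea, hea⟩ := card_pos.1 (show 0 < numJoining p q F {w} (D \ D') by omega)
    rw [mem_filter] at hea
    obtain ⟨a, -, -, hja⟩ := joins_singleton_of_inc (hR.loopless ea hea.1)
      (hea.2.elim (fun h => Or.inl h.1) fun h => Or.inr h.2)
    have haD := (hja.mem_iff hwI1).1 hea.2
    obtain ⟨D'', hD'', haD'', h3D''⟩ := hpair ea hea.1 e3 he3 a u3 hja hj3
      fun h => hu3 (h ▸ haD.1)
    have hD''le := hD''.two_mul_le hR hw
    have honly : ∀ {X : Set V} {y : V}, IsTrivialSet p q F S X → y ∈ S → y ∈ X → w ∉ X →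
        y ∈ D'' → numJoining p q F {w} X ≤ numJoining p q F {w} (X ∩ D'') := by
      rintro X y ⟨t, -, -, hone, -⟩ hyS hyX hwX hyD
      refine card_le_card fun e he => ?_
      rw [mem_filter] at he ⊢
      obtain ⟨x, -, -, hj⟩ := joins_singleton_of_inc (hR.loopless e he.1)
        (he.2.elim (fun h => Or.inl h.1) fun h => Or.inr h.2)
      have hxX := (hj.mem_iff hwX).1 he.2
      have hxy : x = y := (hone x (hnbr e he.1 x hj).1 hxX).trans (hone y hyS hyX).symm
      exact ⟨he.1, (hj.mem_iff fun h => hwX h.1).2 ⟨hxX, hxy ▸ hyD⟩⟩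
    have t1 := (hR.tight _ s1 s1' (by omega)).resolve_right
      (hnontriv he1 hj1 hwI1 fun h => h.2 hu1')
    have t2 := (hR.tight _ s2 s2' (by omega)).resolve_right
      (hnontriv he1 hj1 hwI2 fun h => h.2 hu1)
    have g1 := honly t1 (hnbr ea hea.1 a hja).1 haD hwI1 haD''
    have g2 := honly t2 hu3S ⟨hu3', hu3⟩ hwI2 h3D''
    have g3 := hdisj (X := (D \ D') ∩ D'') (Y := (D' \ D) ∩ D'') (fun h => hwI1 h.1)
      (fun h => hwI2 h.1) (Set.disjoint_left.2 fun x hx hx' => hx.1.2 hx'.1.1)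
    have g4 := numJoining_mono (p := p) (q := q) (F := F) (X := {w})
      (show (D \ D') ∩ D'' ∪ (D' \ D) ∩ D'' ⊆ D'' from
        Set.union_subset Set.inter_subset_right Set.inter_subset_right)
    omega

end

section

variable {V E : Type} {p q : E → V} {F : Finset E} {k : ℕ}

/-- Splitting off preserves the cut condition unless there is a dangerous set. -/
theorem KConn.split {S : Set V} {K : ℕ} {w a b : V} {e f : E} (hS : KConn p q F S K) (he : e ∈ F)
    (hf : f ∈ F) (hef : e ≠ f) (hje : Joins p q {w} {a} e) (hjf : Joins p q {w} {b} f)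
    (hD : ∀ D, Dangerous p q F S K w D → a ∈ D → b ∉ D) :
    KConn (Function.update p e a) (Function.update q e b) (F.erase f) S K := by
  have key : ∀ X : Set V, w ∉ X → (∃ a ∈ S, a ∈ X) → (∃ b ∈ S, b ∉ X) →
      K ≤ (boundary (Function.update p e a) (Function.update q e b) (F.erase f) X).card := by
    intro X hwX h1 h2
    have hX := hS X h1 h2
    have hbad : a ∈ X → b ∈ X → K + 2 ≤ (boundary p q F X).card := by
      intro ha hb
      by_contra hlt
      exact hD X ⟨h1, h2, hwX, by omega⟩ ha hb
    have hFe : F.erase f = insert e ((F.erase f).erase e) :=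
      (insert_erase (mem_erase.2 ⟨hef, he⟩)).symm
    have hF : F = insert f (insert e ((F.erase f).erase e)) := by
      rw [← hFe, insert_erase hf]
    have hnf : f ∉ insert e ((F.erase f).erase e) := by simp [hef.symm]
    have hne : e ∉ (F.erase f).erase e := by simp
    have hG : ∑ x ∈ (F.erase f).erase e,
        (if Leaves (Function.update p e a) (Function.update q e b) X x then 1 else 0) =
        ∑ x ∈ (F.erase f).erase e, if Leaves p q X x then 1 else 0 := by
      refine Finset.sum_congr rfl fun x hx => ?_
      have hxe : x ≠ e := (mem_erase.1 hx).1
      have : Leaves (Function.update p e a) (Function.update q e b) X x ↔ Leaves p q X x := by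
        simp only [Leaves, Function.update_of_ne hxe]
      simp only [this]
    have e1 : (boundary p q F X).card = (if Leaves p q X f then 1 else 0) +
        ((if Leaves p q X e then 1 else 0) +
          ∑ x ∈ (F.erase f).erase e, if Leaves p q X x then 1 else 0) := by
      rw [boundary, card_filter]
      conv_lhs => rw [hF]
      rw [sum_insert hnf, sum_insert hne]
    have e2 : (boundary (Function.update p e a) (Function.update q e b) (F.erase f) X).card =
        (if (a ∈ X ↔ b ∈ X) then 0 else 1) +
          ∑ x ∈ (F.erase f).erase e, if Leaves p q X x then 1 else 0 := by
      rw [boundary, card_filter, hFe, sum_insert hne, ← hFe, hG]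
      simp [Leaves]
    have le : Leaves p q X e ↔ a ∈ X := by
      unfold Leaves
      rcases hje with ⟨h, h'⟩ | ⟨h, h'⟩ <;> rw [Set.mem_singleton_iff] at h h' <;>
        rw [h, h'] <;> tauto
    have lf : Leaves p q X f ↔ b ∈ X := by
      unfold Leaves
      rcases hjf with ⟨h, h'⟩ | ⟨h, h'⟩ <;> rw [Set.mem_singleton_iff] at h h' <;>
        rw [h, h'] <;> tauto
    simp only [le, lf] at e1
    by_cases ha : a ∈ X <;> by_cases hb : b ∈ X <;> simp only [ha, hb] at e1 e2 hbad <;>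
      simp at e1 e2 hbad <;> omega
  intro X h1 h2
  by_cases hwX : w ∈ X
  · rw [← boundary_compl]
    obtain ⟨s, hs, hsX⟩ := h1
    exact key Xᶜ (fun h => h hwX) h2 ⟨s, hs, fun h => h hsX⟩
  · exact key X hwX h1 h2

/-- Splitting off two edges at a vertex that need not be balanced. -/
theorem goodColoring_of_split (ih : ∀ m < F.card, Extendable k m) [Finite V] {S : Set V} {v : V}
    {P : E → Fin k} {ρ : V → ℕ} (hv : v ∈ S) (hs : ∃ s ∈ S, s ≠ v)
    (hR : Reduced p q F S (36 * k)) (hd : (star p q F v).card = 36 * k)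
    (hP : ∀ i, 2 ≤ ((star p q F v).filter fun e => P e = i).card)
    {w : V} (hw : w ∉ S) (hdw : 4 ≤ (star p q F w).card)
    (hbal : 34 * k ≤ (star p q F w).card + ρ w → 2 * k ≤ ρ w) :
    ∃ c, GoodColoring p q F S v P ρ c := by
  obtain ⟨e, he, f, hf, a, b, hje, hjf, hef, hD⟩ :=
    hR.exists_splittable ⟨18 * k, by omega⟩ hw hdw
  have hab : a ≠ b := by
    rintro rfl
    obtain ⟨haS, haK⟩ := hR.neighbor hw he hje
    obtain ⟨s, hs, hsv⟩ := hs
    refine hD {a} ⟨⟨a, haS, rfl⟩, ?_, fun h => hw (h ▸ haS),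
      (card_le_card (boundary_singleton_subset a)).trans (by omega)⟩ rfl rfl
    by_cases hav : a = v
    · exact ⟨s, hs, fun h => hsv (h.trans hav)⟩
    · exact ⟨v, hv, fun h => hav h.symm⟩
  wlog hbv : b ≠ v generalizing e f a b
  · exact this f hf e he b a hjf hje hef.symm (fun D h1 h2 h3 => hD D h1 h3 h2) hab.symm
      fun h => hab (h.trans (not_not.1 hbv).symm)
  have hvw : v ≠ w := fun h => hw (h ▸ hv)
  have hince : ∀ u, Inc p q u e ↔ u = w ∨ u = a := by
    intro u
    unfold Inc
    rcases hje with ⟨h, h'⟩ | ⟨h, h'⟩ <;> rw [Set.mem_singleton_iff] at h h' <;>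
      rw [h, h', eq_comm (b := u), eq_comm (b := u)]
    exact or_comm
  have hincf : ∀ u, Inc p q u f ↔ u = w ∨ u = b := by
    intro u
    unfold Inc
    rcases hjf with ⟨h, h'⟩ | ⟨h, h'⟩ <;> rw [Set.mem_singleton_iff] at h h' <;>
      rw [h, h', eq_comm (b := u), eq_comm (b := u)]
    exact or_comm
  set p' := Function.update p e a with hp'
  set q' := Function.update q e b with hq'
  have hince' : ∀ u, Inc p' q' u e ↔ u = a ∨ u = b := by
    intro u
    simp only [Inc, hp', hq', Function.update_self, eq_comm]
  have hinc' : ∀ u x, x ≠ e → (Inc p' q' u x ↔ Inc p q u x) := by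
    intro u x hx
    simp only [Inc, hp', hq', Function.update_of_ne hx]
  let g : E → E := fun x => if x = f then e else x
  have hstar : ∀ u, u ≠ w → star p' q' (F.erase f) u = (star p q F u).image g ∧
      Set.InjOn g (star p q F u) := by
    intro u hu
    constructor
    · ext x
      simp only [mem_star, mem_image, mem_erase]
      constructor
      · rintro ⟨⟨hxf, hx⟩, hi⟩
        by_cases hxe : x = e
        · subst hxe
          rcases (hince' u).1 hi with rfl | rfl
          · exact ⟨x, ⟨hx, (hince u).2 (Or.inr rfl)⟩, if_neg hxf⟩
          · exact ⟨f, ⟨hf, (hincf u).2 (Or.inr rfl)⟩, if_pos rfl⟩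
        · exact ⟨x, ⟨hx, (hinc' u x hxe).1 hi⟩, if_neg hxf⟩
      · rintro ⟨y, ⟨hy, hi⟩, rfl⟩
        by_cases hyf : y = f
        · subst hyf
          simp only [g, if_pos]
          exact ⟨⟨hef, he⟩, (hince' u).2 (Or.inr (((hincf u).1 hi).resolve_left hu))⟩
        · simp only [g, if_neg hyf]
          refine ⟨⟨hyf, hy⟩, ?_⟩
          by_cases hye : y = e
          · subst hye
            exact (hince' u).2 (Or.inl (((hince u).1 hi).resolve_left hu))
          · exact (hinc' u y hye).2 hi
    · have hnot : ¬ (e ∈ star p q F u ∧ f ∈ star p q F u) := by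
        rintro ⟨h1, h2⟩
        have h3 := ((hince u).1 (mem_star.1 h1).2).resolve_left hu
        have h4 := ((hincf u).1 (mem_star.1 h2).2).resolve_left hu
        exact hab (h3.symm.trans h4)
      intro x hx y hy hxy
      simp only [g] at hxy
      rw [mem_coe] at hx hy
      split_ifs at hxy with h1 h2 h2
      · exact h1.trans h2.symm
      · exact absurd ⟨hxy ▸ hy, h1 ▸ hx⟩ hnot
      · exact absurd ⟨hxy ▸ hx, h2 ▸ hy⟩ hnot
      · exact hxy
  have hdeg : ∀ u, u ≠ w → (star p' q' (F.erase f) u).card = (star p q F u).card := by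
    intro u hu
    rw [(hstar u hu).1, card_image_of_injOn (hstar u hu).2]
  have hstarv : star p' q' (F.erase f) v = star p q F v := by
    rw [(hstar v hvw).1]
    refine (image_congr fun x hx => ?_).trans image_id
    have : x ≠ f := by
      rintro rfl
      rcases (hincf v).1 (mem_star.1 hx).2 with h | h
      exacts [hvw h, hbv h.symm]
    exact if_neg this
  obtain ⟨c', hc'⟩ := ih _ (card_erase_lt_of_mem hf) V E p' q' (F.erase f) S v P ρ rfl hv hs
    (hR.conn.split he hf hef hje hjf hD) (hstarv ▸ hd) (hstarv ▸ hP)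
  have hfv : ¬ Inc p q v f := fun h => ((hincf v).1 h).elim hvw hbv.symm
  have hinv : ∀ x ∈ F, Inc p q v x → x ∈ F.erase f ∧ Inc p' q' v x := by
    intro x hx hi
    have hm : x ∈ star p' q' (F.erase f) v := hstarv ▸ mem_star.2 ⟨hx, hi⟩
    exact mem_star.1 hm
  have hcne : ∀ x, x ≠ f → Function.update c' f (c' e) x = c' x :=
    fun x hx => Function.update_of_ne hx _ _
  refine ⟨Function.update c' f (c' e), fun x hx hi => ?_, fun i => ?_, fun u hu hdegu => ?_⟩
  · obtain ⟨h1, h2⟩ := hinv x hx hi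
    rw [hcne x (mem_erase.1 h1).1]
    exact hc'.agree x h1 h2
  · set T : Set E := {x | x ∈ F ∧ Function.update c' f (c' e) x = some i ∧ ¬ Inc p q v x} with hT
    have hlift : ∀ x y, Linked p' q' {x | x ∈ F.erase f ∧ c' x = some i ∧ ¬ Inc p' q' v x} x y →
        Linked p q T x y := by
      intro x y h C hC
      refine h C ?_
      rintro z ⟨hz, hzi, hzv⟩
      rw [mem_erase] at hz
      by_cases hze : z = e
      · subst hze
        have hva : v ≠ a := fun h => hzv ((hince' v).2 (Or.inl h))
        have h1 := hC z ⟨hz.2, (hcne z hz.1).trans hzi,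
          fun h => ((hince v).1 h).elim hvw hva⟩
        have h2 := hC f ⟨hf, (Function.update_self ..).trans hzi, hfv⟩
        simp only [hp', hq', Function.update_self]
        simp only [Joins, Set.mem_singleton_iff] at hje hjf
        rcases hje with ⟨h3, h4⟩ | ⟨h3, h4⟩ <;> rcases hjf with ⟨h5, h6⟩ | ⟨h5, h6⟩ <;>
          rw [h3, h4] at h1 <;> rw [h5, h6] at h2 <;> tauto
      · have := hC z ⟨hz.2, (hcne z hz.1).trans hzi, fun h => hzv ((hinc' v z hze).2 h)⟩
        simpa only [hp', hq', Function.update_of_ne hze] using this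
    have hAtt : ∀ x, Att p q F S v P i x → ∃ y, Att p' q' (F.erase f) S v P i y ∧
        Linked p q T x y := by
      rintro x ⟨hxv, hx⟩
      rcases hx with hx | ⟨y, hy, hvy, hxy, hPy⟩
      · exact ⟨x, ⟨hxv, Or.inl hx⟩, Linked.refl _ _⟩
      · obtain ⟨h1, h2⟩ := hinv y hy hvy
        by_cases hye : y = e
        · subst hye
          have hva : v = a := ((hince v).1 hvy).resolve_left hvw
          have hxw : x = w := ((hince x).1 hxy).resolve_right fun h => hxv (h.trans hva.symm)
          refine ⟨b, ⟨hbv, Or.inr ⟨y, h1, h2, (hince' b).2 (Or.inr rfl), hPy⟩⟩, ?_⟩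
          intro C hC
          have h3 := hC f ⟨hf, (Function.update_self ..).trans
            ((hc'.agree y h1 h2).trans (congrArg _ hPy)), hfv⟩
          subst hxw
          rcases hjf with ⟨h5, h6⟩ | ⟨h5, h6⟩ <;> rw [Set.mem_singleton_iff] at h5 h6 <;>
            rw [h5, h6] at h3
          exacts [h3, h3.symm]
        · exact ⟨x, ⟨hxv, Or.inr ⟨y, h1, h2, (hinc' x y hye).2 hxy, hPy⟩⟩, Linked.refl _ _⟩
    intro x y hx hy
    obtain ⟨x', hx', hxx'⟩ := hAtt x hx
    obtain ⟨y', hy', hyy'⟩ := hAtt y hy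
    exact hxx'.trans ((hlift _ _ (hc'.linked i x' y' hx' hy')).trans hyy'.symm)
  · by_cases huw : u = w
    · subst huw
      exact bal_of_free ((hbal hdegu).trans (Nat.le_add_left _ _))
    · have hde := hdeg u huw
      refine (hc'.bal u hu (by omega)).of_counts (fun i => ?_) (by omega)
      rw [← card_image_of_injOn ((hstar u huw).2.mono (coe_subset.2 (filter_subset _ _)))]
      refine card_le_card ?_
      intro y hy
      obtain ⟨x, hx, rfl⟩ := mem_image.1 hy
      rw [mem_filter] at hx
      rw [mem_filter, (hstar u huw).1]
      refine ⟨mem_image_of_mem _ hx.1, ?_⟩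
      by_cases hxf : x = f
      · subst hxf
        simp only [g, if_pos]
        rw [← hx.2, Function.update_self]
      · simp only [g, if_neg hxf]
        rw [← hx.2, hcne x hxf]

end

section

variable {V E : Type} {p q : E → V} {F : Finset E} {k : ℕ} {S : Set V} {v : V}

/-- A vertex outside `S` of degree at most three. -/
def IsSmall (p q : E → V) (F : Finset E) (S : Set V) (u : V) : Prop :=
  u ∉ S ∧ (star p q F u).card ≤ 3

/-- The vertices other than `v` that are not small. -/
def Big (p q : E → V) (F : Finset E) (S : Set V) (v : V) : Type :=
  {u : V // u ≠ v ∧ ¬ IsSmall p q F S u}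

/-- The hyperedge containing the edge `e`: all edges at a small vertex form one hyperedge. -/
noncomputable def node (p q : E → V) (F : Finset E) (S : Set V) (e : E) : V ⊕ E :=
  if IsSmall p q F S (p e) then Sum.inl (p e) else
    if IsSmall p q F S (q e) then Sum.inl (q e) else Sum.inr e

/-- The big vertices of the hyperedge `n`. -/
def feet (p q : E → V) (F : Finset E) (S : Set V) (v : V) (n : V ⊕ E) : Set (Big p q F S v) :=
  {b | ∃ e ∈ F, node p q F S e = n ∧ Inc p q b.1 e}

/-- The hyperedge `n` contains `v`. -/
def Touches (p q : E → V) (F : Finset E) (S : Set V) (v : V) (n : V ⊕ E) : Prop :=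
  ∃ e ∈ F, node p q F S e = n ∧ Inc p q v e

/-- The hyperedges avoiding `v`. -/
noncomputable def farNodes (p q : E → V) (F : Finset E) (S : Set V) (v : V) : Finset (V ⊕ E) :=
  (F.image (node p q F S)).filter fun n => ¬ Touches p q F S v n

/-- The hyperedges containing `v`. -/
noncomputable def nearNodes (p q : E → V) (F : Finset E) (S : Set V) (v : V) : Finset (V ⊕ E) :=
  (F.image (node p q F S)).filter fun n => Touches p q F S v n

/-- Every edge has an end in `S`, and `v` is a terminal of the smallest possible degree. -/
structure Independent (p q : E → V) (F : Finset E) (S : Set V) (v : V) (K : ℕ) : Prop where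
  conn : KConn p q F S K
  loopless : ∀ e ∈ F, p e ≠ q e
  covered : ∀ e ∈ F, ∃ t ∈ S, Inc p q t e
  mem : v ∈ S
  other : ∃ s ∈ S, s ≠ v
  deg : (star p q F v).card = K

theorem inc_eq_or_eq {a b c : V} {e : E} (ha : Inc p q a e) (hb : Inc p q b e) (hab : a ≠ b)
    (hc : Inc p q c e) : c = a ∨ c = b := by
  unfold Inc at *
  rcases ha with rfl | rfl <;> rcases hb with rfl | rfl <;> rcases hc with rfl | rfl <;> simp_all

theorem exists_inc_ne {e : E} (hl : p e ≠ q e) (a : V) : ∃ b, b ≠ a ∧ Inc p q b e := by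
  by_cases h : p e = a
  · exact ⟨q e, fun h' => hl (h.trans h'.symm), Or.inr rfl⟩
  · exact ⟨p e, h, Or.inl rfl⟩

theorem Independent.not_small_of_inc {K : ℕ} (h : Independent p q F S v K)
    {a b : V} {e : E} (he : e ∈ F) (ha : Inc p q a e)
    (hb : Inc p q b e) (hab : a ≠ b) (has : IsSmall p q F S a) : b ∈ S := by
  obtain ⟨t, ht, hte⟩ := h.covered e he
  rcases inc_eq_or_eq ha hb hab hte with rfl | rfl
  · exact absurd ht has.1
  · exact ht

theorem Independent.not_small {K : ℕ} (h : Independent p q F S v K)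
    : ¬ IsSmall p q F S v := fun hs => hs.1 h.mem

theorem Independent.node_eq_inl {K : ℕ} (h : Independent p q F S v K) {e : E} (he : e ∈ F) {w : V} :
    node p q F S e = Sum.inl w ↔ IsSmall p q F S w ∧ Inc p q w e := by
  unfold node
  split_ifs with h1 h2
  · rw [Sum.inl.injEq]
    refine ⟨fun hw => hw ▸ ⟨h1, Or.inl rfl⟩, fun hw => by_contra fun hne => ?_⟩
    exact hw.1.1 (h.not_small_of_inc he (Or.inl rfl) hw.2 hne h1)
  · rw [Sum.inl.injEq]
    refine ⟨fun hw => hw ▸ ⟨h2, Or.inr rfl⟩, fun hw => by_contra fun hne => ?_⟩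
    exact hw.1.1 (h.not_small_of_inc he (Or.inr rfl) hw.2 hne h2)
  · refine ⟨fun hw => (by cases hw), ?_⟩
    rintro ⟨hw, rfl | rfl⟩ <;> contradiction

theorem Independent.node_eq_inr {K : ℕ} (h : Independent p q F S v K) {e e' : E} (he : e ∈ F) :
    node p q F S e = Sum.inr e' ↔ e = e' ∧ ∀ w, Inc p q w e → ¬ IsSmall p q F S w := by
  constructor
  · intro hn
    refine ⟨?_, fun w hw hs => ?_⟩
    · unfold node at hn
      split_ifs at hn
      simpa using hn
    · rw [(h.node_eq_inl he).2 ⟨hs, hw⟩] at hn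
      cases hn
  · rintro ⟨rfl, hw⟩
    unfold node
    rw [if_neg (hw _ (Or.inl rfl)), if_neg (hw _ (Or.inr rfl))]

/-- Two edges of the same hyperedge agree or share a small vertex. -/
theorem Independent.eq_or_small {K : ℕ} (h : Independent p q F S v K)
    {e e' : E} (he : e ∈ F) (he' : e' ∈ F)
    (hn : node p q F S e = node p q F S e') :
    e = e' ∨ ∃ w, node p q F S e = Sum.inl w ∧ IsSmall p q F S w ∧ Inc p q w e ∧ Inc p q w e' := by
  rcases hne : node p q F S e with w | x
  · have h1 := (h.node_eq_inl he).1 hne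
    have h2 := (h.node_eq_inl he').1 (hn.symm.trans hne)
    exact Or.inr ⟨w, rfl, h1.1, h1.2, h2.2⟩
  · have h1 := (h.node_eq_inr he).1 hne
    have h2 := (h.node_eq_inr he').1 (hn.symm.trans hne)
    exact Or.inl (h1.1.trans h2.1.symm)

theorem Independent.two_mul_numJoining_le {K : ℕ} (h : Independent p q F S v K)
    {w : V} (hw : w ∉ S) :
    2 * numJoining p q F {w} {v} ≤ (star p q F w).card := by
  have hvw : v ≠ w := fun hh => hw (hh ▸ h.mem)
  have h1 := card_boundary_insert_add (p := p) (q := q) h.loopless (D := {v}) (w := w) hvw.symm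
  obtain ⟨s, hs, hsv⟩ := h.other
  have h2 := h.conn (insert w {v}) ⟨v, h.mem, Or.inr rfl⟩
    ⟨s, hs, by rintro (rfl | rfl) <;> contradiction⟩
  have h3 := card_le_card (boundary_singleton_subset (p := p) (q := q) (F := F) v)
  have h4 := h.deg
  omega

theorem joins_of_inc {w : V} {e : E} (hw : w ≠ v) (hwe : Inc p q w e)
    (hve : Inc p q v e) : Joins p q {w} {v} e := by
  unfold Inc Joins at *
  simp only [Set.mem_singleton_iff]
  rcases hwe with h1 | h1 <;> rcases hve with h2 | h2
  · exact absurd (h1.symm.trans h2) hw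
  · exact Or.inl ⟨h1, h2⟩
  · exact Or.inr ⟨h2, h1⟩
  · exact absurd (h1.symm.trans h2) hw

theorem Independent.node_injOn {K : ℕ} (h : Independent p q F S v K)
    : Set.InjOn (node p q F S) (star p q F v) := by
  intro e he e' he' hn
  rw [mem_coe, mem_star] at he he'
  rcases h.eq_or_small he.1 he'.1 hn with heq | ⟨w, -, hw, hwe, hwe'⟩
  · exact heq
  · have h1 := h.two_mul_numJoining_le hw.1
    have h2 := hw.2
    have hwv : w ≠ v := fun hh => hw.1 (hh ▸ h.mem)
    exact card_le_one.1 (show numJoining p q F {w} {v} ≤ 1 by omega) e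
      (mem_filter.2 ⟨he.1, joins_of_inc hwv hwe he.2⟩) e'
      (mem_filter.2 ⟨he'.1, joins_of_inc hwv hwe' he'.2⟩)

theorem Independent.feet_nonempty {K : ℕ} (h : Independent p q F S v K)
    {n : V ⊕ E} (hn : Touches p q F S v n) :
    (feet p q F S v n).Nonempty := by
  obtain ⟨e, he, rfl, hve⟩ := hn
  rcases hne : node p q F S e with w | x
  · have h1 := (h.node_eq_inl he).1 hne
    have h2 := h.two_mul_numJoining_le h1.1.1
    have hwv : w ≠ v := fun hh => h1.1.1 (hh ▸ h.mem)
    have h3 : 0 < numJoining p q F {w} {v} :=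
      card_pos.2 ⟨e, mem_filter.2 ⟨he, joins_of_inc hwv h1.2 hve⟩⟩
    obtain ⟨e', he', hnot⟩ := exists_mem_notMem_of_card_lt_card
      (show (F.filter (Joins p q {w} {v})).card < (star p q F w).card by
        unfold numJoining at h2 h3
        omega)
    rw [mem_star] at he'
    obtain ⟨b, hbw, hb⟩ := exists_inc_ne (h.loopless e' he'.1) w
    have hbS := h.not_small_of_inc he'.1 he'.2 hb hbw.symm h1.1
    refine ⟨⟨b, ?_, fun hh => hh.1 hbS⟩, e', he'.1, (h.node_eq_inl he'.1).2 ⟨h1.1, he'.2⟩, hb⟩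
    rintro rfl
    exact hnot (mem_filter.2 ⟨he'.1, joins_of_inc hwv he'.2 hb⟩)
  · have h1 := (h.node_eq_inr he).1 hne
    obtain ⟨b, hbv, hb⟩ := exists_inc_ne (h.loopless e he) v
    exact ⟨⟨b, hbv, h1.2 b hb⟩, e, he, hne, hb⟩

theorem Independent.ncard_feet_le {K : ℕ} (h : Independent p q F S v K) [Finite V] (n : V ⊕ E) :
    (feet p q F S v n).ncard ≤ 3 ∧ (Touches p q F S v n → (feet p q F S v n).ncard ≤ 2) := by
  have hsub : ∀ G : Finset V, (∀ b ∈ feet p q F S v n, b.1 ∈ G) →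
      (feet p q F S v n).ncard ≤ G.card := by
    intro G hG
    rw [← Set.ncard_coe_finset,
      ← Set.ncard_image_of_injective (feet p q F S v n) Subtype.val_injective]
    refine Set.ncard_le_ncard ?_ (finite_toSet G)
    rintro _ ⟨b, hb, rfl⟩
    exact hG b hb
  rcases n with w | e
  · by_cases hw : IsSmall p q F S w
    · let oth : E → V := fun e => if p e = w then q e else p e
      have hoth : ∀ b e, b ≠ w → Inc p q w e → Inc p q b e → oth e = b := by
        intro b e hbw hwe hbe
        simp only [oth]
        split_ifs with hp
        · exact hbe.resolve_left fun hh => hbw (hh.symm.trans hp)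
        · exact hbe.resolve_right fun hh => hbw (hh.symm.trans (hwe.resolve_left hp))
      have hne : ∀ b : Big p q F S v, b.1 ≠ w := fun b hb => b.2.2 (hb ▸ hw)
      constructor
      · refine (hsub ((star p q F w).image oth) ?_).trans (card_image_le.trans hw.2)
        rintro b ⟨e, he, hn, hb⟩
        have hwe := ((h.node_eq_inl he).1 hn).2
        exact mem_image.2 ⟨e, mem_star.2 ⟨he, hwe⟩, hoth b.1 e (hne b) hwe hb⟩
      · rintro ⟨e0, he0, hn0, hv0⟩
        have hwe0 := ((h.node_eq_inl he0).1 hn0).2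
        have hwv : w ≠ v := fun hh => hw.1 (hh ▸ h.mem)
        have hc := card_erase_of_mem (mem_star.2 ⟨he0, hwe0⟩)
        have h3 := hw.2
        refine (hsub (((star p q F w).erase e0).image oth) ?_).trans
          (card_image_le.trans (by omega))
        rintro b ⟨e, he, hn, hb⟩
        have hwe := ((h.node_eq_inl he).1 hn).2
        refine mem_image.2 ⟨e, mem_erase.2 ⟨?_, mem_star.2 ⟨he, hwe⟩⟩, hoth b.1 e (hne b) hwe hb⟩
        rintro rfl
        rcases inc_eq_or_eq hwe0 hv0 hwv hb with hh | hh
        exacts [hne b hh, b.2.1 hh]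
    · have hemp : feet p q F S v (Sum.inl w) = ∅ := by
        rw [Set.eq_empty_iff_forall_notMem]
        rintro b ⟨e, he, hn, -⟩
        exact hw ((h.node_eq_inl he).1 hn).1
      rw [hemp, Set.ncard_empty]
      exact ⟨by omega, fun _ => by omega⟩
  · have h2 : (feet p q F S v (Sum.inr e)).ncard ≤ 2 := by
      refine (hsub {p e, q e} ?_).trans card_le_two
      rintro b ⟨e', he', hn, hb⟩
      have := ((h.node_eq_inr he').1 hn).1
      subst this
      rw [mem_insert, mem_singleton]
      exact hb.imp Eq.symm Eq.symm
    exact ⟨h2.trans (by omega), fun _ => h2⟩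

theorem Independent.card_nearNodes_le {K : ℕ} (h : Independent p q F S v K)
    : (nearNodes p q F S v).card ≤ K := by
  rw [← h.deg]
  refine (card_le_card fun n hn => ?_).trans (card_image_le (f := node p q F S))
  obtain ⟨e, he, hn, hve⟩ := (mem_filter.1 hn).2
  exact mem_image.2 ⟨e, mem_star.2 ⟨he, hve⟩, hn⟩

theorem card_le_crossing {X : Set (Big p q F S v)} {G : Finset E} (hG : G ⊆ F)
    (hinj : Set.InjOn (node p q F S) G)
    (hX : ∀ e ∈ G, ∃ b ∈ feet p q F S v (node p q F S e), b ∈ X)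
    (hX' : ∀ e ∈ G, Touches p q F S v (node p q F S e) ∨
      ∃ b ∈ feet p q F S v (node p q F S e), b ∉ X) :
    G.card ≤ (crossing (feet p q F S v) (farNodes p q F S v) X).card +
      (crossing (feet p q F S v) (nearNodes p q F S v) X).card +
      (inside (feet p q F S v) (nearNodes p q F S v) X).card := by
  rw [← card_image_of_injOn hinj]
  refine (card_le_card fun n hn => ?_).trans ((card_union_le _ _).trans
    (Nat.add_le_add_right (card_union_le _ _) _))
  obtain ⟨e, he, rfl⟩ := mem_image.1 hn
  have hmem : node p q F S e ∈ F.image (node p q F S) := mem_image_of_mem _ (hG he)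
  obtain ⟨b, hb, hbX⟩ := hX e he
  have hcr : (∃ b ∈ feet p q F S v (node p q F S e), b ∉ X) →
      ¬ OneSided X (feet p q F S v (node p q F S e)) := by
    rintro ⟨b', hb', hbX'⟩ hone
    exact hbX' ((hone b hb b' hb').1 hbX)
  simp only [mem_union, crossing, inside, farNodes, nearNodes, mem_filter, hmem, true_and]
  by_cases ht : Touches p q F S v (node p q F S e)
  · by_cases hsub : feet p q F S v (node p q F S e) ⊆ X
    · exact Or.inr ⟨ht, hsub⟩
    · exact Or.inl (Or.inr ⟨ht, hcr (Set.not_subset.1 hsub)⟩)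
  · exact Or.inl (Or.inl ⟨ht, hcr ((hX' e he).resolve_left ht)⟩)

theorem touches_or_feet {X : Set (Big p q F S v)} {e : E} (he : e ∈ F) {y : V}
    (hy : Inc p q y e) (hys : ¬ IsSmall p q F S y) (hyX : y ∉ Subtype.val '' X) :
    Touches p q F S v (node p q F S e) ∨ ∃ b ∈ feet p q F S v (node p q F S e), b ∉ X := by
  by_cases hyv : y = v
  · exact Or.inl ⟨e, he, rfl, hyv ▸ hy⟩
  · exact Or.inr ⟨⟨y, hyv, hys⟩, ⟨e, he, rfl, hy⟩, fun hh => hyX ⟨_, hh, rfl⟩⟩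

/-- A cut of the hypergraph containing a terminal on the side not containing `v`. -/
theorem Independent.le_crossing_of_terminal {K : ℕ} (h : Independent p q F S v K)
    {X : Set (Big p q F S v)}
    (hX : ∃ b ∈ X, b.1 ∈ S) :
    K ≤ (crossing (feet p q F S v) (farNodes p q F S v) X).card +
      (crossing (feet p q F S v) (nearNodes p q F S v) X).card +
      (inside (feet p q F S v) (nearNodes p q F S v) X).card := by
  set Z0 : Set V := Subtype.val '' X with hZ0
  let A : V → Finset E := fun w => (star p q F w).filter fun e => ∃ z ∈ Z0, Inc p q z e
  let A' : V → Finset E := fun w => (star p q F w).filter fun e => ¬ ∃ z ∈ Z0, Inc p q z e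
  set Z : Set V := {u | u ∈ Z0 ∨ IsSmall p q F S u ∧ (A' u).card < (A u).card} with hZ
  have hZ0s : ∀ z ∈ Z0, ¬ IsSmall p q F S z := by
    rintro _ ⟨b, -, rfl⟩
    exact b.2.2
  have hvZ : v ∉ Z := by
    rintro (⟨b, -, hb⟩ | hv)
    exacts [b.2.1 hb, h.not_small hv.1]
  have hZns : ∀ y, ¬ IsSmall p q F S y → (y ∈ Z ↔ y ∈ Z0) :=
    fun y hy => ⟨fun hh => hh.resolve_right fun h' => hy h'.1, Or.inl⟩
  have hZs : ∀ w, IsSmall p q F S w → (w ∈ Z ↔ (A' w).card < (A w).card) :=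
    fun w hw => ⟨fun hh => (hh.resolve_left fun h' => hZ0s w h' hw).2, fun hh => Or.inr ⟨hw, hh⟩⟩
  obtain ⟨b0, hb0, hb0S⟩ := hX
  refine (h.conn Z ⟨b0.1, hb0S, Or.inl ⟨b0, hb0, rfl⟩⟩ ⟨v, h.mem, hvZ⟩).trans ?_
  have hfoot : ∀ e ∈ F, (∃ z ∈ Z0, Inc p q z e) →
      ∃ b ∈ feet p q F S v (node p q F S e), b ∈ X := by
    rintro e he ⟨_, ⟨b, hb, rfl⟩, hz⟩
    exact ⟨b, ⟨e, he, rfl, hz⟩, hb⟩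
  -- the edges of the cut at a small vertex
  have hsmall : ∀ w, IsSmall p q F S w → ∃ Y, (Y = A w ∨ Y = A' w) ∧ Y.card ≤ 1 ∧
      (∀ e ∈ boundary p q F Z, Inc p q w e → e ∈ Y) ∧
      (Y.Nonempty → (A w).Nonempty ∧ (A' w).Nonempty) := by
    intro w hw
    have hsum := card_filter_add_card_filter_not (s := star p q F w)
      (fun e => ∃ z ∈ Z0, Inc p q z e)
    have h3 := hw.2
    replace hsum : (A w).card + (A' w).card = (star p q F w).card := hsum
    have hother : ∀ e ∈ boundary p q F Z, Inc p q w e → (e ∈ A w ∧ w ∉ Z) ∨ (e ∈ A' w ∧ w ∈ Z) := by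
      intro e he hwe
      rw [mem_boundary, leaves_iff_exists] at he
      obtain ⟨he, a, b, ha, hb, haZ, hbZ⟩ := he
      have hab : a ≠ b := fun hh => hbZ (hh ▸ haZ)
      rcases inc_eq_or_eq ha hb hab hwe with rfl | rfl
      · refine Or.inr ⟨mem_filter.2 ⟨mem_star.2 ⟨he, hwe⟩, ?_⟩, haZ⟩
        rintro ⟨z, hz, hze⟩
        rcases inc_eq_or_eq ha hb hab hze with rfl | rfl
        · exact hZ0s _ hz hw
        · exact hbZ (Or.inl hz)
      · refine Or.inl ⟨mem_filter.2 ⟨mem_star.2 ⟨he, hwe⟩, a, ?_, ha⟩, hbZ⟩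
        exact (hZns a fun hs => hs.1 (h.not_small_of_inc he hb ha hab.symm hw)).1 haZ
    by_cases hwZ : w ∈ Z
    · have hlt := (hZs w hw).1 hwZ
      refine ⟨A' w, Or.inr rfl, by omega, fun e he hwe => ?_, fun hY => ⟨?_, hY⟩⟩
      · exact ((hother e he hwe).resolve_left fun hh => hh.2 hwZ).1
      · exact card_pos.1 (by omega)
    · have hlt := mt (hZs w hw).2 hwZ
      refine ⟨A w, Or.inl rfl, by omega, fun e he hwe => ?_, fun hY => ⟨hY, ?_⟩⟩
      · exact ((hother e he hwe).resolve_right fun hh => hwZ hh.2).1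
      · have := hY.card_pos
        exact card_pos.1 (by omega)
  have hboth : ∀ e ∈ boundary p q F Z,
      (∃ b ∈ feet p q F S v (node p q F S e), b ∈ X) ∧
      (Touches p q F S v (node p q F S e) ∨
        ∃ b ∈ feet p q F S v (node p q F S e), b ∉ X) := by
    intro e he
    have heF := (mem_boundary.1 he).1
    rcases hne : node p q F S e with w | x
    · obtain ⟨hw, hwe⟩ := (h.node_eq_inl heF).1 hne
      obtain ⟨Y, -, -, hY, hY'⟩ := hsmall w hw
      obtain ⟨⟨e1, he1⟩, e2, he2⟩ := hY' ⟨e, hY e he hwe⟩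
      rw [mem_filter, mem_star] at he1 he2
      have hn1 := (h.node_eq_inl he1.1.1).2 ⟨hw, he1.1.2⟩
      have hn2 := (h.node_eq_inl he2.1.1).2 ⟨hw, he2.1.2⟩
      refine ⟨hn1 ▸ hfoot e1 he1.1.1 he1.2, ?_⟩
      obtain ⟨y, hyw, hy⟩ := exists_inc_ne (h.loopless e2 he2.1.1) w
      rw [← hn2]
      exact touches_or_feet he2.1.1 hy
        (fun hs => hs.1 (h.not_small_of_inc he2.1.1 he2.1.2 hy hyw.symm hw))
        fun hh => he2.2 ⟨y, hh, hy⟩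
    · have hx := (h.node_eq_inr heF).1 hne
      rw [← hne]
      rw [mem_boundary, leaves_iff_exists] at he
      obtain ⟨he, a, b, ha, hb, haZ, hbZ⟩ := he
      exact ⟨hfoot e he ⟨a, (hZns a (hx.2 a ha)).1 haZ, ha⟩,
        touches_or_feet he hb (hx.2 b hb) fun hh => hbZ (Or.inl hh)⟩
  refine card_le_crossing (filter_subset _ _) ?_ (fun e he => (hboth e he).1)
    fun e he => (hboth e he).2
  intro e he e' he' hn
  rcases h.eq_or_small (mem_boundary.1 he).1 (mem_boundary.1 he').1 hn with
    heq | ⟨w, -, hw, hwe, hwe'⟩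
  · exact heq
  · obtain ⟨Y, -, hY1, hY, -⟩ := hsmall w hw
    exact card_le_one.1 hY1 e (hY e he hwe) e' (hY e' he' hwe')

/-- A cut of the hypergraph with a vertex outside `S` on the terminal-free side. -/
theorem Independent.le_crossing_of_no_terminal {K : ℕ} (h : Independent p q F S v K)
    {X : Set (Big p q F S v)}
    (hX : ∀ b ∈ X, b.1 ∉ S) {r : Big p q F S v} (hr : r ∈ X) :
    (star p q F r.1).card ≤ (crossing (feet p q F S v) (farNodes p q F S v) X).card +
      (crossing (feet p q F S v) (nearNodes p q F S v) X).card +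
      (inside (feet p q F S v) (nearNodes p q F S v) X).card ∧
    (star p q F r.1).card ≤ 2 * (crossing (feet p q F S v) (farNodes p q F S v) X).card := by
  have hrS := hX r hr
  have hnode : ∀ e ∈ star p q F r.1, node p q F S e = Sum.inr e ∧ ∃ t ∈ S, Inc p q t e := by
    intro e he
    rw [mem_star] at he
    obtain ⟨t, ht, hte⟩ := h.covered e he.1
    refine ⟨(h.node_eq_inr he.1).2 ⟨rfl, fun w hw hs => ?_⟩, t, ht, hte⟩
    rcases inc_eq_or_eq he.2 hte (fun hh => hrS (hh ▸ ht)) hw with rfl | rfl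
    exacts [r.2.2 hs, hs.1 ht]
  have hinj : Set.InjOn (node p q F S) (star p q F r.1) := by
    intro e he e' he' hn
    rw [(hnode e he).1, (hnode e' he').1] at hn
    simpa using hn
  have hX1 : ∀ e ∈ star p q F r.1, ∃ b ∈ feet p q F S v (node p q F S e), b ∈ X :=
    fun e he => ⟨r, ⟨e, (mem_star.1 he).1, rfl, (mem_star.1 he).2⟩, hr⟩
  have hX2 : ∀ e ∈ star p q F r.1, Touches p q F S v (node p q F S e) ∨
      ∃ b ∈ feet p q F S v (node p q F S e), b ∉ X := by
    intro e he
    obtain ⟨-, t, ht, hte⟩ := hnode e he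
    refine touches_or_feet (mem_star.1 he).1 hte (fun hs => hs.1 ht) ?_
    rintro ⟨b, hb, rfl⟩
    exact hX b hb ht
  refine ⟨card_le_crossing (filter_subset _ _) hinj hX1 hX2, ?_⟩
  have hle := h.two_mul_numJoining_le hrS
  have hcard : (star p q F r.1 \ F.filter (Joins p q {r.1} {v})).card ≤
      (crossing (feet p q F S v) (farNodes p q F S v) X).card := by
    rw [← card_image_of_injOn (hinj.mono (coe_subset.2 sdiff_subset))]
    refine card_le_card fun n hn => ?_
    obtain ⟨e, he, rfl⟩ := mem_image.1 hn
    rw [mem_sdiff, mem_filter, not_and] at he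
    have heF := (mem_star.1 he.1).1
    have hnt : ¬ Touches p q F S v (node p q F S e) := by
      rintro ⟨e', he', hn', hv'⟩
      rw [(hnode e he.1).1] at hn'
      obtain rfl := ((h.node_eq_inr he').1 hn').1
      exact he.2 heF (joins_of_inc r.2.1 (mem_star.1 he.1).2 hv')
    simp only [crossing, farNodes, mem_filter]
    refine ⟨⟨mem_image_of_mem _ heF, hnt⟩, fun hone => ?_⟩
    obtain ⟨b, hb, hbX⟩ := hX1 e he.1
    obtain ⟨b', hb', hbX'⟩ := (hX2 e he.1).resolve_left hnt
    exact hbX' ((hone b hb b' hb').1 hbX)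
  have := le_card_sdiff (F.filter (Joins p q {r.1} {v})) (star p q F r.1)
  unfold numJoining at hle
  omega

end

section

variable {V E : Type} {p q : E → V} {F : Finset E} {k : ℕ} {S : Set V} {v : V}

theorem card_filter_add_card_filter_le {α β : Type} {f : β → α} {A B : Finset α}
    (hAB : Disjoint A B) {a b : α → Prop} {_ : DecidablePred a} {_ : DecidablePred b} {D : Finset β}
    (ha : ∀ n ∈ A, a n → ∃ e ∈ D, f e = n) (hb : ∀ n ∈ B, b n → ∃ e ∈ D, f e = n) :
    (A.filter a).card + (B.filter b).card ≤ D.card := by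
  rw [← card_union_of_disjoint (hAB.mono (filter_subset _ _) (filter_subset _ _))]
  refine (card_le_card fun n hn => ?_).trans (card_image_le (f := f))
  rw [mem_union, mem_filter, mem_filter] at hn
  rw [mem_image]
  exact hn.elim (fun h => ha n h.1 h.2) fun h => hb n h.1 h.2

/-- The case in which every edge has an end in `S`, and every other vertex has degree at most three
or is balanced without automatic reserve. -/
theorem goodColoring_of_independent [Finite V] (hk : 0 < k) {P : E → Fin k} {ρ : V → ℕ}
    (h : Independent p q F S v (36 * k))
    (hP : ∀ i, 2 ≤ ((star p q F v).filter fun e => P e = i).card)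
    (hbig : ∀ u ∉ S, 4 ≤ (star p q F u).card →
      34 * k ≤ (star p q F u).card + ρ u ∧ ρ u < 2 * k) :
    ∃ c, GoodColoring p q F S v P ρ c := by
  have : Finite (Big p q F S v) := inferInstanceAs (Finite {u : V // _})
  have : Fintype (Big p q F S v) := Fintype.ofFinite _
  have hterm : ∀ s, s ∈ S → s ≠ v → s ≠ v ∧ ¬ IsSmall p q F S s := fun s hs hsv =>
    ⟨hsv, fun hh => hh.1 hs⟩
  obtain ⟨s, hs, hsv⟩ := h.other
  have : Nonempty (Big p q F S v) := ⟨⟨s, hterm s hs hsv⟩⟩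
  obtain ⟨P', hP'⟩ : ∃ P' : V ⊕ E → Fin k, ∀ e ∈ star p q F v, P' (node p q F S e) = P e := by
    refine ⟨fun n => if hn : ∃ e ∈ star p q F v, node p q F S e = n then P hn.choose else
      ⟨0, hk⟩, fun e he => ?_⟩
    have hn : ∃ e' ∈ star p q F v, node p q F S e' = node p q F S e := ⟨e, he, rfl⟩
    refine (dif_pos hn).trans ?_
    exact congrArg P (h.node_injOn hn.choose_spec.1 he hn.choose_spec.2)
  have hnear : ∀ e ∈ star p q F v, node p q F S e ∈ nearNodes p q F S v := fun e he =>
    mem_filter.2 ⟨mem_image_of_mem _ (mem_star.1 he).1, e, (mem_star.1 he).1, rfl,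
      (mem_star.1 he).2⟩
  have hno : ∀ {X : Set (Big p q F S v)} {b}, b ∈ X → (¬ ∃ b ∈ X, b.1 ∈ S) →
      32 * k < (star p q F b.1).card ∧ ∀ b ∈ X, b.1 ∉ S := by
    intro X b hb hX
    push Not at hX
    have h1 : 4 ≤ (star p q F b.1).card := by
      by_contra hlt
      exact b.2.2 ⟨hX b hb, by omega⟩
    have := hbig b.1 (hX b hb) h1
    exact ⟨by omega, hX⟩
  obtain ⟨φ, home, full, hfull, hhome, hconn, hbal⟩ :=
    exists_balanced_packing k (farNodes p q F S v) (nearNodes p q F S v) (feet p q F S v) P'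
    (fun x _ => (h.ncard_feet_le x).1) (fun x hx => h.feet_nonempty (mem_filter.1 hx).2)
    (fun x hx => (h.ncard_feet_le x).2 (mem_filter.1 hx).2) h.card_nearNodes_le
    (fun i => by
      refine (hP i).trans ?_
      rw [← card_image_of_injOn (h.node_injOn.mono (coe_subset.2 (filter_subset _ _)))]
      refine card_le_card fun n hn => ?_
      obtain ⟨e, he, rfl⟩ := mem_image.1 hn
      rw [mem_filter] at he ⊢
      exact ⟨hnear e he.1, (hP' e he.1).trans he.2⟩)
    (fun X hX _ => by
      by_cases hXS : ∃ b ∈ X, b.1 ∈ S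
      · have := h.le_crossing_of_terminal hXS
        omega
      · obtain ⟨b, hb⟩ := hX
        obtain ⟨h1, h2⟩ := hno hb hXS
        have := (h.le_crossing_of_no_terminal h2 hb).1
        omega)
    (fun X hX _ => by
      by_cases hXS : ∃ b ∈ X, b.1 ∈ S
      · exact Or.inr (h.card_nearNodes_le.trans (h.le_crossing_of_terminal hXS))
      · obtain ⟨b, hb⟩ := hX
        obtain ⟨h1, h2⟩ := hno hb hXS
        have := (h.le_crossing_of_no_terminal h2 hb).2
        exact Or.inl (by omega))
  let c : E → Option (Fin k) := fun e =>
    if Inc p q v e then some (P e) else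
      if node p q F S e ∈ nearNodes p q F S v then
        if node p q F S e ∈ full ∨ Inc p q (home (node p q F S e)).1 e then
          some (P' (node p q F S e)) else none
      else φ (node p q F S e)
  have hcv : ∀ e, Inc p q v e → c e = some (P e) := fun e he => if_pos he
  have hfar : ∀ n ∈ farNodes p q F S v, ∀ e ∈ F, node p q F S e = n →
      ¬ Inc p q v e ∧ c e = φ n := by
    rintro n hn e he rfl
    have hnt := (mem_filter.1 hn).2
    have hv : ¬ Inc p q v e := fun hh => hnt ⟨e, he, rfl, hh⟩
    refine ⟨hv, ?_⟩
    simp only [c, if_neg hv]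
    exact if_neg fun hh => hnt (mem_filter.1 hh).2
  have hcn : ∀ n ∈ nearNodes p q F S v, ∀ e ∈ F, node p q F S e = n →
      (n ∈ full ∨ Inc p q (home n).1 e) → c e = some (P' n) := by
    rintro n hn e he rfl hor
    by_cases hv : Inc p q v e
    · rw [hcv e hv, hP' e (mem_star.2 ⟨he, hv⟩)]
    · simp only [c, if_neg hv, if_pos hn, if_pos hor]
  -- an edge at `v` without a small end has a single foot
  have hdirect : ∀ e ∈ F, Inc p q v e → ∀ b : Big p q F S v, Inc p q b.1 e →
      ∀ b' ∈ feet p q F S v (node p q F S e), b' = b := by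
    rintro e he hv b hb b' ⟨e', he', hn, hb'⟩
    rcases h.eq_or_small he' he hn with rfl | ⟨w, -, hw, -, hwe⟩
    · exact Subtype.ext ((inc_eq_or_eq hv hb b.2.1.symm hb').resolve_left b'.2.1)
    · rcases inc_eq_or_eq hv hb b.2.1.symm hwe with rfl | rfl
      exacts [absurd hw h.not_small, absurd hw b.2.2]
  have hlink : ∀ (C : Set V) (i : Fin k),
      (∀ e ∈ {e | e ∈ F ∧ c e = some i ∧ ¬ Inc p q v e}, (p e ∈ C ↔ q e ∈ C)) →
      ∀ e ∈ F, c e = some i → ¬ Inc p q v e → ∀ x y, Inc p q x e → Inc p q y e →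
        (x ∈ C ↔ y ∈ C) := by
    intro C i hC e he hei hve x y hx hy
    have := hC e ⟨he, hei, hve⟩
    rcases hx with rfl | rfl <;> rcases hy with rfl | rfl <;> tauto
  have hone : ∀ (C : Set V) (i : Fin k),
      (∀ e ∈ {e | e ∈ F ∧ c e = some i ∧ ¬ Inc p q v e}, (p e ∈ C ↔ q e ∈ C)) →
      ∀ n, (∀ e ∈ F, node p q F S e = n → c e = some i) →
      OneSided (Subtype.val ⁻¹' C) (feet p q F S v n) := by
    rintro C i hC n hn b ⟨e, he, rfl, hb⟩ b' ⟨e', he', hn', hb'⟩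
    have hfeet' : b' ∈ feet p q F S v (node p q F S e) := ⟨e', he', hn', hb'⟩
    have hfeet : b ∈ feet p q F S v (node p q F S e') := ⟨e, he, hn'.symm, hb⟩
    by_cases hv : Inc p q v e
    · rw [hdirect e he hv b hb b' hfeet']
    by_cases hv' : Inc p q v e'
    · rw [hdirect e' he' hv' b' hb' b hfeet]
    rcases h.eq_or_small he' he hn' with rfl | ⟨w, -, -, hwe', hwe⟩
    · exact hlink C i hC _ he (hn _ he rfl) hv _ _ hb hb'
    · exact (hlink C i hC e he (hn e he rfl) hv _ _ hb hwe).trans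
        (hlink C i hC e' he' (hn e' he' hn') hv' _ _ hwe' hb')
  refine ⟨c, fun e _ hv => hcv e hv, fun i x y hx hy C hC => ?_, fun u huv hdeg => ?_⟩
  · have hall : OneSided (Subtype.val ⁻¹' C : Set (Big p q F S v)) Set.univ := by
      refine hconn i _ (fun n hn hni => ?_) fun n hn hni => ?_
      · exact hone C i hC n fun e he hen => ((hfar n hn e he hen).2).trans hni
      · exact hone C i hC n fun e he hen =>
          (hcn n (hfull hn) e he hen (Or.inl hn)).trans (congrArg _ hni)
    have hrep : ∀ x, Att p q F S v P i x → ∃ b : Big p q F S v, x ∈ C ↔ b.1 ∈ C := by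
      rintro x ⟨hxv, hx⟩
      by_cases hxs : IsSmall p q F S x
      · obtain ⟨e, he, hve, hxe, hPe⟩ := hx.resolve_left hxs.1
        have hne := (h.node_eq_inl he).2 ⟨hxs, hxe⟩
        have hmem := hnear e (mem_star.2 ⟨he, hve⟩)
        obtain ⟨e', he', hn', hb'⟩ := hhome _ hmem
        have hPi : P' (node p q F S e) = i := (hP' e (mem_star.2 ⟨he, hve⟩)).trans hPe
        have hxe' := ((h.node_eq_inl he').1 (hn'.trans hne)).2
        refine ⟨home (node p q F S e), hlink C i hC e' he'
          ((hcn _ hmem e' he' hn' (Or.inr hb')).trans (congrArg _ hPi)) ?_ _ _ hxe' hb'⟩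
        intro hv'
        rcases inc_eq_or_eq hv' hxe' hxv.symm hb' with hh | hh
        exacts [(home (node p q F S e)).2.1 hh, (home (node p q F S e)).2.2 (hh ▸ hxs)]
      · exact ⟨⟨x, hxv, hxs⟩, Iff.rfl⟩
    obtain ⟨b, hb⟩ := hrep x hx
    obtain ⟨b', hb'⟩ := hrep y hy
    exact hb.trans ((hall b trivial b' trivial).trans hb'.symm)
  · by_cases hus : IsSmall p q F S u
    · have := hus.2
      exact bal_of_free (by omega)
    · let b : Big p q F S v := ⟨u, huv, hus⟩
      have hdisj : Disjoint (farNodes p q F S v) (nearNodes p q F S v) :=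
        Finset.disjoint_left.2 fun n hn hn' => (mem_filter.1 hn).2 (mem_filter.1 hn').2
      have hmem : ∀ {o : Option (Fin k)} {n e}, e ∈ F → node p q F S e = n → Inc p q u e →
          c e = o → ∃ e ∈ (star p q F u).filter fun e => c e = o, node p q F S e = n :=
        fun he hne hue hc => ⟨_, mem_filter.2 ⟨mem_star.2 ⟨he, hue⟩, hc⟩, hne⟩
      rcases hbal b with h2 | h2
      · refine bal_of_two_le _ fun i => (h2 i).trans
          (card_filter_add_card_filter_le (f := node p q F S) hdisj ?_ ?_)
        · rintro n hn ⟨hi, e, he, hne, hue⟩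
          exact hmem he hne hue ((hfar n hn e he hne).2.trans hi)
        · rintro n hn ⟨hi, ⟨e, he, hne, hue⟩, hor⟩
          refine hmem he hne hue ((hcn n hn e he hne ?_).trans (congrArg _ hi))
          rcases hor with hh | hh
          · exact Or.inr (hh ▸ hue)
          · exact Or.inl hh
      · refine bal_of_free ((h2.trans ?_).trans (Nat.le_add_right _ _))
        refine card_filter_add_card_filter_le (f := node p q F S) hdisj ?_ ?_
        · rintro n hn ⟨hi, e, he, hne, hue⟩
          exact hmem he hne hue ((hfar n hn e he hne).2.trans hi)
        · rintro n hn ⟨⟨e, he, hne, hue⟩, hnf, hnh⟩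
          refine hmem he hne hue ?_
          have hv : ¬ Inc p q v e := fun hv =>
            hnh (hdirect e he hv b hue _ (hne ▸ hhome n hn))
          have hh : ¬ Inc p q (home n).1 e := by
            intro hh
            obtain ⟨e0, he0, hn0, hv0⟩ := (mem_filter.1 hn).2
            have hbh : b.1 ≠ (home n).1 := fun hh => hnh (Subtype.ext hh.symm)
            rcases h.eq_or_small he he0 (hne.trans hn0.symm) with rfl | ⟨w, -, hw, hwe, -⟩
            · exact hv hv0
            · rcases inc_eq_or_eq hue hh hbh hwe with rfl | rfl
              exacts [hus hw, (home n).2.2 hw]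
          subst hne
          simp only [c, if_neg hv, if_pos hn]
          exact if_neg (not_or.2 ⟨hnf, hh⟩)

end

section

variable {V E : Type} {p q : E → V} {F : Finset E} {k : ℕ} {S : Set V}

/-- A separating set of minimum cut without inner edges contains a single terminal. -/
theorem KConn.isTrivialSet {K : ℕ} (hK : 0 < K) (hS : KConn p q F S K) {X : Set V}
    (ha : ∃ a ∈ S, a ∈ X) (hb : ∃ b ∈ S, b ∉ X) (hX : (boundary p q F X).card = K)
    (hin : ∀ e ∈ F, ¬ (p e ∈ X ∧ q e ∈ X)) : IsTrivialSet p q F S X := by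
  have hstar : ∀ t ∈ S, t ∈ X → boundary p q F X = star p q F t := by
    intro t ht htX
    have hsub : boundary p q F {t} ⊆ boundary p q F X := by
      intro e he
      have hi := (mem_star.1 (boundary_singleton_subset t he)).2
      rw [mem_boundary] at he ⊢
      refine ⟨he.1, ?_⟩
      have := hin e he.1
      unfold Leaves
      rcases hi with rfl | rfl <;> tauto
    obtain ⟨b, hbS, hbX⟩ := hb
    have h1 := hS {t} ⟨t, ht, rfl⟩ ⟨b, hbS, fun h => hbX (h ▸ htX)⟩
    have h2 : boundary p q F {t} = boundary p q F X := eq_of_subset_of_card_le hsub (by omega)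
    refine Subset.antisymm (h2 ▸ boundary_singleton_subset t) fun e he => ?_
    rw [mem_star] at he
    rw [mem_boundary]
    refine ⟨he.1, ?_⟩
    have := hin e he.1
    unfold Leaves
    rcases he.2 with rfl | rfl <;> tauto
  obtain ⟨t, ht, htX⟩ := ha
  refine ⟨t, ht, htX, fun s hs hsX => ?_, hin, hstar t ht htX⟩
  obtain ⟨e, he⟩ := card_pos.1 (hX ▸ hK)
  have h1 := (mem_star.1 (hstar t ht htX ▸ he)).2
  have h2 := (mem_star.1 (hstar s hs hsX ▸ he)).2
  have h3 := hin e (mem_boundary.1 he).1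
  by_contra hst
  apply h3
  rcases h1 with rfl | rfl <;> rcases h2 with rfl | rfl
  · exact absurd rfl hst
  · exact ⟨htX, hsX⟩
  · exact ⟨hsX, htX⟩
  · exact absurd rfl hst

/-- The extension theorem. -/
theorem extendable (hk : 0 < k) (n : ℕ) : Extendable k n := by
  induction n using Nat.strong_induction_on with
  | _ n ih =>
    intro V E _ p q F S v P ρ hn hv hs hS hd hP
    subst hn
    by_cases hdel : ∃ e ∈ F, KConn p q (F.erase e) S (36 * k)
    · obtain ⟨e, he, h⟩ := hdel
      exact goodColoring_of_erase ih hv hs hd hP he h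
    push Not at hdel
    by_cases htriv : ∀ X : Set V, (∃ a ∈ S, a ∈ X) → (∃ b ∈ S, b ∉ X) →
        (boundary p q F X).card = 36 * k → IsTrivialSet p q F S X ∨ IsTrivialSet p q F S Xᶜ
    · have hR : Reduced p q F S (36 * k) := by
        refine ⟨hS, fun e he hl => hdel e he fun X ha hb => ?_, htriv, fun e he => ?_⟩
        · refine (hS X ha hb).trans (card_le_card fun e' he' => ?_)
          rw [mem_boundary] at he' ⊢
          refine ⟨mem_erase.2 ⟨?_, he'.1⟩, he'.2⟩
          rintro rfl
          exact he'.2 (by rw [hl])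
        · have := hdel e he
          unfold KConn at this
          push Not at this
          obtain ⟨X, ha, hb, hlt⟩ := this
          have hsub : boundary p q (F.erase e) X = (boundary p q F X).erase e := by
            ext e'
            simp only [mem_boundary, mem_erase, and_assoc]
          rw [hsub] at hlt
          have hX := hS X ha hb
          have heX : e ∈ boundary p q F X := by
            by_contra h
            rw [erase_eq_of_notMem h] at hlt
            omega
          rw [card_erase_of_mem heX] at hlt
          have hc : (boundary p q F X).card = 36 * k := by omega
          rcases htriv X ha hb hc with ⟨t, ht, -, -, -, h⟩ | ⟨t, ht, -, -, -, h⟩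
          · exact ⟨t, ht, (mem_star.1 (h ▸ heX)).2, h ▸ hc⟩
          · rw [boundary_compl] at h
            exact ⟨t, ht, (mem_star.1 (h ▸ heX)).2, h ▸ hc⟩
      by_cases hw : ∃ w, w ∉ S ∧ 4 ≤ (star p q F w).card ∧
          (34 * k ≤ (star p q F w).card + ρ w → 2 * k ≤ ρ w)
      · obtain ⟨w, hwS, hdw, hbal⟩ := hw
        exact goodColoring_of_split ih hv hs hR hd hP hwS hdw hbal
      · push Not at hw
        exact goodColoring_of_independent hk ⟨hS, hR.loopless, fun e he => by
          obtain ⟨t, ht, hte, -⟩ := hR.covered e he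
          exact ⟨t, ht, hte⟩, hv, hs, hd⟩ hP hw
    · push Not at htriv
      obtain ⟨X, hvX, ha, hX, h1, h2⟩ : ∃ X : Set V, v ∉ X ∧ (∃ a ∈ S, a ∈ X) ∧
          (boundary p q F X).card = 36 * k ∧ ¬ IsTrivialSet p q F S X ∧
          ¬ IsTrivialSet p q F S Xᶜ := by
        obtain ⟨X, ha, hb, hX, h1, h2⟩ := htriv
        by_cases hvX : v ∈ X
        · exact ⟨Xᶜ, fun h => h hvX, hb, by rwa [boundary_compl], h2, by rwa [compl_compl]⟩
        · exact ⟨X, hvX, ha, hX, h1, h2⟩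
      have hin : ∃ e ∈ F, p e ∈ X ∧ q e ∈ X := by
        by_contra h
        push Not at h
        exact h1 (hS.isTrivialSet (by omega) ha ⟨v, hv, hvX⟩ hX fun e he h' => h e he h'.1 h'.2)
      have hout : ∃ e ∈ F, p e ∉ X ∧ q e ∉ X := by
        by_contra h
        push Not at h
        obtain ⟨a, ha, haX⟩ := ha
        exact h2 (hS.isTrivialSet (by omega) ⟨v, hv, hvX⟩ ⟨a, ha, fun h => h haX⟩
          (by rwa [boundary_compl]) fun e he h' => h'.2 (h e he h'.1))
      obtain ⟨x0, hx0, hx0X⟩ := ha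
      exact goodColoring_of_tight hk ih hv hS hd hP hvX hx0 hx0X hX hin hout

end

section

variable {V E : Type} {k : ℕ}

/-- Packing Steiner forests: `k` colour classes, each connecting every `S j`, that are balanced at
all vertices of large degree outside the `S j`. -/
theorem exists_forest_coloring [Finite V] (hk : 0 < k) {ι : Type} (S : ι → Set V) (n : ℕ) :
    ∀ (J : Finset ι), J.card = n → (∀ j ∈ J, (S j).Nonempty) →
      ∀ (p q : E → V) (F : Finset E), (∀ j ∈ J, KConn p q F (S j) (36 * k)) →
      ∃ c : E → Option (Fin k), (∀ j ∈ J, ∀ i, ∀ a ∈ S j, ∀ b ∈ S j,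
        Linked p q {e | e ∈ F ∧ c e = some i} a b) ∧
      ∀ u, (∀ j ∈ J, u ∉ S j) → 34 * k ≤ (star p q F u).card → Bal c (star p q F u) 0 := by
  induction n using Nat.strong_induction_on with
  | _ n ih =>
    intro J hn hne p q F hS
    subst hn
    rcases J.eq_empty_or_nonempty with rfl | ⟨j1, hj1⟩
    · refine ⟨fun _ => none, by simp, fun u _ hu => bal_of_free ?_⟩
      rw [filter_true_of_mem fun _ _ => rfl]
      omega
    obtain ⟨X, ⟨hXcard, j0, hj0, hj0X⟩, hmin⟩ := Set.Finite.exists_minimal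
      (s := {X | (boundary p q F X).card < 36 * k ∧ ∃ j ∈ J, S j ⊆ X}) (Set.toFinite _)
      ⟨Set.univ, by
        refine ⟨?_, j1, hj1, Set.subset_univ _⟩
        rw [boundary, filter_false_of_mem fun e _ => by simp [Leaves]]
        simpa using hk⟩
    have hcase : ∀ j ∈ J, ¬ S j ⊆ X → ∀ a ∈ S j, a ∉ X := by
      intro j hj hjX a ha haX
      obtain ⟨b, hb, hbX⟩ := Set.not_subset.1 hjX
      have := hS j hj X ⟨a, ha, haX⟩ ⟨b, hb, hbX⟩
      omega
    obtain ⟨x0, hx0⟩ := hne j0 hj0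
    have hx0X := hj0X hx0
    have hout : ∀ j ∈ J.filter fun j => ¬ S j ⊆ X, j ∈ J ∧ ∀ a ∈ S j, a ∉ X := by
      intro j hj
      rw [mem_filter] at hj
      exact ⟨hj.1, hcase j hj.1 hj.2⟩
    obtain ⟨c0, hc0l, hc0b⟩ := ih _
      (card_lt_card (filter_ssubset.2 ⟨j0, hj0, fun h => h hj0X⟩)) (J.filter fun j => ¬ S j ⊆ X) rfl
      (fun j hj => hne j (hout j hj).1)
      (contract X x0 ∘ p) (contract X x0 ∘ q) (outer p q F X) (by
        rintro j hj Z ⟨a, ha, haZ⟩ ⟨b, hb, hbZ⟩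
        rw [boundary_contract]
        obtain ⟨hjJ, hjX⟩ := hout j hj
        exact hS j hjJ _
          ⟨a, ha, by rwa [Set.mem_preimage, contract_of_notMem (hjX a ha)]⟩
          ⟨b, hb, by rwa [Set.mem_preimage, contract_of_notMem (hjX b hb)]⟩)
    obtain ⟨c, hcout, hcl, hcb⟩ := exists_extension_inside hk (fun m _ => extendable hk m) (X := X)
      (T := {a | ∃ j ∈ J, S j ⊆ X ∧ a ∈ S j}) (p := p) (q := q) (F := F) (x0 := x0) (c0 := c0)
      (fun a ⟨j, _, hjX, ha⟩ => hjX ha) ⟨j0, hj0, hj0X, hx0⟩ hXcard.le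
      (fun Y hYX hne ⟨a, ⟨j, hj, hjX, ha⟩, haY⟩ => by
        by_cases hjY : S j ⊆ Y
        · by_contra hlt
          exact hne (hYX.antisymm (hmin ⟨not_le.1 hlt, j, hj, hjY⟩ hYX))
        · obtain ⟨b, hb, hbY⟩ := Set.not_subset.1 hjY
          exact hS j hj Y ⟨a, ha, haY⟩ ⟨b, hb, hbY⟩)
      (fun _ => 0) (by
        by_cases hlarge : 34 * k ≤ (boundary p q F X).card
        · have h := hc0b x0 (fun j hj hx => (hout j hj).2 x0 hx hx0X)
            (by rwa [star_contract_self hx0X])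
          rw [star_contract_self hx0X] at h
          exact h.of_counts (fun _ => le_rfl) (by omega)
        · exact bal_of_free (by omega)) (Nat.lt_succ_self _)
    refine ⟨c, fun j hj i a ha b hb => ?_, fun u hu hdeg => ?_⟩
    · by_cases hjX : S j ⊆ X
      · exact (hcl i a b ⟨hjX ha, Or.inl ⟨j, hj, hjX, ha⟩⟩ ⟨hjX hb, Or.inl ⟨j, hj, hjX, hb⟩⟩).mono
          fun e he => ⟨he.1, he.2.2⟩
      · have haX := hcase j hj hjX a ha
        have hbX := hcase j hj hjX b hb
        have h := hc0l j (mem_filter.2 ⟨hj, hjX⟩) i a ha b hb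
        refine (Linked.of_contract (x := x0) (X := X) (p := p) (q := q)
          (A := {a | a ∈ X ∧ (a ∈ {a | ∃ j ∈ J, S j ⊆ X ∧ a ∈ S j} ∨
            ∃ e ∈ boundary p q F X, Inc p q a e ∧ c0 e = some i)})
          (T := {e | e ∈ outer p q F X ∧ c0 e = some i})
          (T' := {e | e ∈ F ∧ (p e ∈ X ∧ q e ∈ X) ∧ c e = some i})
          ⟨hx0X, Or.inl ⟨j0, hj0, hj0X, hx0⟩⟩ (fun a ha b hb => hcl i a b ha hb)
          (fun e he y hy hyX => ⟨hyX, Or.inr ⟨e, ?_, hy, he.2⟩⟩)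
          (fun h => absurd h haX) (fun h => absurd h hbX)
          (by rwa [contract_of_notMem haX, contract_of_notMem hbX])).mono ?_
        · have he1 := mem_outer.1 he.1
          refine mem_boundary.2 ⟨he1.1, ?_⟩
          unfold Leaves
          rcases hy with rfl | rfl <;> tauto
        · rintro e (⟨he, hei⟩ | ⟨he, -, hei⟩)
          · rw [mem_outer] at he
            exact ⟨he.1, (hcout e he.2).trans hei⟩
          · exact ⟨he, hei⟩
    · by_cases huX : u ∈ X
      · exact hcb u huX (fun ⟨j, hj, _, huj⟩ => absurd huj (hu j hj)) hdeg
      · have hst := star_contract (p := p) (q := q) (F := F) hx0X huX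
        have h := hc0b u (fun j hj => hu j (hout j hj).1) (by rwa [hst])
        rw [hst] at h
        refine h.of_counts (fun i => card_le_card fun e he => ?_) le_rfl
        rw [mem_filter] at he ⊢
        refine ⟨he.1, ?_⟩
        rw [← hcout e fun h' => ?_]
        · exact he.2
        · rcases (mem_star.1 he.1).2 with h2 | h2
          · exact huX (h2 ▸ h'.1)
          · exact huX (h2 ▸ h'.2)

end

theorem IsWalk.exists_leaving {ends : E → Sym2 V} {a b : V} {l : List E} (h : IsWalk ends a b l)
    {X : Set V} (ha : a ∈ X) (hb : b ∉ X) : ∃ e ∈ l, ∃ x y, ends e = s(x, y) ∧ x ∈ X ∧ y ∉ X := by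
  induction h with
  | nil v => exact absurd ha hb
  | @cons u v w e l he _ ih =>
    by_cases hv : v ∈ X
    · obtain ⟨e', he', h⟩ := ih hv hb
      exact ⟨e', List.mem_cons_of_mem _ he', h⟩
    · exact ⟨e, List.mem_cons_self, u, v, he, ha, hv⟩

theorem EdgeConnectedIn.kConn [Fintype E] {ends : E → Sym2 V} {p q : E → V}
    (hpq : ∀ e, ends e = s(p e, q e)) {S : Set V} {n : ℕ}
    (h : EdgeConnectedIn ends Set.univ S n) : KConn p q Finset.univ S n := by
  rintro X ⟨a, ha, haX⟩ ⟨b, hb, hbX⟩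
  obtain ⟨P, hP, hdisj⟩ := h a ha b hb fun hab => hbX (hab ▸ haX)
  have hex : ∀ i, ∃ e ∈ P i, e ∈ boundary p q Finset.univ X := by
    intro i
    obtain ⟨e, he, x, y, hxy, hx, hy⟩ := (hP i).1.exists_leaving haX hbX
    refine ⟨e, he, mem_boundary.2 ⟨mem_univ _, ?_⟩⟩
    unfold Leaves
    rw [hpq, Sym2.eq_iff] at hxy
    rcases hxy with ⟨rfl, rfl⟩ | ⟨rfl, rfl⟩ <;> tauto
  choose f hf hfb using hex
  have hinj : Function.Injective f := fun i j hij => by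
    by_contra hne
    exact hdisj i j hne (f i) (hf i) (hij ▸ hf j)
  simpa using card_le_card_of_injOn f (s := Finset.univ) (fun i _ => hfb i) hinj.injOn

theorem Linked.reaches {ends : E → Sym2 V} {p q : E → V} (hpq : ∀ e, ends e = s(p e, q e))
    {T : Set E} {a b : V} (h : Linked p q T a b) : Reaches ends T a b :=
  (h {x | Reaches ends T a x} fun e he =>
    ⟨fun hp => Relation.ReflTransGen.tail hp ⟨e, he, hpq e⟩,
      fun hq => Relation.ReflTransGen.tail hq ⟨e, he, (hpq e).trans Sym2.eq_swap⟩⟩).1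
    Relation.ReflTransGen.refl

theorem incEdges_eq_star [Fintype E] {ends : E → Sym2 V} {p q : E → V}
    (hpq : ∀ e, ends e = s(p e, q e)) (u : V) : incEdges ends u = star p q Finset.univ u := by
  ext e
  simp [incEdges, hpq, mem_star, Inc, eq_comm]

theorem Bal.balanceVertex [Fintype E] {ends : E → Sym2 V} {p q : E → V}
    (hpq : ∀ e, ends e = s(p e, q e)) {k : ℕ} (hk : 0 < k) {c : E → Option (Fin k)} {u : V}
    (h : Bal c (star p q Finset.univ u) 0) :
    BalanceVertex ends (fun i : Fin k => {e | c e = some i}) u := by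
  obtain ⟨P, hP, hcard⟩ := h.exists_total hk
  have hu := incEdges_eq_star hpq u
  refine ⟨⟨fun i => Set.inter_subset_left, fun i j hij => Set.disjoint_left.2 ?_⟩,
    fun i => {e | e ∈ incEdges ends u ∧ P e = i}, ⟨⟨fun i e he => he.1, fun i j hij =>
      Set.disjoint_left.2 ?_⟩, ?_, fun i => ?_⟩, fun i e he => ⟨he.1, ?_⟩⟩
  · rintro e ⟨-, hi⟩ ⟨-, hj⟩
    exact hij (Option.some.inj (hi.symm.trans hj))
  · rintro e ⟨-, hi⟩ ⟨-, hj⟩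
    exact hij (hi.symm.trans hj)
  · ext e
    simp
  · rw [hu]
    refine (hcard i).trans_eq ?_
    rw [← Set.ncard_coe_finset]
    congr 1
    ext e
    simp
  · exact hP e (by rw [← mem_coe, ← hu]; exact he.1) i he.2

end

/-- (Steiner Forest Packing) If `G` is loopless, the pairwise
vertex-disjoint sets `S 1, …, S t` are each `36k`-edge-connected with
`|S i| ≥ 2`, `(⋃ S i) ∩ R = ∅`, and every vertex of `R` is incident to at
least `34k` edges, then there are `k` pairwise edge-disjoint
`(S 1, …, S t)`-subgraphs of `G` that balance `R`. -/
theorem steiner_forest_packing_balance {V E : Type} [Fintype V] [Fintype E]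
    (ends : E → Sym2 V) (hG : Loopless ends)
    (k t : ℕ) (hk : 0 < k) (S : Fin t → Set V) (R : Set V)
    (hSR : ∀ i, Disjoint (S i) R)
    (hdisj : ∀ i j, i ≠ j → Disjoint (S i) (S j))
    (hcard : ∀ i, 2 ≤ (S i).ncard)
    (hconn : ∀ i, EdgeConnectedIn ends Set.univ (S i) (36 * k))
    (hR : ∀ r ∈ R, 34 * k ≤ deg ends r) :
    ∃ H : Fin k → Set E, PairwiseEdgeDisjoint H ∧
      (∀ j : Fin k, ∀ i : Fin t, ConnectsSet ends (H j) (S i)) ∧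
      BalanceSet ends H R := by
  classical
  have hex : ∀ e, ∃ x : V × V, ends e = s(x.1, x.2) := fun e =>
    Sym2.ind (fun a b => ⟨(a, b), rfl⟩) (ends e)
  choose f hf using hex
  obtain ⟨c, hl, hb⟩ := exists_forest_coloring hk S _ Finset.univ rfl
    (fun i _ => Set.nonempty_of_ncard_ne_zero (by have := hcard i; omega))
    (fun e => (f e).1) (fun e => (f e).2) Finset.univ
    (fun i _ => (hconn i).kConn hf)
  refine ⟨fun i => {e | c e = some i}, fun i j hij => Set.disjoint_left.2 fun e hi hj =>
    hij (Option.some.inj (hi.symm.trans hj)), fun i j a ha b hb' =>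
    ((hl j (Finset.mem_univ _) i a ha b hb').mono fun e he => he.2).reaches hf,
    fun r hr => (hb r (fun i _ hi => Set.disjoint_left.1 (hSR i) hi hr) ?_).balanceVertex hf hk⟩
  have := hR r hr
  rwa [deg, incEdges_eq_star hf, Set.ncard_coe_finset] at this

end SteinerPacking
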